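/- Self-improving regularity for the strongly coupled nonlocal system: Let s ∈ (0,1), p ≥ 2, d ≥ 2, let Ω ⊂ ℝ^d be a bounded domain, and let A : ℝ^d × ℝ^d → ℝ be measurable with α₁ ≤ A(x,y) ≤ α₂ for constants 0 < α₁ ≤ α₂ and with A(x,y) = A(y,x). Then there exists ε₀ > 0 such that the following holds for every ε ∈ (0, ε₀): suppose u ∈ L^p(Ω; ℝ^d) with [u]_{𝒳^s_p(Ω)} < ∞, M ≥ 0, and F is a linear functional on C_c^∞(ℝ^d; ℝ^d) satisfying |F(φ)| ≤ M · (‖φ‖_{L^p(Ω)}^p + [φ]_{𝒳^{s−ε(p−1)}_p(Ω)}^p)^{1/p} for all φ, and suppose u is a weak solution, i.e. ⟨𝕃^s_{p,Ω} u, φ⟩ = F(φ) for all φ ∈ C_c^∞(ℝ^d; ℝ^d). Then for every η ∈ C_c^∞(Ω) the field ηu satisfies [ηu]_{W^{s+ε,p}(ℝ^d)} < ∞, and there exists a constant C > 0 (depending on d, s, p, ε, α₁, α₂, Ω, η but not on u, F) such that [ηu]_{W^{s+ε,p}(ℝ^d)} ≤ C · M^{1/(p−1)} + C · (‖u‖_{L^p(Ω)}^p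 + [u]_{𝒳^s_p(Ω)}^p)^{1/p}. -/

import Mathlib

open MeasureTheory Filter Set
open scoped ENNReal NNReal Topology

noncomputable section

abbrev Ed (d : ℕ) : Type := EuclideanSpace ℝ (Fin d)

/-- The `p`-th power of the projected Gagliardo seminorm `[f]_{𝒳^s_p(Ω)}^p`. -/
def projGagP (d : ℕ) (s p : ℝ) (Ω : Set (Ed d)) (f : Ed d → Ed d) : ℝ≥0∞ :=
  ∫⁻ x in Ω, ∫⁻ y in Ω,
    ENNReal.ofReal ((|(inner ℝ (f y - f x) (y - x) : ℝ)| / ‖y - x‖) ^ p /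
      ‖y - x‖ ^ ((d : ℝ) + s * p))

/-- The projected Gagliardo seminorm `[f]_{𝒳^s_p(Ω)}`. -/
def projSem (d : ℕ) (s p : ℝ) (Ω : Set (Ed d)) (f : Ed d → Ed d) : ℝ≥0∞ :=
  projGagP d s p Ω f ^ (1 / p)

/-- The `p`-th power of the Gagliardo seminorm `[f]_{W^{s,p}(Ω)}^p`. -/
def gagP (d : ℕ) (s p : ℝ) (Ω : Set (Ed d)) (f : Ed d → Ed d) : ℝ≥0∞ :=
  ∫⁻ x in Ω, ∫⁻ y in Ω,
    ENNReal.ofReal (‖f y - f x‖ ^ p / ‖y - x‖ ^ ((d : ℝ) + s * p))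

/-- The Gagliardo seminorm `[f]_{W^{s,p}(Ω)}`. -/
def gagSem (d : ℕ) (s p : ℝ) (Ω : Set (Ed d)) (f : Ed d → Ed d) : ℝ≥0∞ :=
  gagP d s p Ω f ^ (1 / p)

/-- The nonlocal (linearized) strain `𝒟(v)(x,y) = (v(x) − v(y))·(x − y)/|x − y|`. -/
def Dquot (d : ℕ) (v : Ed d → Ed d) (x y : Ed d) : ℝ :=
  (inner ℝ (v x - v y) (x - y) : ℝ) / ‖x - y‖

/-- The weak pairing `⟨𝕃^s_{p,O} u, φ⟩` associated with the nonlocal operator on `O`. -/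
def nlPairing (d : ℕ) (s p : ℝ) (A : Ed d → Ed d → ℝ) (O : Set (Ed d))
    (u φ : Ed d → Ed d) : ℝ :=
  ∫ x in O, ∫ y in O,
    |Dquot d u x y| ^ (p - 2) * Dquot d u x y * Dquot d φ x y * A x y /
      ‖x - y‖ ^ ((d : ℝ) + s * p)

noncomputable section SectA

lemma jensen_lint {α : Type*} [MeasurableSpace α] (μ : Measure α) {p : ℝ} (hp : 2 ≤ p)
    {w y : α → ℝ≥0∞} (hw : AEMeasurable w μ) (hy : AEMeasurable y μ) :
    (∫⁻ a, w a * y a ∂μ) ^ p ≤ (∫⁻ a, w a ∂μ) ^ (p - 1) * ∫⁻ a, w a * y a ^ p ∂μ := by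
  have hp0 : 0 < p := by linarith
  have hp1 : 0 < p - 1 := by linarith
  set q := p / (p - 1) with hq
  have hpq : q.HolderConjugate p := by
    rw [Real.holderConjugate_iff]
    constructor
    · rw [hq, lt_div_iff₀ hp1]; linarith
    · rw [hq]; field_simp; ring
  have hq0 : 0 < q := hpq.pos
  have h := ENNReal.lintegral_mul_le_Lp_mul_Lq μ hpq
    (f := fun a => w a ^ (1 / q)) (g := fun a => w a ^ (1 / p) * y a)
    (hw.pow_const _) ((hw.pow_const _).mul hy)
  have e1 : ∀ a, ((fun a => w a ^ (1 / q)) * (fun a => w a ^ (1 / p) * y a)) a = w a * y a := by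
    intro a
    simp only [Pi.mul_apply]
    rw [← mul_assoc, ← ENNReal.rpow_add_of_nonneg _ _ (by positivity) (by positivity)]
    have : 1 / q + 1 / p = 1 := by rw [hq]; field_simp; ring
    rw [this, ENNReal.rpow_one]
  have e2 : ∀ a, (w a ^ (1 / q)) ^ q = w a := by
    intro a
    rw [← ENNReal.rpow_mul, one_div_mul_cancel hq0.ne', ENNReal.rpow_one]
  have e3 : ∀ a, (w a ^ (1 / p) * y a) ^ p = w a * y a ^ p := by
    intro a
    rw [ENNReal.mul_rpow_of_nonneg _ _ hp0.le, ← ENNReal.rpow_mul, one_div_mul_cancel hp0.ne',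
      ENNReal.rpow_one]
  simp_rw [e1, e2, e3] at h
  calc _ ≤ _ := ENNReal.rpow_le_rpow h hp0.le
    _ = _ := by
      rw [ENNReal.mul_rpow_of_nonneg _ _ hp0.le, ← ENNReal.rpow_mul, ← ENNReal.rpow_mul,
        one_div_mul_cancel hp0.ne', ENNReal.rpow_one]
      congr 2
      rw [hq]; field_simp

lemma jensen_sum {ι : Type*} (S : Finset ι) {p : ℝ} (hp : 2 ≤ p) (w y : ι → ℝ≥0∞) :
    (∑ k ∈ S, w k * y k) ^ p ≤ (∑ k ∈ S, w k) ^ (p - 1) * ∑ k ∈ S, w k * y k ^ p := by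
  let _ : MeasurableSpace ι := ⊤
  have h := jensen_lint (Measure.count.restrict (S : Set ι)) hp (w := w) (y := y)
    measurable_from_top.aemeasurable measurable_from_top.aemeasurable
  simpa [lintegral_finset] using h

lemma add_rpow_le2 {p : ℝ} (hp : 2 ≤ p) (a b : ℝ≥0∞) :
    (a + b) ^ p ≤ 2 ^ p * (a ^ p + b ^ p) := by
  refine (ENNReal.rpow_add_le_mul_rpow_add_rpow a b (by linarith)).trans ?_
  gcongr
  · exact one_le_two
  · linarith

lemma young_pow {p : ℝ} (hp : 2 ≤ p) {κ a y : ℝ} (hκ : 0 < κ) (ha : 0 ≤ a) (hy : 0 ≤ y) :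
    a ^ (p - 1) * y ≤ κ * a ^ p + κ ^ (1 - p) * y ^ p := by
  have hp0 : p - 1 ≠ 0 := by linarith
  have e : ∀ x : ℝ, 0 ≤ x → x ^ p = x ^ (p - 1) * x := by
    intro x hx
    rcases hx.eq_or_lt with h | h
    · rw [← h, Real.zero_rpow (by linarith)]; simp
    · rw [Real.rpow_sub_one h.ne']; field_simp
  have h1 : 0 ≤ κ * a ^ p := by positivity
  have h2 : 0 ≤ κ ^ (1 - p) * y ^ p := by positivity
  rcases le_total y (κ * a) with h | h
  · have : a ^ (p - 1) * y ≤ κ * a ^ p := by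
      rw [e a ha]
      calc _ ≤ a ^ (p - 1) * (κ * a) := by gcongr
        _ = _ := by ring
    linarith
  · have : a ≤ y / κ := by rw [le_div_iff₀ hκ]; linarith
    have : a ^ (p - 1) * y ≤ κ ^ (1 - p) * y ^ p := by
      calc _ ≤ (y / κ) ^ (p - 1) * y := by
              gcongr
              linarith
        _ = _ := by
            rw [e y hy, Real.div_rpow hy hκ.le, show (1 - p) = -(p - 1) by ring,
              Real.rpow_neg hκ.le]
            ring
    linarith

variable {d : ℕ}

lemma lint_inner (hd : 2 ≤ d) {e : ℝ} (he : -(d : ℝ) < e) :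
    ∫⁻ h in Metric.closedBall (0 : Ed d) 1, ENNReal.ofReal (‖h‖ ^ e) < ∞ := by
  have h1 : IntegrableOn (fun h : Ed d => ‖h‖ ^ e) (Metric.ball 0 2) volume := by
    refine integrableOn_ball_of_norm_le_rpow (C := 1) (α := -e) ?_ ?_ ?_ ?_
    · simp; omega
    · simp; linarith
    · refine Eventually.of_forall fun x => ?_
      rw [Real.norm_of_nonneg (by positivity)]; simp
    · exact (by fun_prop : Measurable fun h : Ed d => ‖h‖ ^ e).aestronglyMeasurable
  have h2 := h1.mono_set (Metric.closedBall_subset_ball (x := (0 : Ed d)) (by norm_num : (1:ℝ) < 2))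
  have h3 := h2.2
  rw [hasFiniteIntegral_iff_ofReal (Eventually.of_forall fun x => by positivity)] at h3
  exact h3

lemma lint_outer {e : ℝ} (he : e < -(d : ℝ)) :
    ∫⁻ h in (Metric.closedBall (0 : Ed d) 1)ᶜ, ENNReal.ofReal (‖h‖ ^ e) < ∞ := by
  have h1 := finite_integral_one_add_norm (E := Ed d) (μ := volume) (r := -e) (by simp; linarith)
  have he0 : e < 0 := he.trans_le (by simp)
  calc _ ≤ ∫⁻ h in (Metric.closedBall (0 : Ed d) 1)ᶜ,
        ENNReal.ofReal (2 ^ (-e)) * ENNReal.ofReal ((1 + ‖h‖) ^ e) := by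
        refine setLIntegral_mono (by fun_prop) fun h hh => ?_
        rw [← ENNReal.ofReal_mul (by positivity)]
        apply ENNReal.ofReal_le_ofReal
        have hh1 : 1 < ‖h‖ := by simpa using hh
        rw [Real.rpow_neg (by norm_num), ← Real.inv_rpow (by norm_num), ← Real.mul_rpow (by norm_num) (by positivity)]
        apply Real.rpow_le_rpow_of_nonpos (by positivity) _ he0.le
        linarith
    _ ≤ ∫⁻ h : Ed d, ENNReal.ofReal (2 ^ (-e)) * ENNReal.ofReal ((1 + ‖h‖) ^ e) :=
        setLIntegral_le_lintegral _ _
    _ < ∞ := by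
        rw [lintegral_const_mul _ (by fun_prop)]
        refine ENNReal.mul_lt_top ENNReal.ofReal_lt_top ?_
        simpa using h1

lemma lint_linear (T : Ed d →ₗ[ℝ] Ed d) (hT : LinearMap.det T ≠ 0) (f : Ed d → ℝ≥0∞)
    (hf : Measurable f) :
    ∫⁻ h, f (T h) = ENNReal.ofReal |(LinearMap.det T)⁻¹| * ∫⁻ h, f h := by
  have hTm : Measurable T := (LinearMap.continuous_of_finiteDimensional T).measurable
  rw [← lintegral_map hf hTm, Measure.map_linearMap_addHaar_eq_smul_addHaar _ hT,
    lintegral_smul_measure, smul_eq_mul]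

lemma lint_smul {c : ℝ} (hc : 0 < c) (f : Ed d → ℝ≥0∞) (hf : Measurable f) :
    ∫⁻ h, f (c • h) = ENNReal.ofReal (c ^ (-(d : ℝ))) * ∫⁻ h, f h := by
  have := lint_linear (c • LinearMap.id) (by simp [LinearMap.det_smul, hc.ne']) f hf
  simp only [LinearMap.smul_apply, LinearMap.id_coe, id_eq, LinearMap.det_smul, LinearMap.det_id] at this
  rw [this]
  congr 2
  rw [abs_of_pos (by positivity)]
  simp [Real.rpow_neg hc.le]

end SectA

noncomputable section SectB
variable {d : ℕ}

/-- projected difference in the direction `h`. -/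
def DD (v : Ed d → Ed d) (x h : Ed d) : ℝ := (inner ℝ (v (x + h) - v x) h : ℝ) / ‖h‖

/-- weighted Gagliardo energy. -/
def En (p : ℝ) (W : Ed d → ℝ≥0∞) (v : Ed d → Ed d) : ℝ≥0∞ :=
  ∫⁻ h, ∫⁻ x, ‖v (x + h) - v x‖ₑ ^ p * W h

/-- weighted projected energy. -/
def Dn (p : ℝ) (W : Ed d → ℝ≥0∞) (v : Ed d → Ed d) : ℝ≥0∞ :=
  ∫⁻ h, ∫⁻ x, ‖DD v x h‖ₑ ^ p * W h

lemma DD_mul (v : Ed d → Ed d) (x h : Ed d) :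
    (inner ℝ (v (x + h) - v x) h : ℝ) = DD v x h * ‖h‖ := by
  unfold DD
  by_cases hh : h = 0
  · simp [hh]
  · have : ‖h‖ ≠ 0 := by simpa using hh
    field_simp

lemma abs_DD_le (v : Ed d → Ed d) (x h : Ed d) : |DD v x h| ≤ ‖v (x + h) - v x‖ := by
  unfold DD
  by_cases hh : h = 0
  · simp [hh]
  · have : 0 < ‖h‖ := by simpa using hh
    rw [abs_div, abs_norm, div_le_iff₀ this]
    exact abs_real_inner_le_norm _ _

lemma meas_DD {v : Ed d → Ed d} (hv : Measurable v) :
    Measurable fun q : Ed d × Ed d => DD v q.2 q.1 := by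
  unfold DD; fun_prop

/-- infinitesimal rotation in the plane `i j`. -/
def Rot (i j : Fin d) : Ed d →ₗ[ℝ] Ed d :=
  LinearMap.smulRight (EuclideanSpace.proj (𝕜 := ℝ) j).toLinearMap (EuclideanSpace.single i (1:ℝ)) -
  LinearMap.smulRight (EuclideanSpace.proj (𝕜 := ℝ) i).toLinearMap (EuclideanSpace.single j (1:ℝ))

lemma Rot_apply (i j : Fin d) (h : Ed d) :
    Rot i j h = h j • EuclideanSpace.single i (1:ℝ) - h i • EuclideanSpace.single j (1:ℝ) := by
  simp [Rot]

lemma inner_Rot (i j : Fin d) (v h : Ed d) : (inner ℝ v (Rot i j h) : ℝ) = v i * h j - v j * h i := by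
  rw [Rot_apply, inner_sub_right, inner_smul_right, inner_smul_right,
    EuclideanSpace.inner_single_right, EuclideanSpace.inner_single_right]
  simp
  ring

lemma norm_Rot_le (i j : Fin d) (h : Ed d) : ‖Rot i j h‖ ≤ 2 * ‖h‖ := by
  rw [Rot_apply]
  refine (norm_sub_le _ _).trans ?_
  rw [norm_smul, norm_smul]
  have h1 := PiLp.norm_apply_le h i
  have h2 := PiLp.norm_apply_le h j
  simp
  simp at h1 h2
  linarith

def ca : Fin 8 → ℝ := ![1, -1, 2, -2, 2, 2, 1, 1]
def cb : Fin 8 → ℝ := ![1, 1, 1, 1, 0, 0, 0, 0]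
def cs : Fin 8 → ℝ := ![0, 0, -1, 1, -1, -1, 0, -1]
def ct : Fin 8 → ℝ := ![0, 0, 0, 0, 1, 0, 0, 0]

def Tm (q : Fin d × Fin d × Fin 8) : Ed d →ₗ[ℝ] Ed d :=
  ca q.2.2 • LinearMap.id + cb q.2.2 • Rot q.1 q.2.1
def Sm (q : Fin d × Fin d × Fin 8) : Ed d →ₗ[ℝ] Ed d :=
  cs q.2.2 • LinearMap.id + ct q.2.2 • Rot q.1 q.2.1

lemma Tm_lower (q : Fin d × Fin d × Fin 8) (h : Ed d) : ‖h‖ ≤ ‖Tm q h‖ := by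
  have h1 : (inner ℝ h (Tm q h) : ℝ) = ca q.2.2 * ‖h‖ ^ 2 := by
    simp [Tm, inner_add_right, inner_smul_right, inner_Rot]
    right; ring
  have h2 : |(inner ℝ h (Tm q h) : ℝ)| ≤ ‖h‖ * ‖Tm q h‖ := abs_real_inner_le_norm _ _
  have h3 : 1 ≤ |ca q.2.2| := by
    obtain ⟨i, j, m⟩ := q
    fin_cases m <;> simp [ca]
  rw [h1, abs_mul, abs_of_nonneg (sq_nonneg ‖h‖)] at h2
  by_cases hh : h = 0
  · simp [hh]
  · have : 0 < ‖h‖ := by simpa using hh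
    nlinarith [mul_le_mul_of_nonneg_right h3 (sq_nonneg ‖h‖)]

lemma Tm_upper (q : Fin d × Fin d × Fin 8) (h : Ed d) : ‖Tm q h‖ ≤ 4 * ‖h‖ := by
  have h1 : |ca q.2.2| + 2 * |cb q.2.2| ≤ 4 := by
    obtain ⟨i, j, m⟩ := q
    fin_cases m <;> simp [ca, cb] <;> norm_num
  simp only [Tm, LinearMap.add_apply, LinearMap.smul_apply, LinearMap.id_coe, id_eq]
  refine (norm_add_le _ _).trans ?_
  rw [norm_smul, norm_smul, Real.norm_eq_abs, Real.norm_eq_abs]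
  have := norm_Rot_le q.1 q.2.1 h
  nlinarith [norm_nonneg h, abs_nonneg (cb q.2.2), mul_le_mul_of_nonneg_left this (abs_nonneg (cb q.2.2)),
    mul_le_mul_of_nonneg_right h1 (norm_nonneg h)]

lemma Tm_det (q : Fin d × Fin d × Fin 8) : LinearMap.det (Tm q) ≠ 0 := by
  have hinj : Function.Injective (Tm q) := by
    rw [injective_iff_map_eq_zero]
    intro h hh
    have := Tm_lower q h
    rw [hh, norm_zero] at this
    exact norm_le_zero_iff.1 this
  have : LinearMap.ker (Tm q) = ⊥ := LinearMap.ker_eq_bot.2 hinj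
  intro h0
  exact (LinearMap.bot_lt_ker_of_det_eq_zero h0).ne' this

lemma second_diff_rot (v : Ed d → Ed d) (x h l : Ed d) :
    (inner ℝ (v (x + h) - (2:ℝ) • v x + v (x - h)) l : ℝ) =
      inner ℝ (v (x + (h + l)) - v x) (h + l) + inner ℝ (v (x + (-h + l)) - v x) (-h + l)
      - inner ℝ (v (x - h + ((2:ℝ) • h + l)) - v (x - h)) ((2:ℝ) • h + l)
      - inner ℝ (v (x + h + (-(2:ℝ) • h + l)) - v (x + h)) (-(2:ℝ) • h + l)
      + 1 / 2 * inner ℝ (v (x + (-h + l) + (2:ℝ) • h) - v (x + (-h + l))) ((2:ℝ) • h)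
      + inner ℝ (v (x - h + (2:ℝ) • h) - v (x - h)) ((2:ℝ) • h) := by
  have e1 : x - h + ((2:ℝ) • h + l) = x + (h + l) := by module
  have e2 : x + h + (-(2:ℝ) • h + l) = x + (-h + l) := by module
  have e3 : x + (-h + l) + (2:ℝ) • h = x + (h + l) := by module
  have e4 : x - h + (2:ℝ) • h = x + h := by module
  rw [e1, e2, e3, e4]
  simp only [inner_add_left, inner_add_right, inner_sub_left, inner_smul_left, inner_smul_right,
    inner_neg_right]
  simp
  ring

lemma abs_eight (a b c e f g k l : ℝ) :
    |a + b - c - e + 1 / 2 * f + g| + |k - l| ≤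
      |a| + |b| + |c| + |e| + |f| + |g| + |k| + |l| := by
  have h1 : |a + b - c - e + 1 / 2 * f + g| ≤ |a| + |b| + |c| + |e| + |f| + |g| := by
    rw [abs_le]
    constructor <;> linarith [le_abs_self a, neg_abs_le a, le_abs_self b, neg_abs_le b,
      le_abs_self c, neg_abs_le c, le_abs_self e, neg_abs_le e, le_abs_self f, neg_abs_le f,
      le_abs_self g, neg_abs_le g]
  have h2 := abs_sub k l
  linarith

lemma second_diff_bound (v : Ed d → Ed d) (x h : Ed d) :
    ‖v (x + h) - (2:ℝ) • v x + v (x - h)‖ ≤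
      ∑ q : Fin d × Fin d × Fin 8, 4 * |DD v (x + Sm q h) (Tm q h)| := by
  set D := v (x + h) - (2:ℝ) • v x + v (x - h) with hD
  by_cases hh : h = 0
  · have : D = 0 := by rw [hD, hh]; simp; module
    rw [this, norm_zero]; positivity
  have hpos : 0 < ‖h‖ := by simpa using hh
  have hq : ∀ q : Fin d × Fin d × Fin 8, ∀ y k, y = x + Sm q h → k = Tm q h →
      |(inner ℝ (v (y + k) - v y) k : ℝ)| ≤ 4 * |DD v (x + Sm q h) (Tm q h)| * ‖h‖ := by
    rintro q y k rfl rfl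
    rw [DD_mul, abs_mul, abs_norm]
    have := Tm_upper q h
    nlinarith [abs_nonneg (DD v (x + Sm q h) (Tm q h))]
  have h1 : ∀ i j, |(inner ℝ D (Rot i j h) : ℝ)| + |(inner ℝ D h : ℝ)| ≤
      ∑ m : Fin 8, 4 * |DD v (x + Sm (i, j, m) h) (Tm (i, j, m) h)| * ‖h‖ := by
    intro i j
    have r0 := hq (i, j, 0) x (h + Rot i j h) (by simp [Sm, cs, ct]) (by simp [Tm, ca, cb])
    have r1 := hq (i, j, 1) x (-h + Rot i j h) (by simp [Sm, cs, ct]) (by simp [Tm, ca, cb])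
    have r2 := hq (i, j, 2) (x - h) ((2:ℝ) • h + Rot i j h) (by simp [Sm, cs, ct, sub_eq_add_neg])
      (by simp [Tm, ca, cb])
    have r3 := hq (i, j, 3) (x + h) (-(2:ℝ) • h + Rot i j h) (by simp [Sm, cs, ct])
      (by simp [Tm, ca, cb])
    have r4 := hq (i, j, 4) (x + (-h + Rot i j h)) ((2:ℝ) • h) (by simp [Sm, cs, ct])
      (by simp [Tm, ca, cb])
    have r5 := hq (i, j, 5) (x - h) ((2:ℝ) • h) (by simp [Sm, cs, ct, sub_eq_add_neg])
      (by simp [Tm, ca, cb])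
    have r6 := hq (i, j, 6) x h (by simp [Sm, cs, ct]) (by simp [Tm, ca, cb])
    have r7 := hq (i, j, 7) (x - h) h (by simp [Sm, cs, ct, sub_eq_add_neg])
      (by simp [Tm, ca, cb])
    have s1 := second_diff_rot v x h (Rot i j h)
    rw [← hD] at s1
    have s2 : (inner ℝ D h : ℝ) = inner ℝ (v (x + h) - v x) h -
        inner ℝ (v (x - h + h) - v (x - h)) h := by
      rw [hD, sub_add_cancel]
      simp only [inner_add_left, inner_sub_left, inner_smul_left]
      simp
      ring
    rw [s1, s2, Fin.sum_univ_eight]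
    exact (abs_eight _ _ _ _ _ _ _ _).trans (by linarith)
  have h2 : ∀ i, |D i| * ‖h‖ ≤ ∑ j, (|(inner ℝ D (Rot i j h) : ℝ)| + |(inner ℝ D h : ℝ)|) := by
    intro i
    have e : D i * ‖h‖ ^ 2 = ∑ j, (inner ℝ D (Rot i j h) : ℝ) * h j + (inner ℝ D h : ℝ) * h i := by
      rw [EuclideanSpace.norm_sq_eq, PiLp.inner_apply, Finset.mul_sum, Finset.sum_mul,
        ← Finset.sum_add_distrib]
      refine Finset.sum_congr rfl fun j _ => ?_
      rw [inner_Rot]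
      simp
      ring
    have hc : ∀ j, |h j| ≤ ‖h‖ := fun j => by simpa using PiLp.norm_apply_le h j
    have e2 : |D i| * ‖h‖ ^ 2 ≤ (∑ j, |(inner ℝ D (Rot i j h) : ℝ)| + |(inner ℝ D h : ℝ)|) * ‖h‖ := by
      rw [← abs_of_nonneg (sq_nonneg ‖h‖), ← abs_mul, e]
      refine (abs_add_le _ _).trans ?_
      rw [add_mul, Finset.sum_mul]
      refine add_le_add ((Finset.abs_sum_le_sum_abs _ _).trans (Finset.sum_le_sum fun j _ => ?_)) ?_
      · rw [abs_mul]; gcongr; exact hc j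
      · rw [abs_mul]; gcongr; exact hc i
    have e3 : |(inner ℝ D h : ℝ)| ≤ ∑ j : Fin d, |(inner ℝ D h : ℝ)| :=
      Finset.single_le_sum (f := fun _ : Fin d => |(inner ℝ D h : ℝ)|) (fun _ _ => abs_nonneg _) (Finset.mem_univ i)
    rw [Finset.sum_add_distrib]
    have : |D i| * ‖h‖ ≤ (∑ j, |(inner ℝ D (Rot i j h) : ℝ)| + |(inner ℝ D h : ℝ)|) := by
      refine le_of_mul_le_mul_right ?_ hpos
      calc _ = |D i| * ‖h‖ ^ 2 := by ring
        _ ≤ _ := e2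
    linarith
  have h3 : ‖D‖ ≤ ∑ i, |D i| := by
    rw [EuclideanSpace.norm_eq]
    refine Real.sqrt_le_iff.2 ⟨by positivity, ?_⟩
    simpa using Finset.sum_sq_le_sq_sum_of_nonneg (s := Finset.univ) (f := fun i => |D i|) (fun i _ => abs_nonneg _)
  refine le_of_mul_le_mul_right ?_ hpos
  calc ‖D‖ * ‖h‖ ≤ (∑ i, |D i|) * ‖h‖ := by gcongr
    _ = ∑ i, |D i| * ‖h‖ := by rw [Finset.sum_mul]
    _ ≤ ∑ i, ∑ j, ∑ m : Fin 8, 4 * |DD v (x + Sm (i, j, m) h) (Tm (i, j, m) h)| * ‖h‖ :=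
        Finset.sum_le_sum fun i _ => (h2 i).trans (Finset.sum_le_sum fun j _ => h1 i j)
    _ = _ := by
        rw [Finset.sum_mul, Fintype.sum_prod_type]
        refine Finset.sum_congr rfl fun i _ => ?_
        rw [Fintype.sum_prod_type]

end SectB

noncomputable section SectC
variable {d : ℕ}

lemma enorm_rpow {E : Type*} [NormedAddCommGroup E] (a : E) {p : ℝ} (hp : 0 ≤ p) :
    ‖a‖ₑ ^ p = ENNReal.ofReal (‖a‖ ^ p) := by
  rw [← ofReal_norm, ENNReal.ofReal_rpow_of_nonneg (norm_nonneg _) hp]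

lemma meas_En {p : ℝ} {v : Ed d → Ed d} (hv : Measurable v) {W : Ed d → ℝ≥0∞} (hW : Measurable W) :
    Measurable fun h => ∫⁻ x, ‖v (x + h) - v x‖ₑ ^ p * W h := by
  apply Measurable.lintegral_prod_right' (f := fun q : Ed d × Ed d => ‖v (q.2 + q.1) - v q.2‖ₑ ^ p * W q.1)
  fun_prop

lemma meas_Dn {p : ℝ} {v : Ed d → Ed d} (hv : Measurable v) {W : Ed d → ℝ≥0∞} (hW : Measurable W) :
    Measurable fun h => ∫⁻ x, ‖DD v x h‖ₑ ^ p * W h := by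
  apply Measurable.lintegral_prod_right' (f := fun q : Ed d × Ed d => ‖DD v q.2 q.1‖ₑ ^ p * W q.1)
  have := meas_DD hv
  fun_prop

lemma half_split {p t : ℝ} (hp : 2 ≤ p) (ht : 0 < t) (ht1 : t < 1) (X Y : ℝ≥0∞) :
    (2⁻¹ * X + 2⁻¹ * Y) ^ p ≤ ENNReal.ofReal (t ^ (1 - p) * 2 ^ (-p)) * X ^ p +
      ENNReal.ofReal ((1 - t) ^ (1 - p) * 2 ^ (-p)) * Y ^ p := by
  have key : ∀ t : ℝ, 0 < t → ∀ X : ℝ≥0∞, ENNReal.ofReal t * (ENNReal.ofReal (2 * t)⁻¹ * X) = 2⁻¹ * X := by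
    intro t ht X
    rw [← mul_assoc, ← ENNReal.ofReal_mul ht.le]
    congr 1
    have : t * (2 * t)⁻¹ = 2⁻¹ := by field_simp
    rw [this, ENNReal.ofReal_inv_of_pos (by norm_num)]; simp
  have key2 : ∀ t : ℝ, 0 < t → ∀ X : ℝ≥0∞, ENNReal.ofReal t * (ENNReal.ofReal (2 * t)⁻¹ * X) ^ p
      = ENNReal.ofReal (t ^ (1 - p) * 2 ^ (-p)) * X ^ p := by
    intro t ht X
    rw [ENNReal.mul_rpow_of_nonneg _ _ (by linarith), ← mul_assoc,
      ENNReal.ofReal_rpow_of_nonneg (by positivity) (by linarith), ← ENNReal.ofReal_mul ht.le]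
    congr 2
    rw [Real.inv_rpow (by positivity), Real.mul_rpow (by norm_num) ht.le, Real.rpow_sub ht,
      Real.rpow_neg (by norm_num), Real.rpow_one]
    field_simp
  have := jensen_sum Finset.univ hp (fun i : Fin 2 => ENNReal.ofReal (![t, 1 - t] i))
    (fun i : Fin 2 => ![ENNReal.ofReal (2 * t)⁻¹ * X, ENNReal.ofReal (2 * (1 - t))⁻¹ * Y] i)
  simp only [Fin.sum_univ_two, Matrix.cons_val_zero, Matrix.cons_val_one] at this
  rw [key t ht, key (1 - t) (by linarith), key2 t ht, key2 (1 - t) (by linarith),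
    ← ENNReal.ofReal_add ht.le (by linarith)] at this
  simpa using this

def cT (q : Fin d × Fin d × Fin 8) : ℝ≥0∞ := ENNReal.ofReal |(LinearMap.det (Tm q))⁻¹|

def CD (d : ℕ) (p : ℝ) (c : ℝ≥0∞) : ℝ≥0∞ :=
  (∑ _q : Fin d × Fin d × Fin 8, (4:ℝ≥0∞)) ^ (p - 1) * ∑ q : Fin d × Fin d × Fin 8, 4 * (c * cT q)

def CK (d : ℕ) (p σ : ℝ) (c : ℝ≥0∞) : ℝ≥0∞ :=
  ENNReal.ofReal (1 - 2 ^ (-(1 - σ)))⁻¹ *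
    (ENNReal.ofReal ((1 - 2 ^ (-(1 - σ))) ^ (1 - p) * 2 ^ (-p)) * CD d p c)

lemma CK_ne_top {p σ : ℝ} (hp : 2 ≤ p) {c : ℝ≥0∞} (hc : c ≠ ∞) : CK d p σ c ≠ ∞ := by
  unfold CK CD cT
  have : (∑ _q : Fin d × Fin d × Fin 8, (4:ℝ≥0∞)) ^ (p - 1) ≠ ∞ := by
    apply ENNReal.rpow_ne_top_of_nonneg (by linarith)
    exact ENNReal.sum_ne_top.2 fun _ _ => by simp
  have : ∑ q : Fin d × Fin d × Fin 8, 4 * (c * ENNReal.ofReal |(LinearMap.det (Tm q))⁻¹|) ≠ ∞ := by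
    refine ENNReal.sum_ne_top.2 fun _ _ => ?_
    finiteness
  finiteness

lemma lint2_sum {ι : Type*} [Fintype ι] (g : ι → Ed d × Ed d → ℝ≥0∞) (hg : ∀ q, Measurable (g q))
    (C a : ℝ≥0∞) :
    ∫⁻ h, ∫⁻ x, C * ∑ q, a * g q (h, x) = C * ∑ q, a * ∫⁻ h, ∫⁻ x, g q (h, x) := by
  have m5 : ∀ q h, Measurable fun x => g q (h, x) := fun q h => (hg q).comp measurable_prodMk_left
  have m6 : ∀ q, Measurable fun h => ∫⁻ x, g q (h, x) := fun q => (hg q).lintegral_prod_right'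
  have a1 : ∀ h, ∫⁻ x, C * ∑ q, a * g q (h, x) = C * ∑ q, a * ∫⁻ x, g q (h, x) := by
    intro h
    rw [lintegral_const_mul _ (Finset.measurable_sum _ fun q _ => (m5 q h).const_mul a),
      lintegral_finsetSum _ (fun q _ => (m5 q h).const_mul a)]
    congr 1
    exact Finset.sum_congr rfl fun q _ => lintegral_const_mul _ (m5 q h)
  simp_rw [a1]
  rw [lintegral_const_mul _ (Finset.measurable_sum _ fun q _ => (m6 q).const_mul a),
    lintegral_finsetSum _ (fun q _ => (m6 q).const_mul a)]
  congr 1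
  exact Finset.sum_congr rfl fun q _ => lintegral_const_mul _ (m6 q)

lemma second_energy {p : ℝ} (hp : 2 ≤ p) {W : Ed d → ℝ≥0∞} (hW : Measurable W) {c : ℝ≥0∞}
    (hW2 : ∀ h h', ‖h‖ ≤ ‖h'‖ → ‖h'‖ ≤ 4 * ‖h‖ → W h ≤ c * W h') {v : Ed d → Ed d} (hv : Measurable v) :
    ∫⁻ h, ∫⁻ x, ‖v (x + h) - (2:ℝ) • v x + v (x - h)‖ₑ ^ p * W h ≤ CD d p c * Dn p W v := by
  have hp0 : 0 ≤ p := by linarith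
  have m1 := meas_DD hv
  have m2 : ∀ T : Ed d →ₗ[ℝ] Ed d, Measurable T :=
    fun T => (LinearMap.continuous_of_finiteDimensional T).measurable
  have m3 : ∀ q : Fin d × Fin d × Fin 8,
      Measurable fun z : Ed d × Ed d => ‖DD v (z.2 + Sm q z.1) (Tm q z.1)‖ₑ ^ p * W z.1 := by
    intro q
    have := m2 (Tm q); have := m2 (Sm q)
    have h4 := m1.comp (by fun_prop : Measurable fun z : Ed d × Ed d => (Tm q z.1, z.2 + Sm q z.1))
    simp only [Function.comp_def] at h4
    fun_prop
  have step : ∀ q : Fin d × Fin d × Fin 8,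
      ∫⁻ h, ∫⁻ x, ‖DD v (x + Sm q h) (Tm q h)‖ₑ ^ p * W h ≤ c * cT q * Dn p W v := by
    intro q
    calc _ = ∫⁻ h, ∫⁻ x, ‖DD v x (Tm q h)‖ₑ ^ p * W h := by
          refine lintegral_congr fun h => ?_
          exact lintegral_add_right_eq_self (fun x => ‖DD v x (Tm q h)‖ₑ ^ p * W h) (Sm q h)
      _ ≤ ∫⁻ h, c * ∫⁻ x, ‖DD v x (Tm q h)‖ₑ ^ p * W (Tm q h) := by
          refine lintegral_mono fun h => ?_
          have m4 : Measurable fun x => ‖DD v x (Tm q h)‖ₑ ^ p * W (Tm q h) := by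
            have h4 := m1.comp (by fun_prop : Measurable fun x : Ed d => (Tm q h, x))
            simp only [Function.comp_def] at h4
            fun_prop
          simp only
          rw [← lintegral_const_mul _ m4]
          refine lintegral_mono fun x => ?_
          simp only
          calc _ ≤ ‖DD v x (Tm q h)‖ₑ ^ p * (c * W (Tm q h)) := by
                gcongr
                exact hW2 _ _ (Tm_lower q h) (Tm_upper q h)
            _ = _ := by ring
      _ = c * ∫⁻ h, ∫⁻ x, ‖DD v x (Tm q h)‖ₑ ^ p * W (Tm q h) := by
          rw [lintegral_const_mul]
          exact (meas_Dn hv hW).comp (m2 (Tm q))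
      _ = _ := by
          rw [lint_linear (Tm q) (Tm_det q) (fun h => ∫⁻ x, ‖DD v x h‖ₑ ^ p * W h) (meas_Dn hv hW)]
          unfold cT Dn; ring
  calc _ ≤ ∫⁻ h, ∫⁻ x, (∑ _q : Fin d × Fin d × Fin 8, (4:ℝ≥0∞)) ^ (p - 1) *
          ∑ q : Fin d × Fin d × Fin 8, 4 * (‖DD v (x + Sm q h) (Tm q h)‖ₑ ^ p * W h) := by
        refine lintegral_mono fun h => lintegral_mono fun x => ?_
        have h1 : ‖v (x + h) - (2:ℝ) • v x + v (x - h)‖ₑ ≤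
            ∑ q : Fin d × Fin d × Fin 8, 4 * ‖DD v (x + Sm q h) (Tm q h)‖ₑ := by
          have := ENNReal.ofReal_le_ofReal (second_diff_bound v x h)
          rw [ENNReal.ofReal_sum_of_nonneg (fun _ _ => by positivity)] at this
          rw [← ofReal_norm]
          refine this.trans (le_of_eq ?_)
          refine Finset.sum_congr rfl fun q _ => ?_
          rw [ENNReal.ofReal_mul (by norm_num), ← ofReal_norm, Real.norm_eq_abs]; simp
        calc _ ≤ (∑ q : Fin d × Fin d × Fin 8, 4 * ‖DD v (x + Sm q h) (Tm q h)‖ₑ) ^ p * W h := by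
              gcongr
          _ ≤ ((∑ _q : Fin d × Fin d × Fin 8, (4:ℝ≥0∞)) ^ (p - 1) *
          ∑ q : Fin d × Fin d × Fin 8, 4 * (‖DD v (x + Sm q h) (Tm q h)‖ₑ ^ p)) * W h := by
              gcongr; exact jensen_sum _ hp _ _
          _ = _ := by
              rw [mul_assoc, Finset.sum_mul]; simp only [mul_assoc]
    _ = (∑ _q : Fin d × Fin d × Fin 8, (4:ℝ≥0∞)) ^ (p - 1) *
          ∑ q : Fin d × Fin d × Fin 8, 4 * ∫⁻ h, ∫⁻ x, (‖DD v (x + Sm q h) (Tm q h)‖ₑ ^ p * W h) := by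
        exact lint2_sum (fun q z => ‖DD v (z.2 + Sm q z.1) (Tm q z.1)‖ₑ ^ p * W z.1) m3 _ _
    _ ≤ (∑ _q : Fin d × Fin d × Fin 8, (4:ℝ≥0∞)) ^ (p - 1) *
          ∑ q : Fin d × Fin d × Fin 8, 4 * (c * cT q * Dn p W v) := by
        gcongr with q _
        exact step q
    _ = _ := by
        unfold CD
        rw [mul_assoc, Finset.sum_mul]; simp only [mul_assoc]

lemma korn {p σ : ℝ} (hp : 2 ≤ p) (hσ : σ < 1) {W : Ed d → ℝ≥0∞} (hW : Measurable W) {c : ℝ≥0∞}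
    (hW1 : ∀ h : Ed d, W h ≤ ENNReal.ofReal (2 ^ (d + σ * p)) * W ((2:ℝ) • h))
    (hW2 : ∀ h h', ‖h‖ ≤ ‖h'‖ → ‖h'‖ ≤ 4 * ‖h‖ → W h ≤ c * W h') {v : Ed d → Ed d} (hv : Measurable v)
    (hfin : En p W v ≠ ∞) :
    En p W v ≤ CK d p σ c * Dn p W v := by
  have hp0 : 0 ≤ p := by linarith
  set t : ℝ := 2 ^ (-(1 - σ)) with htd
  have ht : 0 < t := by positivity
  have ht1 : t < 1 := Real.rpow_lt_one_of_one_lt_of_neg (by norm_num) (by linarith)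
  set E2 := ∫⁻ h, ∫⁻ x, ‖v (x + h) - (2:ℝ) • v x + v (x - h)‖ₑ ^ p * W h with hE2
  have hE2' : E2 ≤ CD d p c * Dn p W v := second_energy hp hW hW2 hv
  have hsym : ∫⁻ h, ∫⁻ x, ‖v (x + h) - v (x - h)‖ₑ ^ p * W h ≤
      ENNReal.ofReal (2 ^ (σ * p)) * En p W v := by
    calc _ = ∫⁻ h, ∫⁻ x, ‖v (x + (2:ℝ) • h) - v x‖ₑ ^ p * W h := by
          refine lintegral_congr fun h => ?_
          rw [← lintegral_add_right_eq_self (fun x => ‖v (x + h) - v (x - h)‖ₑ ^ p * W h) h]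
          refine lintegral_congr fun x => ?_
          rw [two_smul, add_assoc, add_sub_cancel_right]
      _ ≤ ∫⁻ h, ENNReal.ofReal (2 ^ (d + σ * p)) * ∫⁻ x, ‖v (x + (2:ℝ) • h) - v x‖ₑ ^ p * W ((2:ℝ) • h) := by
          refine lintegral_mono fun h => ?_
          simp only
          rw [← lintegral_const_mul _ (by fun_prop)]
          refine lintegral_mono fun x => ?_
          simp only
          calc _ ≤ ‖v (x + (2:ℝ) • h) - v x‖ₑ ^ p * (ENNReal.ofReal (2 ^ (d + σ * p)) * W ((2:ℝ) • h)) := by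
                gcongr; exact hW1 h
            _ = _ := by ring
      _ = ENNReal.ofReal (2 ^ (d + σ * p)) * (ENNReal.ofReal (2 ^ (-(d:ℝ))) * En p W v) := by
          have m := meas_En (p := p) hv hW
          rw [lintegral_const_mul]
          · rw [lint_smul (by norm_num : (0:ℝ) < 2) (fun h => ∫⁻ x, ‖v (x + h) - v x‖ₑ ^ p * W h) m]
            rfl
          · exact m.comp (by fun_prop : Measurable fun h : Ed d => (2:ℝ) • h)
      _ = _ := by
          rw [← mul_assoc, ← ENNReal.ofReal_mul (by positivity), ← Real.rpow_add (by norm_num)]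
          congr 3; ring
  have main : En p W v ≤ ENNReal.ofReal t * En p W v + ENNReal.ofReal ((1 - t) ^ (1 - p) * 2 ^ (-p)) * E2 := by
    calc En p W v ≤ ∫⁻ h, ∫⁻ x, (ENNReal.ofReal (t ^ (1 - p) * 2 ^ (-p)) * (‖v (x + h) - v (x - h)‖ₑ ^ p * W h) +
          ENNReal.ofReal ((1 - t) ^ (1 - p) * 2 ^ (-p)) * (‖v (x + h) - (2:ℝ) • v x + v (x - h)‖ₑ ^ p * W h)) := by
          refine lintegral_mono fun h => lintegral_mono fun x => ?_
          simp only
          rw [← mul_assoc, ← mul_assoc, ← add_mul]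
          gcongr
          refine le_trans ?_ (half_split hp ht ht1 _ _)
          gcongr
          have e : v (x + h) - v x = (2:ℝ)⁻¹ • (v (x + h) - v (x - h)) +
              (2:ℝ)⁻¹ • (v (x + h) - (2:ℝ) • v x + v (x - h)) := by
            module
          rw [e]
          refine (enorm_add_le _ _).trans (le_of_eq ?_)
          rw [enorm_smul, enorm_smul]
          have : ‖(2:ℝ)⁻¹‖ₑ = 2⁻¹ := by
            rw [← ofReal_norm, Real.norm_of_nonneg (by norm_num), ENNReal.ofReal_inv_of_pos (by norm_num)]; simp
          rw [this]
      _ = ENNReal.ofReal (t ^ (1 - p) * 2 ^ (-p)) * (∫⁻ h, ∫⁻ x, ‖v (x + h) - v (x - h)‖ₑ ^ p * W h) +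
           ENNReal.ofReal ((1 - t) ^ (1 - p) * 2 ^ (-p)) * E2 := by
          have m1 : Measurable fun h => ∫⁻ x, ‖v (x + h) - v (x - h)‖ₑ ^ p * W h := by
            apply Measurable.lintegral_prod_right' (f := fun q : Ed d × Ed d => ‖v (q.2 + q.1) - v (q.2 - q.1)‖ₑ ^ p * W q.1)
            fun_prop
          have m2 : Measurable fun h => ∫⁻ x, ‖v (x + h) - (2:ℝ) • v x + v (x - h)‖ₑ ^ p * W h := by
            apply Measurable.lintegral_prod_right' (f := fun q : Ed d × Ed d => ‖v (q.2 + q.1) - (2:ℝ) • v q.2 + v (q.2 - q.1)‖ₑ ^ p * W q.1)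
            fun_prop
          rw [hE2, ← lintegral_const_mul _ m1, ← lintegral_const_mul _ m2, ← lintegral_add_left (by fun_prop)]
          refine lintegral_congr fun h => ?_
          rw [lintegral_add_left (by fun_prop), lintegral_const_mul _ (by fun_prop),
            lintegral_const_mul _ (by fun_prop)]
      _ ≤ ENNReal.ofReal (t ^ (1 - p) * 2 ^ (-p)) * (ENNReal.ofReal (2 ^ (σ * p)) * En p W v) +
           ENNReal.ofReal ((1 - t) ^ (1 - p) * 2 ^ (-p)) * E2 := by gcongr
      _ = _ := by
          congr 1
          rw [← mul_assoc, ← ENNReal.ofReal_mul (by positivity)]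
          congr 2
          rw [htd, ← Real.rpow_mul (by norm_num), ← Real.rpow_add (by norm_num), ← Real.rpow_add (by norm_num)]
          congr 1; ring
  have h3 : ENNReal.ofReal (1 - t) * En p W v ≤ ENNReal.ofReal ((1 - t) ^ (1 - p) * 2 ^ (-p)) * E2 := by
    have e : En p W v = ENNReal.ofReal t * En p W v + ENNReal.ofReal (1 - t) * En p W v := by
      rw [← add_mul, ← ENNReal.ofReal_add ht.le (by linarith)]; simp
    rw [e] at main
    have hf : ENNReal.ofReal t * En p W v ≠ ∞ := by finiteness
    rw [← e] at main
    nth_rw 1 [e] at main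
    exact (ENNReal.add_le_add_iff_left hf).1 main
  calc En p W v = ENNReal.ofReal (1 - t)⁻¹ * (ENNReal.ofReal (1 - t) * En p W v) := by
        rw [← mul_assoc, ← ENNReal.ofReal_mul (inv_nonneg.2 (by linarith)), inv_mul_cancel₀ (by linarith)]; simp
    _ ≤ ENNReal.ofReal (1 - t)⁻¹ * (ENNReal.ofReal ((1 - t) ^ (1 - p) * 2 ^ (-p)) * (CD d p c * Dn p W v)) := by
        gcongr ENNReal.ofReal (1 - t)⁻¹ * ?_; exact h3.trans (by gcongr)
    _ = _ := by unfold CK; ring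

end SectC

noncomputable section SectW1
variable {d : ℕ}

def lam (N : ℕ) (r : ℝ) : ℕ := Nat.findGreatest (fun k => r * 2 ^ k ≤ 1) N

lemma lam_le (N : ℕ) (r : ℝ) : lam N r ≤ N := Nat.findGreatest_le N

lemma le_lam {N k : ℕ} {r : ℝ} (hk : k ≤ N) (h : r * 2 ^ k ≤ 1) : k ≤ lam N r :=
  Nat.le_findGreatest hk h

lemma lam_spec {N : ℕ} {r : ℝ} (h : lam N r ≠ 0) : r * 2 ^ (lam N r) ≤ 1 :=
  Nat.findGreatest_of_ne_zero (P := fun k => r * 2 ^ k ≤ 1) rfl h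

lemma lam_anti (N : ℕ) {r r' : ℝ} (h : r ≤ r') : lam N r' ≤ lam N r := by
  by_cases h0 : lam N r' = 0
  · omega
  · apply le_lam (lam_le _ _)
    exact (mul_le_mul_of_nonneg_right h (by positivity)).trans (lam_spec h0)

lemma le_lam_iff {N k : ℕ} {r : ℝ} (hr : 0 ≤ r) (hk1 : 1 ≤ k) (hk : k ≤ N) :
    k ≤ lam N r ↔ r * 2 ^ k ≤ 1 := by
  constructor
  · intro h
    have := lam_spec (N := N) (r := r) (by omega)
    refine le_trans ?_ this
    gcongr
    norm_num
  · exact le_lam hk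

lemma lam_two (N : ℕ) (r : ℝ) : lam N r ≤ lam N (2 * r) + 1 := by
  by_cases h0 : lam N r = 0
  · omega
  · have h1 := lam_spec h0
    have h2 := lam_le N r
    obtain ⟨j, hj⟩ := Nat.exists_eq_succ_of_ne_zero h0
    rw [hj] at h1 h2 ⊢
    have : j ≤ lam N (2 * r) := by
      apply le_lam (by omega)
      calc 2 * r * 2 ^ j = r * 2 ^ (j.succ) := by rw [pow_succ]; ring
        _ ≤ 1 := h1
    omega

lemma lam_four {N : ℕ} {r r' : ℝ} (h : r' ≤ 4 * r) : lam N r ≤ lam N r' + 2 := by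
  have h1 := lam_two N r
  have h2 := lam_two N (2 * r)
  have h3 := lam_anti N h
  have : 2 * (2 * r) = 4 * r := by ring
  rw [this] at h2
  omega

lemma lam_one_lt {N : ℕ} {r : ℝ} (h : 1 < r) : lam N r = 0 := by
  by_contra h0
  have h1 := lam_spec h0
  have h2 : (1:ℝ) ≤ 2 ^ lam N r := one_le_pow₀ (by norm_num)
  nlinarith

lemma lam_succ {N : ℕ} {r : ℝ} (h : lam N r < N) : 1 < r * 2 ^ (lam N r + 1) := by
  by_contra h0
  push Not at h0
  have := le_lam (N := N) (k := lam N r + 1) (by omega) h0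
  omega

/-- the weight -/
def om (θ : ℝ) (N : ℕ) (h : Ed d) : ℝ := θ ^ (lam N ‖h‖)

lemma om_one_le {θ : ℝ} (hθ : 1 ≤ θ) (N : ℕ) (h : Ed d) : 1 ≤ om θ N h := one_le_pow₀ hθ

lemma om_le {θ : ℝ} (hθ : 1 ≤ θ) (N : ℕ) (h : Ed d) : om θ N h ≤ θ ^ N :=
  pow_le_pow_right₀ hθ (lam_le _ _)

/-- the homogeneous kernel -/
def Ks (d : ℕ) (s p : ℝ) (h : Ed d) : ℝ := ‖h‖ ^ (-((d:ℝ) + s * p))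

lemma Ks_nonneg (s p : ℝ) (h : Ed d) : 0 ≤ Ks d s p h := by unfold Ks; positivity

lemma Ks_meas (s p : ℝ) : Measurable (Ks d s p) := by unfold Ks; fun_prop

lemma lam_meas (N : ℕ) : Measurable (lam N) := by
  have : Antitone (lam N) := fun a b h => lam_anti N h
  exact this.measurable

lemma om_meas (θ : ℝ) (N : ℕ) : Measurable (om (d := d) θ N) := by
  unfold om
  have := lam_meas N
  fun_prop

lemma om_two {θ : ℝ} (hθ : 1 ≤ θ) (N : ℕ) (h : Ed d) : om θ N h ≤ θ * om θ N ((2:ℝ) • h) := by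
  unfold om
  rw [norm_smul, ← pow_succ']
  apply pow_le_pow_right₀ hθ
  simpa using lam_two N ‖h‖

lemma om_four {θ : ℝ} (hθ : 1 ≤ θ) (N : ℕ) {h h' : Ed d} (hh : ‖h'‖ ≤ 4 * ‖h‖) :
    om θ N h ≤ θ ^ 2 * om θ N h' := by
  unfold om
  rw [← pow_add]
  apply pow_le_pow_right₀ hθ
  have := lam_four (N := N) hh
  omega

lemma om_pos {θ : ℝ} (hθ : 1 ≤ θ) (N : ℕ) (h : Ed d) : 0 < om θ N h :=
  lt_of_lt_of_le one_pos (om_one_le hθ N h)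

lemma om_eq_one {θ : ℝ} (N : ℕ) {h : Ed d} (hh : 1 < ‖h‖) : om θ N h = 1 := by
  unfold om; rw [lam_one_lt hh]; simp

lemma theta_pow (e : ℝ) (k : ℕ) : ((2:ℝ) ^ e) ^ k = ((2:ℝ) ^ k) ^ e := by
  rw [← Real.rpow_natCast, ← Real.rpow_natCast, ← Real.rpow_mul (by norm_num),
    ← Real.rpow_mul (by norm_num), mul_comm]

lemma om_le_rpow {e : ℝ} (he : 0 ≤ e) (N : ℕ) {h : Ed d} (h0 : h ≠ 0) (hh : ‖h‖ ≤ 1) :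
    om (2 ^ e) N h ≤ ‖h‖ ^ (-e) := by
  have hpos : 0 < ‖h‖ := by simpa using h0
  unfold om
  rw [theta_pow, Real.rpow_neg hpos.le, ← Real.inv_rpow hpos.le]
  apply Real.rpow_le_rpow (by positivity) _ he
  rw [le_inv_comm₀ (by positivity) hpos, ← one_div, le_div_iff₀ (by positivity)]
  by_cases hl : lam N ‖h‖ = 0
  · rw [hl]; simpa using hh
  · exact lam_spec hl

/-- lower bound for the weight -/
lemma om_lower {e : ℝ} (he : 0 ≤ e) {N k : ℕ} (hk : k ≤ N) (h : Ed d) :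
    ((2:ℝ) ^ e) ^ k ≤ 2 ^ e * om (2 ^ e) N h * (max 1 (2 ^ k * ‖h‖)) ^ e := by
  have hθ : (1:ℝ) ≤ 2 ^ e := Real.one_le_rpow (by norm_num) he
  have h1 : (1:ℝ) ≤ (max 1 (2 ^ k * ‖h‖)) ^ e := Real.one_le_rpow (le_max_left _ _) he
  unfold om
  rw [← pow_succ']
  by_cases hl : k ≤ lam N ‖h‖ + 1
  · calc ((2:ℝ) ^ e) ^ k ≤ (2 ^ e) ^ (lam N ‖h‖ + 1) * 1 := by
          rw [mul_one]; exact pow_le_pow_right₀ hθ hl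
      _ ≤ _ := by gcongr
  · push Not at hl
    have h2 := lam_succ (N := N) (r := ‖h‖) (by omega)
    obtain ⟨j, hj⟩ := Nat.exists_eq_add_of_le hl.le
    rw [hj, pow_add]
    gcongr
    rw [theta_pow]
    apply Real.rpow_le_rpow (by positivity) _ he
    refine le_trans ?_ (le_max_right _ _)
    rw [pow_add]
    have : (0:ℝ) < 2 ^ j := by positivity
    nlinarith

def Wt (d : ℕ) (s p θ : ℝ) (N : ℕ) (h : Ed d) : ℝ≥0∞ := ENNReal.ofReal (Ks d s p h * om θ N h)

lemma Wt_meas (s p θ : ℝ) (N : ℕ) : Measurable (Wt d s p θ N) := by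
  unfold Wt
  have := Ks_meas (d := d) s p
  have := om_meas (d := d) θ N
  fun_prop

lemma Ks_four {s p : ℝ} (he : 0 < (d:ℝ) + s * p) {h h' : Ed d} (hh : ‖h'‖ ≤ 4 * ‖h‖) (hl : ‖h‖ ≤ ‖h'‖) :
    Ks d s p h ≤ 4 ^ ((d:ℝ) + s * p) * Ks d s p h' := by
  unfold Ks
  by_cases h0 : h = 0
  · rw [h0, norm_zero, Real.zero_rpow (by linarith)]; positivity
  have hpos : 0 < ‖h‖ := by simpa using h0
  have hpos' : 0 < ‖h'‖ := hpos.trans_le hl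
  calc ‖h‖ ^ (-((d:ℝ) + s * p)) = 4 ^ ((d:ℝ) + s * p) * (4 * ‖h‖) ^ (-((d:ℝ) + s * p)) := by
        rw [Real.mul_rpow (by norm_num) hpos.le, ← mul_assoc, ← Real.rpow_add (by norm_num)]; simp
    _ ≤ _ := by
        gcongr ?_ * ?_
        exact Real.rpow_le_rpow_of_nonpos hpos' hh (by linarith)

lemma lint_le_of_trunc (f : Ed d → ℝ≥0∞) (B : ℝ≥0∞) (h0 : f 0 = 0)
    (δ : ℕ → ℝ) (hδ : Antitone δ) (hδ0 : Tendsto δ atTop (𝓝 0))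
    (h : ∀ n, ∫⁻ h in {h : Ed d | δ n < ‖h‖}, f h ≤ B) : ∫⁻ h, f h ≤ B := by
  have hU : (⋃ n, {h : Ed d | δ n < ‖h‖}) ⊇ {0}ᶜ := by
    intro z hz
    have hz : 0 < ‖z‖ := by simpa using hz
    obtain ⟨n, hn⟩ := (hδ0.eventually (gt_mem_nhds hz)).exists
    exact mem_iUnion.2 ⟨n, hn⟩
  have e : ∫⁻ h, f h = ∫⁻ h in (⋃ n, {h : Ed d | δ n < ‖h‖}), f h := by
    rw [← lintegral_indicator (MeasurableSet.iUnion fun n => measurableSet_lt measurable_const measurable_norm)]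
    refine lintegral_congr fun z => ?_
    by_cases hz : z = 0
    · rw [hz, h0]; simp [indicator, h0]
    · rw [indicator_of_mem (hU (by simpa using hz))]
  rw [e, setLIntegral_iUnion_of_directed]
  · exact iSup_le h
  · apply Monotone.directed_le
    intro n m hnm z hz
    exact (hδ hnm).trans_lt hz

lemma lint_Ks_trunc {s p : ℝ} (hsp : 0 < s * p) {δ : ℝ} (hδ : 0 < δ) :
    ∫⁻ h in {h : Ed d | δ < ‖h‖}, ENNReal.ofReal (Ks d s p h) < ∞ := by
  have e : {h : Ed d | δ < ‖h‖} ⊆ ({h : Ed d | δ < ‖h‖} ∩ Metric.closedBall 0 1) ∪ (Metric.closedBall 0 1)ᶜ := by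
    intro z hz
    by_cases h1 : z ∈ Metric.closedBall (0: Ed d) 1
    · left; exact ⟨hz, h1⟩
    · right; exact h1
  refine (lintegral_mono_set e).trans_lt ?_
  refine (lintegral_union_le _ _ _).trans_lt ?_
  refine ENNReal.add_lt_top.2 ⟨?_, lint_outer (by linarith)⟩
  calc _ ≤ ∫⁻ h in {h : Ed d | δ < ‖h‖} ∩ Metric.closedBall 0 1, ENNReal.ofReal (δ ^ (-((d:ℝ) + s * p))) := by
        refine setLIntegral_mono (by fun_prop) fun z hz => ?_
        apply ENNReal.ofReal_le_ofReal
        exact Real.rpow_le_rpow_of_nonpos hδ (le_of_lt hz.1) (by have : (0:ℝ) ≤ d := by positivity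
                                                                 linarith)
    _ < ∞ := by
        rw [setLIntegral_const]
        refine ENNReal.mul_lt_top (by simp) ?_
        exact (measure_mono inter_subset_right).trans_lt (measure_closedBall_lt_top)

lemma lint_diff_le {p : ℝ} (hp : 2 ≤ p) {v : Ed d → Ed d} (hv : Measurable v) (h : Ed d) :
    ∫⁻ x, ‖v (x + h) - v x‖ₑ ^ p ≤ 2 ^ p * (2 * ∫⁻ x, ‖v x‖ₑ ^ p) := by
  calc _ ≤ ∫⁻ x, 2 ^ p * (‖v (x + h)‖ₑ ^ p + ‖v x‖ₑ ^ p) := by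
        refine lintegral_mono fun x => ?_
        refine le_trans ?_ (add_rpow_le2 hp _ _)
        gcongr
        exact enorm_sub_le
    _ = _ := by
        rw [lintegral_const_mul _ (by fun_prop), lintegral_add_left (by fun_prop),
          lintegral_add_right_eq_self (fun x => ‖v x‖ₑ ^ p) h, two_mul]

def CKorn (d : ℕ) (s p : ℝ) : ℝ≥0∞ := CK d p ((1 + s) / 2) (ENNReal.ofReal (4 ^ ((d:ℝ) + s * p) * 4))

lemma CKorn_ne_top {s p : ℝ} (hp : 2 ≤ p) : CKorn d s p ≠ ∞ := CK_ne_top hp (by simp)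

lemma korn_om {s p : ℝ} (hs : 0 < s) (hs1 : s < 1) (hp : 2 ≤ p) {θ : ℝ} (hθ : 1 ≤ θ) (hθ2 : θ ≤ 2)
    (hθs : θ ≤ 2 ^ ((1 - s) / 2 * p)) (N : ℕ) {v : Ed d → Ed d} (hv : Measurable v)
    (hvp : ∫⁻ x, ‖v x‖ₑ ^ p ≠ ∞) :
    En p (Wt d s p θ N) v ≤ CKorn d s p * Dn p (Wt d s p θ N) v := by
  have hsp : 0 < s * p := by positivity
  have hdd : (0:ℝ) ≤ d := by positivity
  have key : ∀ δ : ℝ, 0 < δ → ∫⁻ h in {h : Ed d | δ < ‖h‖}, ∫⁻ x, ‖v (x + h) - v x‖ₑ ^ p * Wt d s p θ N h ≤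
      CKorn d s p * Dn p (Wt d s p θ N) v := by
    intro δ hδ
    set S := {h : Ed d | δ < ‖h‖} with hS
    have hSm : MeasurableSet S := measurableSet_lt measurable_const measurable_norm
    have hWm := Wt_meas (d := d) s p θ N
    set W := S.indicator (Wt d s p θ N) with hW
    have hEn : En p W v = ∫⁻ h in S, ∫⁻ x, ‖v (x + h) - v x‖ₑ ^ p * Wt d s p θ N h := by
      rw [← lintegral_indicator hSm]
      refine lintegral_congr fun h => ?_
      by_cases hh : h ∈ S <;> simp [hW, hh]
    have hDn : Dn p W v ≤ Dn p (Wt d s p θ N) v := by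
      refine lintegral_mono fun h => lintegral_mono fun x => ?_
      simp only
      gcongr
      exact indicator_le_self _ _ _
    rw [← hEn]
    refine le_trans (korn hp (σ := (1 + s) / 2) (c := (ENNReal.ofReal (4 ^ ((d:ℝ) + s * p) * 4))) (by linarith)
      (hWm.indicator hSm) ?_ ?_ hv ?_) (mul_le_mul_right hDn _)
    · intro h
      by_cases hh : h ∈ S
      · have hh2 : (2:ℝ) • h ∈ S := by
          simp only [hS, mem_ofPred_eq, norm_smul] at hh ⊢
          simp; linarith [norm_nonneg h]
        rw [indicator_of_mem hh, indicator_of_mem hh2]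
        unfold Wt
        rw [← ENNReal.ofReal_mul (by positivity)]
        apply ENNReal.ofReal_le_ofReal
        have e1 : Ks d s p h = 2 ^ ((d:ℝ) + s * p) * Ks d s p ((2:ℝ) • h) := by
          unfold Ks
          rw [norm_smul, Real.norm_of_nonneg (by norm_num : (0:ℝ) ≤ 2), Real.mul_rpow (by norm_num) (norm_nonneg _), ← mul_assoc,
            ← Real.rpow_add (by norm_num)]; simp
        have e2 : (2:ℝ) ^ ((d:ℝ) + (1 + s) / 2 * p) = 2 ^ ((d:ℝ) + s * p) * 2 ^ ((1 - s) / 2 * p) := by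
          rw [← Real.rpow_add (by norm_num)]; congr 1; ring
        rw [e2]
        nth_rw 1 [e1]
        have k1 := Ks_nonneg s p ((2:ℝ) • h)
        have k2 := om_two hθ N h
        have k3 := (om_pos hθ N ((2:ℝ) • h)).le
        calc _ ≤ 2 ^ ((d:ℝ) + s * p) * Ks d s p ((2:ℝ) • h) * (2 ^ ((1 - s) / 2 * p) * om θ N ((2:ℝ) • h)) := by
              gcongr
              exact k2.trans (by gcongr)
          _ = _ := by ring
      · rw [indicator_of_notMem hh]; exact zero_le
    · intro h h' hl hu
      by_cases hh : h ∈ S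
      · have hh2 : h' ∈ S := lt_of_lt_of_le hh hl
        rw [indicator_of_mem hh, indicator_of_mem hh2]
        unfold Wt
        rw [← ENNReal.ofReal_mul (by positivity)]
        apply ENNReal.ofReal_le_ofReal
        have k1 := Ks_nonneg s p h'
        have k2 := om_four hθ N hu
        have k3 := (om_pos hθ N h').le
        have k4 := Ks_four (d := d) (s := s) (p := p) (by linarith) hu hl
        calc _ ≤ (4 ^ ((d:ℝ) + s * p) * Ks d s p h') * (4 * om θ N h') := by
              have k5 := (om_pos hθ N h).le
              gcongr
              refine k2.trans ?_
              gcongr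
              nlinarith
          _ = _ := by ring
      · rw [indicator_of_notMem hh]; exact zero_le
    · rw [hEn]
      apply ne_of_lt
      calc _ ≤ ∫⁻ h in S, (2 ^ p * (2 * ∫⁻ x, ‖v x‖ₑ ^ p) * ENNReal.ofReal (θ ^ N)) * ENNReal.ofReal (Ks d s p h) := by
            refine lintegral_mono fun h => ?_
            simp only
            rw [lintegral_mul_const _ (by fun_prop), mul_assoc]
            gcongr
            · exact lint_diff_le hp hv h
            · unfold Wt
              rw [← ENNReal.ofReal_mul (by positivity)]
              apply ENNReal.ofReal_le_ofReal
              rw [mul_comm]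
              gcongr
              · exact Ks_nonneg _ _ _
              · exact om_le hθ N h
        _ < ∞ := by
            rw [lintegral_const_mul _ (by have := Ks_meas (d := d) s p; fun_prop)]
            refine ENNReal.mul_lt_top ?_ (lint_Ks_trunc hsp hδ)
            have : (2:ℝ≥0∞) ^ p ≠ ∞ := by finiteness
            apply lt_top_iff_ne_top.2
            finiteness
  have hδ1 : Antitone fun n : ℕ => 1 / ((n:ℝ) + 1) := fun n m hnm => by
    simp only
    gcongr
  refine lint_le_of_trunc _ _ ?_ (fun n => 1 / ((n:ℝ) + 1)) hδ1 tendsto_one_div_add_atTop_nhds_zero_nat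
    (fun n => key _ (by positivity))
  have : Wt d s p θ N 0 = 0 := by
    unfold Wt Ks
    rw [norm_zero, Real.zero_rpow (by linarith)]; simp
  simp [this]

end SectW1

noncomputable section SectM1
variable {d : ℕ}

def qf (σ r : ℝ) : ℝ := min (r ^ σ) (r ^ σ)⁻¹

lemma qf_tele {σ r : ℝ} (hσ : 0 < σ) (hr : 0 < r) :
    qf σ r ≤ (4 * 2 ^ σ / (2 ^ σ - 1)) * ((2 * r) ^ σ / (1 + (2 * r) ^ σ) - r ^ σ / (1 + r ^ σ)) := by
  have ha : (1:ℝ) < 2 ^ σ := Real.one_lt_rpow (by norm_num) hσ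
  rw [Real.mul_rpow (by norm_num) hr.le]
  unfold qf
  have hy : 0 < r ^ σ := by positivity
  generalize r ^ σ = y at *
  generalize (2:ℝ) ^ σ = a at *
  have hm : min y y⁻¹ * ((1 + a * y) * (1 + y)) ≤ 4 * a * y := by
    rcases le_total y 1 with h | h
    · have h1 : min y y⁻¹ ≤ y := min_le_left _ _
      calc _ ≤ y * ((1 + a * y) * (1 + y)) := by gcongr
        _ ≤ y * ((a + a * 1) * (1 + 1)) := by gcongr
        _ = _ := by ring
    · have h1 : min y y⁻¹ ≤ y⁻¹ := min_le_right _ _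
      calc _ ≤ y⁻¹ * ((1 + a * y) * (1 + y)) := by gcongr
        _ ≤ y⁻¹ * ((a * y + a * y) * (y + y)) := by
            gcongr
            nlinarith
        _ = _ := by field_simp; ring
  have e : (4 * a / (a - 1)) * (a * y / (1 + a * y) - y / (1 + y)) = 4 * a * y / ((1 + a * y) * (1 + y)) := by
    have : a - 1 ≠ 0 := by linarith
    have : 1 + a * y ≠ 0 := by positivity
    have : 1 + y ≠ 0 := by positivity
    field_simp
    ring
  rw [e, le_div_iff₀ (by positivity)]
  exact hm

def Cq (σ : ℝ) : ℝ := 4 * 2 ^ σ / (2 ^ σ - 1)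

lemma qf_nonneg {σ r : ℝ} (hr : 0 ≤ r) : 0 ≤ qf σ r := by unfold qf; positivity
lemma qf_pos {σ r : ℝ} (hr : 0 < r) : 0 < qf σ r := by unfold qf; positivity

lemma Cq_pos {σ : ℝ} (hσ : 0 < σ) : 0 < Cq σ := by
  have ha : (1:ℝ) < 2 ^ σ := Real.one_lt_rpow (by norm_num) hσ
  unfold Cq
  have : 0 < (2:ℝ) ^ σ - 1 := by linarith
  positivity

lemma qf_sum {σ r : ℝ} (hσ : 0 < σ) (hr : 0 < r) (N : ℕ) :
    ∑ k ∈ Finset.Icc 1 N, qf σ (2 ^ k * r) ≤ Cq σ := by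
  have hsub : Finset.Icc 1 N ⊆ Finset.range (N + 1) := by
    intro k hk; simp at hk ⊢; omega
  refine (Finset.sum_le_sum_of_subset_of_nonneg hsub fun k _ _ => qf_nonneg (by positivity)).trans ?_
  set g : ℕ → ℝ := fun k => (2 ^ k * r) ^ σ / (1 + (2 ^ k * r) ^ σ) with hg
  have h1 : ∀ k ∈ Finset.range (N + 1), qf σ (2 ^ k * r) ≤ Cq σ * (g (k + 1) - g k) := by
    intro k _
    have := qf_tele hσ (r := 2 ^ k * r) (by positivity)
    rw [hg]; simp only
    rw [pow_succ', mul_assoc]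
    exact this
  refine (Finset.sum_le_sum h1).trans ?_
  rw [← Finset.mul_sum, Finset.sum_range_sub]
  have h2 : g (N + 1) ≤ 1 := by
    rw [hg]; simp only
    rw [div_le_one (by positivity)]; linarith
  have h3 : 0 ≤ g 0 := by rw [hg]; positivity
  nlinarith [Cq_pos hσ]

/-- averaged oscillation -/
def osc (k : ℕ) (w : Ed d → Ed d) (x : Ed d) : ℝ≥0∞ :=
  ENNReal.ofReal (2 ^ (k * d)) * ∫⁻ t in Metric.closedBall (0 : Ed d) (2 * (2 ^ k)⁻¹), ‖w (x - t) - w x‖ₑ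

lemma osc_meas (k : ℕ) {w : Ed d → Ed d} (hw : Measurable w) : Measurable (osc k w) := by
  unfold osc
  apply Measurable.const_mul
  apply Measurable.lintegral_prod_right' (f := fun q : Ed d × Ed d => ‖w (q.1 - q.2) - w q.1‖ₑ)
  fun_prop

lemma vol_ball (k : ℕ) : volume (Metric.closedBall (0 : Ed d) (2 * (2 ^ k)⁻¹)) =
    (ENNReal.ofReal (2 ^ (k * d)))⁻¹ * volume (Metric.closedBall (0 : Ed d) 2) := by
  rw [Measure.addHaar_closedBall _ _ (by positivity), Measure.addHaar_closedBall _ _ (by norm_num : (0:ℝ) ≤ 2), ← mul_assoc]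
  congr 1
  rw [← ENNReal.ofReal_inv_of_pos (by positivity), ← ENNReal.ofReal_mul (by positivity)]
  congr 1
  simp [mul_pow, pow_mul]
  ring

def cB (d : ℕ) (p : ℝ) : ℝ≥0∞ := volume (Metric.closedBall (0 : Ed d) 2) ^ (p - 1)

lemma cB_ne_top {p : ℝ} (hp : 2 ≤ p) : cB d p ≠ ∞ := by
  unfold cB
  have : volume (Metric.closedBall (0 : Ed d) 2) ≠ ∞ := measure_closedBall_lt_top.ne
  exact ENNReal.rpow_ne_top_of_nonneg (by linarith) this

lemma osc_lint {p : ℝ} (hp : 2 ≤ p) (k : ℕ) {w : Ed d → Ed d} (hw : Measurable w) :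
    ∫⁻ x, osc k w x ^ p ≤ cB d p * (ENNReal.ofReal (2 ^ (k * d)) *
      ∫⁻ t in Metric.closedBall (0 : Ed d) (2 * (2 ^ k)⁻¹), ∫⁻ x, ‖w (x + t) - w x‖ₑ ^ p) := by
  set S := Metric.closedBall (0 : Ed d) (2 * (2 ^ k)⁻¹) with hS
  set a := ENNReal.ofReal (2 ^ (k * d)) with ha
  have ha0 : a ≠ 0 := by rw [ha]; simp
  have hat : a ≠ ∞ := by simp [ha]
  have h1 : ∀ x, osc k w x ^ p ≤ (cB d p * a) * ∫⁻ t in S, ‖w (x - t) - w x‖ₑ ^ p := by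
    intro x
    have := jensen_lint (volume.restrict S) hp (w := fun _ => a) (y := fun t => ‖w (x - t) - w x‖ₑ)
      (by fun_prop) (by fun_prop)
    rw [lintegral_const_mul _ (by fun_prop)] at this
    unfold osc
    refine this.trans (le_of_eq ?_)
    rw [lintegral_const_mul _ (by fun_prop), ← mul_assoc]
    congr 2
    rw [setLIntegral_const, hS, vol_ball, ← mul_assoc, ENNReal.mul_inv_cancel ha0 hat, one_mul]
    rfl
  calc _ ≤ ∫⁻ x, (cB d p * a) * ∫⁻ t in S, ‖w (x - t) - w x‖ₑ ^ p := lintegral_mono h1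
    _ = (cB d p * a) * ∫⁻ x, ∫⁻ t in S, ‖w (x - t) - w x‖ₑ ^ p := by
        rw [lintegral_const_mul]
        apply Measurable.lintegral_prod_right' (f := fun q : Ed d × Ed d => ‖w (q.1 - q.2) - w q.1‖ₑ ^ p)
        fun_prop
    _ = (cB d p * a) * ∫⁻ t in S, ∫⁻ x, ‖w (x - t) - w x‖ₑ ^ p := by
        rw [lintegral_lintegral_swap]
        exact (by fun_prop : Measurable fun q : Ed d × Ed d => ‖w (q.1 - q.2) - w q.1‖ₑ ^ p).aemeasurable
    _ = _ := by
        rw [mul_assoc]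
        congr 2
        refine lintegral_congr fun t => ?_
        rw [← lintegral_add_right_eq_self (fun x => ‖w (x - t) - w x‖ₑ ^ p) t]
        refine lintegral_congr fun x => ?_
        rw [add_sub_cancel_right, ← enorm_neg, neg_sub]

/-- error functional -/
def Bf (θ : ℝ) (N : ℕ) (w : Ed d → Ed d) (x h : Ed d) : ℝ≥0∞ :=
  ∑ k ∈ Finset.Icc 1 N, ENNReal.ofReal (θ ^ k * min (2 ^ k * ‖h‖) 1) * (osc k w x + osc k w (x + h))

def Vt (d : ℕ) (s p θ : ℝ) (N : ℕ) (h : Ed d) : ℝ≥0∞ := ENNReal.ofReal (Ks d s p h * om θ N h ^ (1 - p))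

lemma Vt_meas (s p θ : ℝ) (N : ℕ) : Measurable (Vt d s p θ N) := by
  unfold Vt
  have := Ks_meas (d := d) s p
  have := om_meas (d := d) θ N
  fun_prop

/-- the profile -/
def Psi (s p σ : ℝ) (r : ℝ) : ℝ := min r 1 ^ p * qf σ r ^ (1 - p) * (max 1 r) ^ (s * p / 4)

lemma Psi_meas (s p σ : ℝ) : Measurable (Psi s p σ) := by unfold Psi qf; fun_prop

def JJ (d : ℕ) (s p σ : ℝ) : ℝ≥0∞ := ∫⁻ h : Ed d, ENNReal.ofReal (Ks d s p h * Psi s p σ ‖h‖)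

lemma JJ_lt_top (hd : 2 ≤ d) {s p σ : ℝ} (hs : 0 < s) (hs1 : s < 1) (hp : 2 ≤ p)
    (hσ : 0 < σ) (hσ1 : σ ≤ s / 2) (hσ2 : σ ≤ (1 - s) / 2) : JJ d s p σ < ∞ := by
  unfold JJ
  rw [← lintegral_add_compl _ (Metric.isClosed_closedBall (x := (0:Ed d)) (ε := 1)).measurableSet]
  refine ENNReal.add_lt_top.2 ⟨?_, ?_⟩
  · refine lt_of_le_of_lt ?_ (lint_inner (d := d) hd (e := -((d:ℝ) + s * p) + (p + σ * (1 - p))) (by nlinarith))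
    refine setLIntegral_mono (by fun_prop) fun h hh => ?_
    apply ENNReal.ofReal_le_ofReal
    have hh1 : ‖h‖ ≤ 1 := by simpa using hh
    by_cases h0 : h = 0
    · unfold Ks
      rw [h0, norm_zero, Real.zero_rpow (by nlinarith [(by positivity : (0:ℝ) ≤ d)]), zero_mul]
      positivity
    have hpos : 0 < ‖h‖ := by simpa using h0
    unfold Ks Psi
    have hq : qf σ ‖h‖ = ‖h‖ ^ σ := by
      unfold qf
      apply min_eq_left
      have h1 : ‖h‖ ^ σ ≤ 1 := Real.rpow_le_one hpos.le hh1 hσ.le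
      exact h1.trans ((one_le_inv₀ (by positivity)).2 h1)
    rw [hq, min_eq_left hh1, max_eq_left hh1, Real.one_rpow, mul_one, ← Real.rpow_mul hpos.le,
      ← Real.rpow_add hpos, ← Real.rpow_add hpos]
  · refine lt_of_le_of_lt ?_ (lint_outer (d := d) (e := -((d:ℝ) + s * p) + (σ * (p - 1) + s * p / 4)) (by nlinarith))
    refine setLIntegral_mono (by fun_prop) fun h hh => ?_
    apply ENNReal.ofReal_le_ofReal
    have hh1 : 1 ≤ ‖h‖ := by
      have : 1 < ‖h‖ := by simpa using hh
      exact this.le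
    have hpos : 0 < ‖h‖ := by linarith
    unfold Ks Psi
    have hq : qf σ ‖h‖ = ‖h‖ ^ (-σ) := by
      unfold qf
      rw [Real.rpow_neg hpos.le]
      apply min_eq_right
      have h1 : 1 ≤ ‖h‖ ^ σ := Real.one_le_rpow hh1 hσ.le
      exact (inv_le_one_of_one_le₀ h1).trans h1
    rw [hq, min_eq_right hh1, max_eq_right hh1, Real.one_rpow, one_mul, ← Real.rpow_mul hpos.le,
      ← Real.rpow_add hpos, ← Real.rpow_add hpos]
    apply le_of_eq
    congr 1
    ring

lemma JJ_scale {s p σ : ℝ} (k : ℕ) :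
    ∫⁻ h : Ed d, ENNReal.ofReal (Ks d s p h * Psi s p σ (2 ^ k * ‖h‖)) =
      ENNReal.ofReal ((2 ^ k) ^ (s * p)) * JJ d s p σ := by
  have m : Measurable fun h : Ed d => ENNReal.ofReal (Ks d s p h * Psi s p σ ‖h‖) := by
    have := Ks_meas (d := d) s p
    have := Psi_meas s p σ
    fun_prop
  have h1 := lint_smul (d := d) (c := 2 ^ k) (by positivity)
    (fun h : Ed d => ENNReal.ofReal (Ks d s p h * Psi s p σ ‖h‖)) m
  have h2 : ∀ h : Ed d, ENNReal.ofReal (Ks d s p h * Psi s p σ (2 ^ k * ‖h‖)) =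
      ENNReal.ofReal ((2 ^ k) ^ ((d:ℝ) + s * p)) *
        ENNReal.ofReal (Ks d s p ((2 ^ k : ℝ) • h) * Psi s p σ ‖(2 ^ k : ℝ) • h‖) := by
    intro h
    rw [← ENNReal.ofReal_mul (by positivity), norm_smul, Real.norm_of_nonneg (by positivity : (0:ℝ) ≤ 2 ^ k)]
    congr 1
    rw [← mul_assoc]
    congr 1
    unfold Ks
    rw [norm_smul, Real.norm_of_nonneg (by positivity : (0:ℝ) ≤ 2 ^ k), Real.mul_rpow (by positivity) (norm_nonneg _), ← mul_assoc,
      ← Real.rpow_add (by positivity)]; simp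
  simp_rw [h2]
  rw [lintegral_const_mul, h1]
  · unfold JJ
    rw [← mul_assoc, ← ENNReal.ofReal_mul (by positivity), ← Real.rpow_add (by positivity)]
    congr 3; ring
  · exact m.comp (by fun_prop : Measurable fun h : Ed d => (2 ^ k : ℝ) • h)

end SectM1

noncomputable section SectM2
variable {d : ℕ}

lemma coef_bound {s p e σ : ℝ} (hp : 2 ≤ p) (he : 0 ≤ e) (he1 : e ≤ 1)
    (hep : e * (p - 1) ≤ s * p / 4) {N k : ℕ} (hk : k ≤ N) {h : Ed d} (h0 : h ≠ 0) :
    qf σ (2 ^ k * ‖h‖) * ((((2:ℝ) ^ e) ^ k * min (2 ^ k * ‖h‖) 1) / qf σ (2 ^ k * ‖h‖)) ^ p *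
      (Ks d s p h * om (2 ^ e) N h ^ (1 - p)) ≤
    (2 ^ (p - 1) * ((2:ℝ) ^ e) ^ k) * (Ks d s p h * Psi s p σ (2 ^ k * ‖h‖)) := by
  have hpos : 0 < ‖h‖ := by simpa using h0
  have hθ : (1:ℝ) ≤ 2 ^ e := Real.one_le_rpow (by norm_num) he
  have hθ2 : (2:ℝ) ^ e ≤ 2 := by
    calc (2:ℝ) ^ e ≤ 2 ^ (1:ℝ) := Real.rpow_le_rpow_of_exponent_le (by norm_num) he1
      _ = 2 := by simp
  have hlow := om_lower he hk h
  have hompos := om_pos hθ N h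
  have hq : 0 < qf σ (2 ^ k * ‖h‖) := qf_pos (by positivity)
  have hK := Ks_nonneg s p h
  unfold Psi
  set q := qf σ (2 ^ k * ‖h‖)
  set r := 2 ^ k * ‖h‖ with hr
  have hrpos : 0 < r := by positivity
  set ω := om (2 ^ e) N h
  set θ := (2:ℝ) ^ e
  set a := θ ^ k with ha
  have hapos : 0 < a := by positivity
  have h1 : (a / ω) ^ (p - 1) ≤ 2 ^ (p - 1) * (max 1 r) ^ (s * p / 4) := by
    calc (a / ω) ^ (p - 1) ≤ (2 * (max 1 r) ^ e) ^ (p - 1) := by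
          apply Real.rpow_le_rpow (by positivity) _ (by linarith)
          rw [div_le_iff₀ hompos]
          calc a ≤ θ * ω * max 1 r ^ e := hlow
            _ ≤ 2 * ω * max 1 r ^ e := by gcongr
            _ = _ := by ring
      _ = 2 ^ (p - 1) * (max 1 r) ^ (e * (p - 1)) := by
          rw [Real.mul_rpow (by norm_num) (by positivity), ← Real.rpow_mul (by positivity)]
      _ ≤ _ := by
          gcongr
          exact le_max_left _ _
  have e1 : q * (a * min r 1 / q) ^ p = a * (a ^ (p - 1) * (min r 1 ^ p * q ^ (1 - p))) := by
    rw [Real.div_rpow (by positivity) hq.le, Real.mul_rpow hapos.le (by positivity),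
      Real.rpow_sub hq, Real.rpow_one, Real.rpow_sub hapos, Real.rpow_one]
    field_simp
  have e2 : (a / ω) ^ (p - 1) = a ^ (p - 1) * ω ^ (1 - p) := by
    rw [Real.div_rpow hapos.le hompos.le, div_eq_mul_inv, ← Real.rpow_neg hompos.le, neg_sub]
  rw [e1]
  calc _ = a * (min r 1 ^ p * q ^ (1 - p)) * Ks d s p h * (a ^ (p - 1) * ω ^ (1 - p)) := by ring
    _ ≤ a * (min r 1 ^ p * q ^ (1 - p)) * Ks d s p h * (2 ^ (p - 1) * (max 1 r) ^ (s * p / 4)) := by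
        rw [← e2]; gcongr
    _ = _ := by ring

lemma Bf_pointwise {s p e σ : ℝ} (hs : 0 < s) (hp : 2 ≤ p) (he : 0 ≤ e) (he1 : e ≤ 1) (hσ : 0 < σ)
    (hep : e * (p - 1) ≤ s * p / 4) (N : ℕ) (w : Ed d → Ed d) (x h : Ed d) :
    Bf (2 ^ e) N w x h ^ p * Vt d s p (2 ^ e) N h ≤
      ENNReal.ofReal (Cq σ) ^ (p - 1) * ∑ k ∈ Finset.Icc 1 N,
        (2 ^ p * ENNReal.ofReal (2 ^ (p - 1) * ((2:ℝ) ^ e) ^ k)) *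
          (ENNReal.ofReal (Ks d s p h * Psi s p σ (2 ^ k * ‖h‖)) * (osc k w x ^ p + osc k w (x + h) ^ p)) := by
  by_cases h0 : h = 0
  · have : Vt d s p (2 ^ e) N h = 0 := by
      unfold Vt Ks
      rw [h0, norm_zero, Real.zero_rpow (by
        have : (0:ℝ) ≤ d := by positivity
        nlinarith)]; simp
    rw [this, mul_zero]; exact zero_le
  have hpos : 0 < ‖h‖ := by simpa using h0
  have hq : ∀ k : ℕ, 0 < qf σ (2 ^ k * ‖h‖) := fun k => qf_pos (by positivity)
  have e0 : Bf (2 ^ e) N w x h = ∑ k ∈ Finset.Icc 1 N, ENNReal.ofReal (qf σ (2 ^ k * ‖h‖)) *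
      (ENNReal.ofReal ((((2:ℝ) ^ e) ^ k * min (2 ^ k * ‖h‖) 1) / qf σ (2 ^ k * ‖h‖)) * (osc k w x + osc k w (x + h))) := by
    unfold Bf
    refine Finset.sum_congr rfl fun k _ => ?_
    rw [← mul_assoc, ← ENNReal.ofReal_mul (hq k).le]
    congr 2
    have := hq k
    field_simp
  rw [e0]
  have h1 := jensen_sum (Finset.Icc 1 N) hp (fun k => ENNReal.ofReal (qf σ (2 ^ k * ‖h‖)))
    (fun k => (ENNReal.ofReal ((((2:ℝ) ^ e) ^ k * min (2 ^ k * ‖h‖) 1) / qf σ (2 ^ k * ‖h‖)) * (osc k w x + osc k w (x + h))))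
  have h2 : ∑ k ∈ Finset.Icc 1 N, ENNReal.ofReal (qf σ (2 ^ k * ‖h‖)) ≤ ENNReal.ofReal (Cq σ) := by
    rw [← ENNReal.ofReal_sum_of_nonneg (fun k _ => (hq k).le)]
    exact ENNReal.ofReal_le_ofReal (qf_sum hσ hpos N)
  refine (mul_le_mul_left h1 _).trans ?_
  rw [mul_assoc, Finset.sum_mul]
  refine mul_le_mul' (ENNReal.rpow_le_rpow h2 (by linarith)) (Finset.sum_le_sum fun k hk => ?_)
  have hkN : k ≤ N := (Finset.mem_Icc.1 hk).2
  have h3 := coef_bound (d := d) (σ := σ) hp he he1 hep hkN h0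
  calc _ = ENNReal.ofReal (qf σ (2 ^ k * ‖h‖) * ((((2:ℝ) ^ e) ^ k * min (2 ^ k * ‖h‖) 1) / qf σ (2 ^ k * ‖h‖)) ^ p *
      (Ks d s p h * om (2 ^ e) N h ^ (1 - p))) * (osc k w x + osc k w (x + h)) ^ p := by
        have := hq k
        have a1 : 0 ≤ (((2:ℝ) ^ e) ^ k * min (2 ^ k * ‖h‖) 1) / qf σ (2 ^ k * ‖h‖) := by positivity
        rw [ENNReal.mul_rpow_of_nonneg _ _ (by linarith), ENNReal.ofReal_rpow_of_nonneg a1 (by linarith),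
          ENNReal.ofReal_mul (by positivity), ENNReal.ofReal_mul (by positivity)]
        unfold Vt
        ring
    _ ≤ ENNReal.ofReal ((2 ^ (p - 1) * ((2:ℝ) ^ e) ^ k) * (Ks d s p h * Psi s p σ (2 ^ k * ‖h‖))) *
          (2 ^ p * (osc k w x ^ p + osc k w (x + h) ^ p)) := by
        gcongr
        exact add_rpow_le2 hp _ _
    _ = _ := by
        rw [ENNReal.ofReal_mul (by positivity)]
        ring

lemma ball_sum {s p e σ : ℝ} (hd : 2 ≤ d) (hs : 0 < s) (hp : 2 ≤ p) (he : 0 ≤ e) (he1 : e ≤ 1)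
    (hσ : 0 < σ) (hσ1 : σ ≤ 1) (N : ℕ) {t : Ed d} (ht : t ≠ 0) :
    ∑ k ∈ Finset.Icc 1 N, (Metric.closedBall (0 : Ed d) (2 * (2 ^ k)⁻¹)).indicator
      (fun _ => ((2:ℝ) ^ e) ^ k * ((2 ^ k) ^ ((d:ℝ) + s * p))) t ≤
      (4 * 2 ^ ((d:ℝ) + s * p + σ) * Cq σ) * (Ks d s p t * om (2 ^ e) N t) := by
  have hpos : 0 < ‖t‖ := by simpa using ht
  have hθ : (1:ℝ) ≤ 2 ^ e := Real.one_le_rpow (by norm_num) he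
  have hθ2 : (2:ℝ) ^ e ≤ 2 := by
    calc (2:ℝ) ^ e ≤ 2 ^ (1:ℝ) := Real.rpow_le_rpow_of_exponent_le (by norm_num) he1
      _ = 2 := by simp
  have hd' : (2:ℝ) ≤ d := by exact_mod_cast hd
  set E := (d:ℝ) + s * p with hE
  have hE2 : σ ≤ E := by nlinarith
  have hK := Ks_nonneg s p t
  have hom := (om_pos hθ N t).le
  have h1 : ∀ k ∈ Finset.Icc 1 N, (Metric.closedBall (0 : Ed d) (2 * (2 ^ k)⁻¹)).indicator
      (fun _ => ((2:ℝ) ^ e) ^ k * ((2 ^ k) ^ E)) t ≤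
      (4 * 2 ^ (E + σ) * (Ks d s p t * om (2 ^ e) N t)) * qf σ (2 ^ k * ‖t‖) := by
    intro k hk
    have hkN : k ≤ N := (Finset.mem_Icc.1 hk).2
    have hq : 0 < qf σ (2 ^ k * ‖t‖) := qf_pos (by positivity)
    by_cases htS : t ∈ Metric.closedBall (0 : Ed d) (2 * (2 ^ k)⁻¹)
    swap
    · rw [indicator_of_notMem htS]; positivity
    rw [indicator_of_mem htS]
    have hr2 : 2 ^ k * ‖t‖ ≤ 2 := by
      have : ‖t‖ ≤ 2 * (2 ^ k)⁻¹ := by simpa using htS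
      calc 2 ^ k * ‖t‖ ≤ 2 ^ k * (2 * (2 ^ k)⁻¹) := by gcongr
        _ = 2 := by field_simp
    have a1 : ((2:ℝ) ^ e) ^ k ≤ 4 * om (2 ^ e) N t := by
      calc _ ≤ _ := om_lower he hkN t
        _ ≤ 2 * om (2 ^ e) N t * 2 := by
            gcongr
            calc (max 1 (2 ^ k * ‖t‖)) ^ e ≤ 2 ^ e := by
                  apply Real.rpow_le_rpow (by positivity) _ he
                  exact max_le (by norm_num) hr2
              _ ≤ 2 := hθ2
        _ = _ := by ring
    have a2 : ((2:ℝ) ^ k) ^ E = (2 ^ k * ‖t‖) ^ E * Ks d s p t := by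
      unfold Ks
      rw [Real.mul_rpow (by positivity) hpos.le, mul_assoc, ← Real.rpow_add hpos]
      simp [hE]
    have a3 : (2 ^ k * ‖t‖) ^ E ≤ 2 ^ (E + σ) * qf σ (2 ^ k * ‖t‖) := by
      have hrp : 0 < 2 ^ k * ‖t‖ := by positivity
      generalize 2 ^ k * ‖t‖ = r at *
      unfold qf
      rw [← Real.rpow_neg hrp.le]
      have b1 : (1:ℝ) ≤ 2 ^ (E + σ) := Real.one_le_rpow (by norm_num) (by linarith)
      have b2 : r ^ E ≤ 2 ^ (E + σ) * r ^ (-σ) := by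
        have : r ^ (E + σ) ≤ 2 ^ (E + σ) := by gcongr
        calc r ^ E = r ^ (E + σ) * r ^ (-σ) := by rw [← Real.rpow_add hrp]; simp
          _ ≤ _ := by gcongr
      have b3 : r ^ E ≤ 2 ^ (E + σ) * r ^ σ := by
        rcases le_total r 1 with h | h
        · calc r ^ E ≤ r ^ σ := Real.rpow_le_rpow_of_exponent_ge hrp h hE2
            _ ≤ _ := le_mul_of_one_le_left (by positivity) b1
        · calc _ ≤ _ := b2
            _ ≤ _ := by
              gcongr
              linarith
      rw [mul_min_of_nonneg _ _ (by positivity)]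
      exact le_min b3 b2
    rw [a2]
    calc _ ≤ (4 * om (2 ^ e) N t) * ((2 ^ (E + σ) * qf σ (2 ^ k * ‖t‖)) * Ks d s p t) := by gcongr
      _ = _ := by ring
  refine (Finset.sum_le_sum h1).trans ?_
  rw [← Finset.mul_sum]
  calc _ ≤ (4 * 2 ^ (E + σ) * (Ks d s p t * om (2 ^ e) N t)) * Cq σ := by
        gcongr; exact qf_sum hσ hpos N
    _ = _ := by ring

def sg (s : ℝ) : ℝ := min (s / 2) ((1 - s) / 2)

def CBf (d : ℕ) (s p : ℝ) : ℝ≥0∞ :=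
  ENNReal.ofReal (Cq (sg s)) ^ (p - 1) * (2 ^ p * ENNReal.ofReal (2 ^ (p - 1)) * 2 * JJ d s p (sg s) * cB d p *
    ENNReal.ofReal (4 * 2 ^ ((d:ℝ) + s * p + sg s) * Cq (sg s)))

lemma sg_pos {s : ℝ} (hs : 0 < s) (hs1 : s < 1) : 0 < sg s := lt_min (by linarith) (by linarith)

lemma CBf_ne_top (hd : 2 ≤ d) {s p : ℝ} (hs : 0 < s) (hs1 : s < 1) (hp : 2 ≤ p) : CBf d s p ≠ ∞ := by
  unfold CBf
  have h1 := (JJ_lt_top hd hs hs1 hp (sg_pos hs hs1) (min_le_left _ _) (min_le_right _ _)).ne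
  have h2 := cB_ne_top (d := d) hp
  have h3 : ENNReal.ofReal (Cq (sg s)) ^ (p - 1) ≠ ∞ :=
    ENNReal.rpow_ne_top_of_nonneg (by linarith) (by simp)
  have h4 : (2:ℝ≥0∞) ^ p ≠ ∞ := ENNReal.rpow_ne_top_of_nonneg (by linarith) (by simp)
  finiteness

lemma B_est (hd : 2 ≤ d) {s p e : ℝ} (hs : 0 < s) (hs1 : s < 1) (hp : 2 ≤ p) (he : 0 ≤ e) (he1 : e ≤ 1)
    (hep : e * (p - 1) ≤ s * p / 4) (N : ℕ) {w : Ed d → Ed d} (hw : Measurable w) :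
    ∫⁻ h, ∫⁻ x, Bf (2 ^ e) N w x h ^ p * Vt d s p (2 ^ e) N h ≤
      CBf d s p * En p (Wt d s p (2 ^ e) N) w := by
  have hσ := sg_pos hs hs1
  have hσ1 : sg s ≤ 1 := (min_le_left _ _).trans (by linarith)
  set σ := sg s with hsg
  have mo : ∀ k, Measurable (osc k w) := fun k => osc_meas k hw
  have mK := Ks_meas (d := d) s p
  have mP := Psi_meas s p σ
  set c : ℕ → ℝ≥0∞ := fun k => 2 ^ p * ENNReal.ofReal (2 ^ (p - 1) * ((2:ℝ) ^ e) ^ k) with hc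
  have mh : Measurable fun h => ∫⁻ x, ‖w (x + h) - w x‖ₑ ^ p := by
    apply Measurable.lintegral_prod_right' (f := fun q : Ed d × Ed d => ‖w (q.2 + q.1) - w q.2‖ₑ ^ p)
    fun_prop
  calc _ ≤ ∫⁻ h, ∫⁻ x, ENNReal.ofReal (Cq σ) ^ (p - 1) * ∑ k ∈ Finset.Icc 1 N, c k *
          (ENNReal.ofReal (Ks d s p h * Psi s p σ (2 ^ k * ‖h‖)) * (osc k w x ^ p + osc k w (x + h) ^ p)) :=
        lintegral_mono fun h => lintegral_mono fun x => Bf_pointwise hs hp he he1 hσ hep N w x h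
    _ = ENNReal.ofReal (Cq σ) ^ (p - 1) * ∑ k ∈ Finset.Icc 1 N, c k * (
          (ENNReal.ofReal ((2 ^ k) ^ (s * p)) * JJ d s p σ) * (2 * ∫⁻ x, osc k w x ^ p)) := by
        have b1 : ∀ h : Ed d, ∫⁻ x, ENNReal.ofReal (Cq σ) ^ (p - 1) * ∑ k ∈ Finset.Icc 1 N, c k *
          (ENNReal.ofReal (Ks d s p h * Psi s p σ (2 ^ k * ‖h‖)) * (osc k w x ^ p + osc k w (x + h) ^ p)) =
          ENNReal.ofReal (Cq σ) ^ (p - 1) * ∑ k ∈ Finset.Icc 1 N, c k *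
          (ENNReal.ofReal (Ks d s p h * Psi s p σ (2 ^ k * ‖h‖)) * (2 * ∫⁻ x, osc k w x ^ p)) := by
          intro h
          have m1 : ∀ k, Measurable fun x => osc k w x ^ p := fun k => (mo k).pow_const p
          have m2 : ∀ k, Measurable fun x => osc k w (x + h) ^ p :=
            fun k => (m1 k).comp (measurable_add_const h)
          rw [lintegral_const_mul _ (by fun_prop), lintegral_finsetSum _ (fun k _ => by fun_prop)]
          congr 1
          refine Finset.sum_congr rfl fun k _ => ?_
          rw [lintegral_const_mul _ (by fun_prop), lintegral_const_mul _ (by fun_prop),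
            lintegral_add_left (m1 k), lintegral_add_right_eq_self (fun x => osc k w x ^ p) h, two_mul]
        simp_rw [b1]
        rw [lintegral_const_mul _ (by fun_prop), lintegral_finsetSum _ (fun k _ => by fun_prop)]
        congr 1
        refine Finset.sum_congr rfl fun k _ => ?_
        rw [lintegral_const_mul _ (by fun_prop), lintegral_mul_const _ (by fun_prop), JJ_scale]
    _ ≤ ENNReal.ofReal (Cq σ) ^ (p - 1) * ∑ k ∈ Finset.Icc 1 N, c k * (
          (ENNReal.ofReal ((2 ^ k) ^ (s * p)) * JJ d s p σ) * (2 * (cB d p * (ENNReal.ofReal (2 ^ (k * d)) *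
      ∫⁻ t in Metric.closedBall (0 : Ed d) (2 * (2 ^ k)⁻¹), ∫⁻ x, ‖w (x + t) - w x‖ₑ ^ p)))) := by
        gcongr with k _
        exact osc_lint hp k hw
    _ = ENNReal.ofReal (Cq σ) ^ (p - 1) * (2 ^ p * ENNReal.ofReal (2 ^ (p - 1)) * 2 * JJ d s p σ * cB d p *
          ∑ k ∈ Finset.Icc 1 N, ∫⁻ t, ENNReal.ofReal ((Metric.closedBall (0 : Ed d) (2 * (2 ^ k)⁻¹)).indicator
      (fun _ => ((2:ℝ) ^ e) ^ k * ((2 ^ k) ^ ((d:ℝ) + s * p))) t) * ∫⁻ x, ‖w (x + t) - w x‖ₑ ^ p) := by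
        congr 1
        rw [Finset.mul_sum]
        refine Finset.sum_congr rfl fun k _ => ?_
        have b2 : ∫⁻ t, ENNReal.ofReal ((Metric.closedBall (0 : Ed d) (2 * (2 ^ k)⁻¹)).indicator
            (fun _ => ((2:ℝ) ^ e) ^ k * ((2 ^ k) ^ ((d:ℝ) + s * p))) t) * ∫⁻ x, ‖w (x + t) - w x‖ₑ ^ p =
            ENNReal.ofReal (((2:ℝ) ^ e) ^ k * ((2 ^ k) ^ ((d:ℝ) + s * p))) *
            ∫⁻ t in Metric.closedBall (0 : Ed d) (2 * (2 ^ k)⁻¹), ∫⁻ x, ‖w (x + t) - w x‖ₑ ^ p := by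
          rw [← lintegral_const_mul _ mh, ← lintegral_indicator Metric.isClosed_closedBall.measurableSet]
          refine lintegral_congr fun t => ?_
          by_cases ht : t ∈ Metric.closedBall (0 : Ed d) (2 * (2 ^ k)⁻¹)
          · rw [indicator_of_mem ht, indicator_of_mem ht]
          · rw [indicator_of_notMem ht, indicator_of_notMem ht]; simp
        rw [b2, hc]
        simp only
        have b3 : ((2:ℝ) ^ k) ^ ((d:ℝ) + s * p) = (2 ^ k) ^ (s * p) * 2 ^ (k * d) := by
          rw [Real.rpow_add (by positivity), pow_mul, Real.rpow_natCast, mul_comm]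
        rw [b3, ENNReal.ofReal_mul (by positivity), ENNReal.ofReal_mul (by positivity),
          ENNReal.ofReal_mul (by positivity)]
        ring
    _ = ENNReal.ofReal (Cq σ) ^ (p - 1) * (2 ^ p * ENNReal.ofReal (2 ^ (p - 1)) * 2 * JJ d s p σ * cB d p *
          ∫⁻ t, ENNReal.ofReal (∑ k ∈ Finset.Icc 1 N, (Metric.closedBall (0 : Ed d) (2 * (2 ^ k)⁻¹)).indicator
      (fun _ => ((2:ℝ) ^ e) ^ k * ((2 ^ k) ^ ((d:ℝ) + s * p))) t) * ∫⁻ x, ‖w (x + t) - w x‖ₑ ^ p) := by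
        congr 2
        rw [← lintegral_finsetSum]
        · refine lintegral_congr fun t => ?_
          rw [ENNReal.ofReal_sum_of_nonneg, Finset.sum_mul]
          intro k _
          apply indicator_nonneg
          intro _ _; positivity
        · intro k _
          refine Measurable.mul ?_ mh
          exact (measurable_const.indicator Metric.isClosed_closedBall.measurableSet).ennreal_ofReal
    _ ≤ ENNReal.ofReal (Cq σ) ^ (p - 1) * (2 ^ p * ENNReal.ofReal (2 ^ (p - 1)) * 2 * JJ d s p σ * cB d p *
          ∫⁻ t, ENNReal.ofReal (4 * 2 ^ ((d:ℝ) + s * p + σ) * Cq σ) * ∫⁻ x, ‖w (x + t) - w x‖ₑ ^ p * Wt d s p (2 ^ e) N t) := by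
        refine mul_le_mul' le_rfl (mul_le_mul' le_rfl (lintegral_mono fun t => ?_))
        by_cases ht : t = 0
        · have : (0:ℝ) < p := by linarith
          simp [ht, this]
        · rw [lintegral_mul_const _ (by fun_prop)]
          unfold Wt
          have c0 := (Cq_pos hσ).le
          calc _ ≤ ENNReal.ofReal ((4 * 2 ^ ((d:ℝ) + s * p + σ) * Cq σ) * (Ks d s p t * om (2 ^ e) N t)) * _ := by
                gcongr
                exact ball_sum hd hs hp he he1 hσ hσ1 N ht
            _ = _ := by
                rw [ENNReal.ofReal_mul (by positivity)]; ring
    _ = _ := by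
        rw [lintegral_const_mul _ (meas_En hw (Wt_meas _ _ _ _))]
        unfold CBf En
        rw [← hsg]
        ring

end SectM2

noncomputable section SectM3
variable {d : ℕ}

lemma exists_rho (d : ℕ) : ∃ ρ : Ed d → ℝ, ContDiff ℝ (⊤ : ℕ∞) ρ ∧ HasCompactSupport ρ ∧ (∀ z, 0 ≤ ρ z) ∧
    (∀ z, 1 < ‖z‖ → ρ z = 0) ∧ ∫ z, ρ z = 1 ∧
    ∃ L : ℝ, 0 < L ∧ (∀ z, ρ z ≤ L) ∧ ∀ z z', |ρ z - ρ z'| ≤ L * ‖z - z'‖ := by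
  let b : ContDiffBump (0 : Ed d) := ⟨1 / 2, 1, by norm_num, by norm_num⟩
  have hb1 : ContDiff ℝ (⊤ : ℕ∞) (b.normed volume) := b.contDiff_normed
  have hb2 : HasCompactSupport (b.normed volume) := b.hasCompactSupport_normed
  obtain ⟨C, hC⟩ := hb1.lipschitzWith_of_hasCompactSupport hb2 (by simp)
  obtain ⟨M, hM⟩ := hb2.exists_bound_of_continuous hb1.continuous
  refine ⟨b.normed volume, hb1, hb2, b.nonneg_normed, ?_, b.integral_normed, C + |M| + 1, by positivity, ?_, ?_⟩
  · intro z hz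
    have : z ∉ Function.support (b.normed volume) := by
      rw [b.support_normed_eq]
      simp [b]; exact hz.le
    simpa using this
  · intro z
    have h1 := (le_abs_self _).trans (hM z)
    have := le_abs_self M
    have : (0:ℝ) ≤ C := by positivity
    linarith
  · intro z z'
    have := hC.dist_le_mul z z'
    rw [Real.dist_eq, dist_eq_norm] at this
    refine this.trans ?_
    gcongr
    have := abs_nonneg M
    linarith

def rho (d : ℕ) : Ed d → ℝ := (exists_rho d).choose
lemma rho_spec (d : ℕ) : ContDiff ℝ (⊤ : ℕ∞) (rho d) ∧ HasCompactSupport (rho d) ∧ (∀ z, 0 ≤ rho d z) ∧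
    (∀ z, 1 < ‖z‖ → rho d z = 0) ∧ ∫ z, rho d z = 1 ∧
    ∃ L : ℝ, 0 < L ∧ (∀ z, rho d z ≤ L) ∧ ∀ z z', |rho d z - rho d z'| ≤ L * ‖z - z'‖ :=
  (exists_rho d).choose_spec
def Lr (d : ℕ) : ℝ := (rho_spec d).2.2.2.2.2.choose
lemma Lr_spec (d : ℕ) : 0 < Lr d ∧ (∀ z, rho d z ≤ Lr d) ∧ ∀ z z', |rho d z - rho d z'| ≤ Lr d * ‖z - z'‖ :=
  (rho_spec d).2.2.2.2.2.choose_spec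
lemma rho_contDiff : ContDiff ℝ (⊤ : ℕ∞) (rho d) := (rho_spec d).1
lemma rho_supp : HasCompactSupport (rho d) := (rho_spec d).2.1
lemma rho_nonneg (z : Ed d) : 0 ≤ rho d z := (rho_spec d).2.2.1 z
lemma rho_zero (z : Ed d) (hz : 1 < ‖z‖) : rho d z = 0 := (rho_spec d).2.2.2.1 z hz
lemma rho_int : ∫ z, rho d z = 1 := (rho_spec d).2.2.2.2.1

def rk (k : ℕ) (z : Ed d) : ℝ := 2 ^ (k * d) * rho d ((2 ^ k : ℝ) • z)

lemma rk_contDiff (k : ℕ) : ContDiff ℝ (⊤ : ℕ∞) (rk (d := d) k) := by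
  unfold rk
  have := rho_contDiff (d := d)
  fun_prop

lemma rk_cont (k : ℕ) : Continuous (rk (d := d) k) := (rk_contDiff k).continuous

lemma rk_nonneg (k : ℕ) (z : Ed d) : 0 ≤ rk k z := mul_nonneg (by positivity) (rho_nonneg _)

lemma rk_zero (k : ℕ) (z : Ed d) (hz : (2 ^ k)⁻¹ < ‖z‖) : rk k z = 0 := by
  unfold rk
  rw [rho_zero, mul_zero]
  rw [norm_smul, Real.norm_of_nonneg (by positivity)]
  rw [inv_lt_iff_one_lt_mul₀ (by positivity)] at hz
  linarith

lemma rk_supp (k : ℕ) : HasCompactSupport (rk (d := d) k) := by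
  apply HasCompactSupport.of_support_subset_isCompact (isCompact_closedBall (0 : Ed d) ((2 ^ k)⁻¹))
  intro z hz
  by_contra h
  simp at h
  exact hz (rk_zero k z h)

lemma rk_int (k : ℕ) : ∫ z, rk (d := d) k z = 1 := by
  unfold rk
  rw [integral_const_mul, Measure.integral_comp_smul_of_nonneg _ _ _ (hR := by positivity), rho_int]
  simp [pow_mul]

lemma rk_le (k : ℕ) (z : Ed d) : rk k z ≤ Lr d * 2 ^ (k * d) := by
  unfold rk
  rw [mul_comm]
  gcongr
  exact (Lr_spec d).2.1 _

lemma rk_lip (k : ℕ) (z z' : Ed d) : |rk k z - rk k z'| ≤ (Lr d * (2 ^ k * ‖z - z'‖)) * 2 ^ (k * d) := by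
  unfold rk
  rw [← mul_sub, abs_mul, abs_of_nonneg (by positivity), mul_comm]
  gcongr
  refine ((Lr_spec d).2.2 _ _).trans (le_of_eq ?_)
  rw [← smul_sub, norm_smul, Real.norm_of_nonneg (by positivity)]

/-- mollification -/
def Pk (k : ℕ) (w : Ed d → Ed d) (x : Ed d) : Ed d := ∫ t, rk k t • w (x - t)

lemma Pk_integrable (k : ℕ) {w : Ed d → Ed d} (hw : LocallyIntegrable w) (x : Ed d) :
    Integrable fun t => rk k t • w (x - t) :=
  (rk_supp k).convolutionExists_left (ContinuousLinearMap.lsmul ℝ ℝ) (rk_cont k) hw x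

lemma Pk_eq_conv (k : ℕ) (w : Ed d → Ed d) :
    Pk k w = MeasureTheory.convolution (rk k) w (ContinuousLinearMap.lsmul ℝ ℝ) volume := rfl

lemma Pk_contDiff (k : ℕ) {w : Ed d → Ed d} (hw : LocallyIntegrable w) : ContDiff ℝ (⊤ : ℕ∞) (Pk k w) := by
  rw [Pk_eq_conv]
  exact (rk_supp k).contDiff_convolution_left _ (rk_contDiff k) hw

lemma Pk_supp (k : ℕ) {w : Ed d → Ed d} (hw : HasCompactSupport w) : HasCompactSupport (Pk k w) := by
  rw [Pk_eq_conv]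
  exact (rk_supp k).convolution _ hw

lemma kernel_osc (k : ℕ) {w : Ed d → Ed d} (x : Ed d) {g : Ed d → ℝ} {c : ℝ}
    (hg1 : ∀ t, |g t| ≤ c * 2 ^ (k * d)) (hg2 : ∀ t, 2 * (2 ^ k)⁻¹ < ‖t‖ → g t = 0) :
    ‖∫ t, g t • (w (x - t) - w x)‖ₑ ≤ ENNReal.ofReal c * osc k w x := by
  refine (enorm_integral_le_lintegral_enorm _).trans ?_
  unfold osc
  have hc : 0 ≤ c := by
    have := (abs_nonneg _).trans (hg1 0)
    by_contra h
    push Not at h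
    have : c * 2 ^ (k * d) < 0 := mul_neg_of_neg_of_pos h (by positivity)
    linarith
  rw [← mul_assoc, ← ENNReal.ofReal_mul hc, ← lintegral_const_mul' _ _ (by simp),
    ← lintegral_indicator Metric.isClosed_closedBall.measurableSet]
  refine lintegral_mono fun t => ?_
  by_cases ht : t ∈ Metric.closedBall (0 : Ed d) (2 * (2 ^ k)⁻¹)
  · rw [indicator_of_mem ht, enorm_smul]
    gcongr
    rw [← ofReal_norm]
    exact ENNReal.ofReal_le_ofReal (hg1 t)
  · rw [indicator_of_notMem ht, hg2 t (by simpa using ht)]; simp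

lemma rk_integrable (k : ℕ) : Integrable (rk (d := d) k) := (rk_cont k).integrable_of_hasCompactSupport (rk_supp k)

lemma Pk_diff1 (k : ℕ) {w : Ed d → Ed d} (hw : LocallyIntegrable w) (x : Ed d) :
    ‖w x - Pk k w x‖ₑ ≤ ENNReal.ofReal (Lr d) * osc k w x := by
  have e : w x - Pk k w x = - ∫ t, rk k t • (w (x - t) - w x) := by
    simp_rw [smul_sub]
    rw [integral_sub (Pk_integrable k hw x) ((rk_integrable k).smul_const _), integral_smul_const, rk_int]
    simp [Pk]
  rw [e, enorm_neg]
  refine kernel_osc k x ?_ ?_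
  · intro t; rw [abs_of_nonneg (rk_nonneg k t)]; exact rk_le k t
  · intro t ht
    apply rk_zero
    have : (0:ℝ) < (2 ^ k)⁻¹ := by positivity
    linarith

lemma Pk_diff2 (k : ℕ) {w : Ed d → Ed d} (hw : LocallyIntegrable w) (x h : Ed d) (hh : 2 ^ k * ‖h‖ ≤ 1) :
    ‖Pk k w (x + h) - Pk k w x‖ₑ ≤ ENNReal.ofReal (Lr d * (2 ^ k * ‖h‖)) * osc k w x := by
  have e1 : Pk k w (x + h) = ∫ t, rk k (t + h) • w (x - t) := by
    unfold Pk
    rw [← integral_add_right_eq_self (fun t => rk k t • w (x + h - t)) h]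
    congr 1; ext1 t
    congr 2; abel
  have i1 : Integrable fun t => rk k (t + h) • w (x - t) := by
    have := (Pk_integrable k hw (x + h)).comp_add_right h
    refine this.congr (Eventually.of_forall fun t => ?_)
    simp only
    congr 2; abel
  have i2 := (rk_integrable (d := d) k).comp_add_right h
  have i3 := rk_integrable (d := d) k
  have e : Pk k w (x + h) - Pk k w x = ∫ t, (rk k (t + h) - rk k t) • (w (x - t) - w x) := by
    have i4 : Integrable fun t => rk k (t + h) • w (x - t) - rk k t • w (x - t) := i1.sub (Pk_integrable k hw x)
    have i5 : Integrable fun t => (rk k (t + h) - rk k t) • w x := (i2.sub i3).smul_const _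
    have e2 : ∀ t, (rk k (t + h) - rk k t) • (w (x - t) - w x) =
        (rk k (t + h) • w (x - t) - rk k t • w (x - t)) - (rk k (t + h) - rk k t) • w x := by
      intro t; module
    simp_rw [e2]
    rw [integral_sub i4 i5, integral_sub i1 (Pk_integrable k hw x), integral_smul_const,
      integral_sub i2 i3, integral_add_right_eq_self (fun t => rk k t) h, e1]
    simp [Pk]
  rw [e]
  refine kernel_osc k x ?_ ?_
  · intro t
    have := rk_lip k (t + h) t
    simpa using this
  · intro t ht
    have hp : (0:ℝ) < (2 ^ k)⁻¹ := by positivity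
    have h1 : ‖h‖ ≤ (2 ^ k)⁻¹ := by
      rw [← one_div, le_div_iff₀ (by positivity)]; linarith
    rw [rk_zero k t (by linarith), rk_zero k (t + h), sub_zero]
    have : ‖t‖ ≤ ‖t + h‖ + ‖h‖ := by
      calc ‖t‖ = ‖t + h - h‖ := by simp
        _ ≤ _ := norm_sub_le _ _
    linarith

lemma Pk_meas (k : ℕ) {w : Ed d → Ed d} (hw : Measurable w) : Measurable (Pk k w) := by
  unfold Pk
  have : Measurable fun q : Ed d × Ed d => rk k q.2 • w (q.1 - q.2) := by
    have := (rk_cont (d := d) k).measurable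
    fun_prop
  exact (this.stronglyMeasurable.integral_prod_right').measurable

/-- the operator -/
def Tw (θ : ℝ) (N : ℕ) (w : Ed d → Ed d) (x : Ed d) : Ed d :=
  ∑ k ∈ Finset.Icc 1 N, ((θ - 1) * θ ^ (k - 1)) • (w x - Pk k w x)

lemma Tw_meas (θ : ℝ) (N : ℕ) {w : Ed d → Ed d} (hw : Measurable w) : Measurable (Tw θ N w) := by
  unfold Tw
  refine Finset.measurable_fun_sum _ fun k _ => ?_
  have := Pk_meas k hw
  fun_prop

lemma geom_lam (θ : ℝ) (n : ℕ) : ∑ k ∈ Finset.Icc 1 n, (θ - 1) * θ ^ (k - 1) = θ ^ n - 1 := by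
  induction n with
  | zero => simp
  | succ n ih =>
    rw [Finset.sum_Icc_succ_top (by omega), ih]
    simp [pow_succ]; ring

lemma om_sub_one (θ : ℝ) (N : ℕ) (h : Ed d) :
    om θ N h - 1 = ∑ k ∈ Finset.Icc 1 N, (θ - 1) * θ ^ (k - 1) * (if 2 ^ k * ‖h‖ ≤ 1 then 1 else 0) := by
  unfold om
  rw [← geom_lam]
  have : Finset.Icc 1 (lam N ‖h‖) = (Finset.Icc 1 N).filter (fun k => 2 ^ k * ‖h‖ ≤ 1) := by
    ext k
    simp only [Finset.mem_filter, Finset.mem_Icc]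
    constructor
    · rintro ⟨h1, h2⟩
      have h3 := lam_le N ‖h‖
      refine ⟨⟨h1, by omega⟩, ?_⟩
      rw [mul_comm]
      exact (le_lam_iff (norm_nonneg h) h1 (by omega)).1 h2
    · rintro ⟨⟨h1, h2⟩, h3⟩
      rw [mul_comm] at h3
      exact ⟨h1, (le_lam_iff (norm_nonneg h) h1 h2).2 h3⟩
  rw [this, Finset.sum_filter]
  simp

lemma enorm_ofReal_smul {c : ℝ} (hc : 0 ≤ c) (v : Ed d) : ‖c • v‖ₑ = ENNReal.ofReal c * ‖v‖ₑ := by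
  rw [enorm_smul, ← ofReal_norm, Real.norm_of_nonneg hc]

lemma ck_le {θ : ℝ} (hθ : 1 ≤ θ) (k : ℕ) : (θ - 1) * θ ^ (k - 1) ≤ (θ - 1) * θ ^ k := by
  exact mul_le_mul_of_nonneg_left (pow_le_pow_right₀ hθ (by omega)) (by linarith)

lemma Tw_diff {θ : ℝ} (hθ : 1 ≤ θ) (N : ℕ) {w : Ed d → Ed d} (hw : LocallyIntegrable w) (x h : Ed d) :
    ‖(Tw θ N w (x + h) - Tw θ N w x) - (om θ N h - 1) • (w (x + h) - w x)‖ₑ ≤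
      ENNReal.ofReal (Lr d * (θ - 1)) * Bf θ N w x h := by
  rw [om_sub_one]
  unfold Tw Bf
  rw [Finset.sum_smul, ← Finset.sum_sub_distrib, ← Finset.sum_sub_distrib, Finset.mul_sum]
  refine (enorm_sum_le _ _).trans (Finset.sum_le_sum fun k _ => ?_)
  have hθ1 : 0 ≤ θ - 1 := by linarith
  have hL := (Lr_spec d).1.le
  set c := (θ - 1) * θ ^ (k - 1) with hc
  have hc0 : 0 ≤ c := by positivity
  have key : ∀ D : Ed d, ‖D‖ₑ ≤ ENNReal.ofReal (Lr d * min (2 ^ k * ‖h‖) 1) * (osc k w x + osc k w (x + h)) →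
      ‖c • D‖ₑ ≤ ENNReal.ofReal (Lr d * (θ - 1)) * (ENNReal.ofReal (θ ^ k * min (2 ^ k * ‖h‖) 1) * (osc k w x + osc k w (x + h))) := by
    intro D hD
    rw [enorm_ofReal_smul hc0]
    calc _ ≤ ENNReal.ofReal ((θ - 1) * θ ^ k) * (ENNReal.ofReal (Lr d * min (2 ^ k * ‖h‖) 1) * (osc k w x + osc k w (x + h))) := by
          exact mul_le_mul' (ENNReal.ofReal_le_ofReal (ck_le hθ k)) hD
      _ = _ := by
          rw [← mul_assoc, ← mul_assoc, ← ENNReal.ofReal_mul (by positivity), ← ENNReal.ofReal_mul (by positivity)]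
          congr 2; ring
  by_cases hk : 2 ^ k * ‖h‖ ≤ 1
  · have e : c • (w (x + h) - Pk k w (x + h)) - c • (w x - Pk k w x) - (c * if 2 ^ k * ‖h‖ ≤ 1 then 1 else 0) • (w (x + h) - w x)
        = c • (-(Pk k w (x + h) - Pk k w x)) := by
      rw [if_pos hk]; module
    rw [e]
    apply key
    rw [enorm_neg, min_eq_left hk]
    refine (Pk_diff2 k hw x h hk).trans ?_
    gcongr
    exact le_self_add
  · have e : c • (w (x + h) - Pk k w (x + h)) - c • (w x - Pk k w x) - (c * if 2 ^ k * ‖h‖ ≤ 1 then 1 else 0) • (w (x + h) - w x)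
        = c • ((w (x + h) - Pk k w (x + h)) - (w x - Pk k w x)) := by
      rw [if_neg hk]; module
    rw [e]
    apply key
    push Not at hk
    rw [min_eq_right hk.le, mul_one]
    refine enorm_sub_le.trans ?_
    rw [mul_add, add_comm]
    exact add_le_add (Pk_diff1 k hw x) (Pk_diff1 k hw (x + h))

lemma Tw_bound {θ : ℝ} (hθ : 1 ≤ θ) (N : ℕ) {w : Ed d → Ed d} (hw : LocallyIntegrable w) (x h : Ed d) (hh : 1 ≤ ‖h‖) :
    ‖Tw θ N w x‖ₑ ≤ ENNReal.ofReal (Lr d * (θ - 1)) * Bf θ N w x h := by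
  unfold Tw Bf
  rw [Finset.mul_sum]
  refine (enorm_sum_le _ _).trans (Finset.sum_le_sum fun k _ => ?_)
  have hθ1 : 0 ≤ θ - 1 := by linarith
  have hL := (Lr_spec d).1.le
  have h2 : (1:ℝ) ≤ 2 ^ k * ‖h‖ := one_le_mul_of_one_le_of_one_le (one_le_pow₀ (by norm_num)) hh
  rw [min_eq_right h2, mul_one, enorm_ofReal_smul (by positivity)]
  calc _ ≤ ENNReal.ofReal ((θ - 1) * θ ^ k) * (ENNReal.ofReal (Lr d) * (osc k w x + osc k w (x + h))) := by
        exact mul_le_mul' (ENNReal.ofReal_le_ofReal (ck_le hθ k))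
          ((Pk_diff1 k hw x).trans (mul_le_mul' le_rfl le_self_add))
    _ = _ := by
          rw [← mul_assoc, ← mul_assoc, ← ENNReal.ofReal_mul (by positivity), ← ENNReal.ofReal_mul (by positivity)]
          congr 2; ring

end SectM3

noncomputable section SectM4
variable {d : ℕ}

def Kn (d : ℕ) (s p : ℝ) (h : Ed d) : ℝ≥0∞ := ENNReal.ofReal (Ks d s p h)

lemma Kn_meas (s p : ℝ) : Measurable (Kn d s p) := by
  unfold Kn
  have := Ks_meas (d := d) s p
  fun_prop

lemma Kn_le_Wt (s p : ℝ) {θ : ℝ} (hθ : 1 ≤ θ) (N : ℕ) (h : Ed d) : Kn d s p h ≤ Wt d s p θ N h := by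
  unfold Kn Wt
  apply ENNReal.ofReal_le_ofReal
  exact le_mul_of_one_le_right (Ks_nonneg s p h) (om_one_le hθ N h)

lemma Vt_le_Kn (s : ℝ) {p : ℝ} (hp : 2 ≤ p) {θ : ℝ} (hθ : 1 ≤ θ) (N : ℕ) (h : Ed d) : Vt d s p θ N h ≤ Kn d s p h := by
  unfold Kn Vt
  apply ENNReal.ofReal_le_ofReal
  exact mul_le_of_le_one_right (Ks_nonneg s p h) (Real.rpow_le_one_of_one_le_of_nonpos (om_one_le hθ N h) (by linarith))

lemma Kn_le_Vt (s : ℝ) {p : ℝ} (hp : 2 ≤ p) {θ : ℝ} (hθ : 1 ≤ θ) (N : ℕ) (h : Ed d) :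
    Kn d s p h ≤ ENNReal.ofReal ((θ ^ N) ^ (p - 1)) * Vt d s p θ N h := by
  unfold Kn Vt
  have ho := om_pos hθ N h
  rw [← ENNReal.ofReal_mul (by positivity)]
  apply ENNReal.ofReal_le_ofReal
  have h1 : om θ N h ^ (p - 1) ≤ (θ ^ N) ^ (p - 1) :=
    Real.rpow_le_rpow ho.le (om_le hθ N h) (by linarith)
  have h2 : om θ N h ^ (p - 1) * om θ N h ^ (1 - p) = 1 := by
    rw [← Real.rpow_add ho]; simp
  calc Ks d s p h = Ks d s p h * (om θ N h ^ (p - 1) * om θ N h ^ (1 - p)) := by rw [h2, mul_one]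
    _ ≤ Ks d s p h * ((θ ^ N) ^ (p - 1) * om θ N h ^ (1 - p)) := by
      gcongr
      exact Ks_nonneg s p h
    _ = _ := by ring

lemma Wt_le_Kn (s p : ℝ) {θ : ℝ} (hθ : 1 ≤ θ) (N : ℕ) (h : Ed d) :
    Wt d s p θ N h ≤ ENNReal.ofReal (θ ^ N) * Kn d s p h := by
  unfold Kn Wt
  rw [← ENNReal.ofReal_mul (by positivity)]
  apply ENNReal.ofReal_le_ofReal
  rw [mul_comm]
  gcongr
  · exact Ks_nonneg s p h
  · exact om_le hθ N h

def CM (d : ℕ) (s p : ℝ) : ℝ≥0∞ :=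
  (∫⁻ h in Metric.closedBall (0 : Ed d) 1, ENNReal.ofReal (‖h‖ ^ ((1 - s) / 2 * p - d))) +
    ∫⁻ h in {h : Ed d | 1 < ‖h‖}, ENNReal.ofReal (Ks d s p h)

lemma CM_ne_top (hd : 2 ≤ d) {s p : ℝ} (hs : 0 < s) (hs1 : s < 1) (hp : 2 ≤ p) : CM d s p ≠ ∞ := by
  unfold CM
  have h1 : 0 < (1 - s) / 2 * p := by
    have : 0 < 1 - s := by linarith
    positivity
  exact ENNReal.add_ne_top.2 ⟨(lint_inner hd (by linarith)).ne, (lint_Ks_trunc (by positivity) one_pos).ne⟩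

lemma CM_est {s p e : ℝ} (hp : 2 ≤ p) (he : 0 ≤ e) (hes : e ≤ (1 - s) / 2 * p) (N : ℕ) :
    ∫⁻ h : Ed d, ENNReal.ofReal (min 1 ‖h‖) ^ p * Wt d s p (2 ^ e) N h ≤ CM d s p := by
  unfold CM
  have hc : (Metric.closedBall (0 : Ed d) 1)ᶜ = {h : Ed d | 1 < ‖h‖} := by ext; simp
  rw [← lintegral_add_compl _ (Metric.isClosed_closedBall (x := (0 : Ed d)) (ε := 1)).measurableSet, hc]
  refine add_le_add ?_ ?_
  · refine setLIntegral_mono' Metric.isClosed_closedBall.measurableSet fun h hh => ?_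
    have hh : ‖h‖ ≤ 1 := by simpa using hh
    by_cases h0 : h = 0
    · simp [h0, ENNReal.zero_rpow_of_pos (by linarith : 0 < p)]
    have hpos : 0 < ‖h‖ := by simpa using h0
    rw [min_eq_right hh, ENNReal.ofReal_rpow_of_nonneg hpos.le (by linarith)]
    unfold Wt
    rw [← ENNReal.ofReal_mul (by positivity)]
    apply ENNReal.ofReal_le_ofReal
    calc ‖h‖ ^ p * (Ks d s p h * om (2 ^ e) N h) ≤ ‖h‖ ^ p * (Ks d s p h * ‖h‖ ^ (-e)) := by
          gcongr
          · exact Ks_nonneg s p h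
          · exact om_le_rpow he N h0 hh
      _ = ‖h‖ ^ (p + (-((d:ℝ) + s * p) + -e)) := by
          unfold Ks
          rw [Real.rpow_add hpos, Real.rpow_add hpos]
      _ ≤ _ := by
          apply Real.rpow_le_rpow_of_exponent_ge hpos hh
          linarith
  · refine setLIntegral_mono' (measurableSet_lt measurable_const measurable_norm) fun h hh => ?_
    have hh : 1 < ‖h‖ := hh
    rw [min_eq_left hh.le]
    unfold Wt
    rw [om_eq_one N hh]
    simp

/-- commutator estimate -/
lemma cut_est {p : ℝ} (hp : 2 ≤ p) {ζ : Ed d → ℝ} {L : ℝ} (hL : 0 ≤ L) (hζ : ∀ x h, |ζ (x + h) - ζ x| ≤ L * min 1 ‖h‖)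
    {v : Ed d → Ed d} (hv : Measurable v) {W : Ed d → ℝ≥0∞} (hW : Measurable W) :
    ∫⁻ h, ∫⁻ x, ‖(ζ (x + h) - ζ x) • v (x + h)‖ₑ ^ p * W h ≤
      ENNReal.ofReal L ^ p * (∫⁻ h, ENNReal.ofReal (min 1 ‖h‖) ^ p * W h) * ∫⁻ x, ‖v x‖ₑ ^ p := by
  calc _ ≤ ∫⁻ h, ∫⁻ x, (ENNReal.ofReal L ^ p * (ENNReal.ofReal (min 1 ‖h‖) ^ p * W h)) * ‖v (x + h)‖ₑ ^ p := by
        refine lintegral_mono fun h => lintegral_mono fun x => ?_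
        rw [enorm_smul, ENNReal.mul_rpow_of_nonneg _ _ (by linarith : 0 ≤ p)]
        have h1 : ‖ζ (x + h) - ζ x‖ₑ ≤ ENNReal.ofReal L * ENNReal.ofReal (min 1 ‖h‖) := by
          rw [← ENNReal.ofReal_mul hL, ← ofReal_norm]
          exact ENNReal.ofReal_le_ofReal (hζ x h)
        calc _ ≤ ((ENNReal.ofReal L * ENNReal.ofReal (min 1 ‖h‖)) ^ p * ‖v (x + h)‖ₑ ^ p) * W h := by
              refine mul_le_mul' (mul_le_mul' (ENNReal.rpow_le_rpow h1 (by linarith)) le_rfl) le_rfl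
          _ = _ := by
              rw [ENNReal.mul_rpow_of_nonneg _ _ (by linarith : 0 ≤ p)]; ring
    _ = ∫⁻ h, ENNReal.ofReal L ^ p * ((ENNReal.ofReal (min 1 ‖h‖) ^ p * W h) * ∫⁻ x, ‖v x‖ₑ ^ p) := by
        refine lintegral_congr fun h => ?_
        rw [lintegral_const_mul _ (by fun_prop), lintegral_add_right_eq_self (fun x => ‖v x‖ₑ ^ p) h, mul_assoc]
    _ = _ := by
        rw [lintegral_const_mul _ (by fun_prop), lintegral_mul_const _ (by fun_prop), mul_assoc]

def cS (d : ℕ) (s p : ℝ) : ℝ≥0∞ := ∫⁻ h in {h : Ed d | 1 < ‖h‖}, Kn d s p h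

lemma cS_ne_top {s p : ℝ} (hs : 0 < s) (hp : 2 ≤ p) : cS d s p ≠ ∞ := (lint_Ks_trunc (by positivity) one_pos).ne

lemma cS_ne_zero (hd : 2 ≤ d) {s p : ℝ} : cS d s p ≠ 0 := by
  unfold cS
  rw [← pos_iff_ne_zero, setLIntegral_pos_iff (Kn_meas s p)]
  have h1 : Function.support (Kn d s p) ∩ {h : Ed d | 1 < ‖h‖} = {h : Ed d | 1 < ‖h‖} := by
    apply inter_eq_right.2
    intro h hh
    have hh : 0 < ‖h‖ := lt_trans one_pos hh
    simp only [Function.mem_support, Kn, Ks]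
    have : 0 < ‖h‖ ^ (-((d:ℝ) + s * p)) := by positivity
    simpa using this
  rw [h1]
  have ho : IsOpen {h : Ed d | 1 < ‖h‖} := isOpen_lt continuous_const continuous_norm
  refine ho.measure_pos volume ⟨EuclideanSpace.single ⟨0, by omega⟩ 2, ?_⟩
  simp

def CT (d : ℕ) (s p : ℝ) : ℝ≥0∞ := (cS d s p)⁻¹ * (ENNReal.ofReal (Lr d) ^ p * CBf d s p)

lemma CT_ne_top (hd : 2 ≤ d) {s p : ℝ} (hs : 0 < s) (hs1 : s < 1) (hp : 2 ≤ p) : CT d s p ≠ ∞ := by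
  unfold CT
  exact ENNReal.mul_ne_top (ENNReal.inv_ne_top.2 (cS_ne_zero hd)) (ENNReal.mul_ne_top
    (ENNReal.rpow_ne_top_of_nonneg (by linarith) (by simp)) (CBf_ne_top hd hs hs1 hp))

lemma Tw_Lp (hd : 2 ≤ d) {s p e : ℝ} (hs : 0 < s) (hs1 : s < 1) (hp : 2 ≤ p) (he : 0 ≤ e) (he1 : e ≤ 1)
    (hep : e * (p - 1) ≤ s * p / 4) (N : ℕ) {w : Ed d → Ed d} (hw : Measurable w) (hwl : LocallyIntegrable w) :
    ∫⁻ x, ‖Tw (2 ^ e) N w x‖ₑ ^ p ≤ CT d s p * ENNReal.ofReal (2 ^ e - 1) ^ p * En p (Wt d s p (2 ^ e) N) w := by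
  have hθ : (1:ℝ) ≤ 2 ^ e := Real.one_le_rpow (by norm_num) he
  have hL := (Lr_spec d).1.le
  have hTm := Tw_meas (2 ^ e) N hw
  have key : cS d s p * ∫⁻ x, ‖Tw (2 ^ e) N w x‖ₑ ^ p ≤
      ENNReal.ofReal (Lr d * (2 ^ e - 1)) ^ p * (CBf d s p * En p (Wt d s p (2 ^ e) N) w) := by
    calc _ = ∫⁻ h in {h : Ed d | 1 < ‖h‖}, Kn d s p h * ∫⁻ x, ‖Tw (2 ^ e) N w x‖ₑ ^ p := by
          unfold cS
          rw [lintegral_mul_const _ (Kn_meas s p)]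
      _ ≤ ∫⁻ h in {h : Ed d | 1 < ‖h‖}, ∫⁻ x, ENNReal.ofReal (Lr d * (2 ^ e - 1)) ^ p * (Bf (2 ^ e) N w x h ^ p * Vt d s p (2 ^ e) N h) := by
          refine setLIntegral_mono' (measurableSet_lt measurable_const measurable_norm) fun h hh => ?_
          have hh : 1 < ‖h‖ := hh
          rw [← lintegral_const_mul _ (by fun_prop)]
          refine lintegral_mono fun x => ?_
          have h1 : Vt d s p (2 ^ e) N h = Kn d s p h := by
            unfold Vt Kn
            rw [om_eq_one N hh]; simp
          rw [h1, ← mul_assoc, ← ENNReal.mul_rpow_of_nonneg _ _ (by linarith : 0 ≤ p), mul_comm]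
          exact mul_le_mul' (ENNReal.rpow_le_rpow (Tw_bound hθ N hwl x h hh.le) (by linarith)) le_rfl
      _ ≤ ∫⁻ h, ∫⁻ x, ENNReal.ofReal (Lr d * (2 ^ e - 1)) ^ p * (Bf (2 ^ e) N w x h ^ p * Vt d s p (2 ^ e) N h) :=
          setLIntegral_le_lintegral _ _
      _ = ENNReal.ofReal (Lr d * (2 ^ e - 1)) ^ p * ∫⁻ h, ∫⁻ x, (Bf (2 ^ e) N w x h ^ p * Vt d s p (2 ^ e) N h) := by
          have hc : ENNReal.ofReal (Lr d * (2 ^ e - 1)) ^ p ≠ ∞ := ENNReal.rpow_ne_top_of_nonneg (by linarith) (by simp)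
          rw [← lintegral_const_mul' _ _ hc]
          refine lintegral_congr fun h => ?_
          rw [← lintegral_const_mul' _ _ hc]
      _ ≤ _ := mul_le_mul' le_rfl (B_est hd hs hs1 hp he he1 hep N hw)
  calc _ = (cS d s p)⁻¹ * (cS d s p * ∫⁻ x, ‖Tw (2 ^ e) N w x‖ₑ ^ p) := by
        rw [← mul_assoc, ENNReal.inv_mul_cancel (cS_ne_zero hd) (cS_ne_top hs hp), one_mul]
    _ ≤ _ := mul_le_mul' le_rfl key
    _ = _ := by
        unfold CT
        rw [ENNReal.ofReal_mul hL, ENNReal.mul_rpow_of_nonneg _ _ (by linarith : 0 ≤ p)]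
        ring

/-- energy of the remainder `R` -/
lemma R_est (hd : 2 ≤ d) {s p e : ℝ} (hs : 0 < s) (hs1 : s < 1) (hp : 2 ≤ p) (he : 0 ≤ e) (he1 : e ≤ 1)
    (hep : e * (p - 1) ≤ s * p / 4) (N : ℕ) {w : Ed d → Ed d} (hw : Measurable w) (hwl : LocallyIntegrable w) :
    ∫⁻ h, ∫⁻ x, ‖(Tw (2 ^ e) N w (x + h) - Tw (2 ^ e) N w x) - (om (2 ^ e) N h - 1) • (w (x + h) - w x)‖ₑ ^ p
      * Vt d s p (2 ^ e) N h ≤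
      ENNReal.ofReal (Lr d) ^ p * CBf d s p * ENNReal.ofReal (2 ^ e - 1) ^ p * En p (Wt d s p (2 ^ e) N) w := by
  have hθ : (1:ℝ) ≤ 2 ^ e := Real.one_le_rpow (by norm_num) he
  have hL := (Lr_spec d).1.le
  have hc : ENNReal.ofReal (Lr d * (2 ^ e - 1)) ^ p ≠ ∞ := ENNReal.rpow_ne_top_of_nonneg (by linarith) (by simp)
  calc _ ≤ ∫⁻ h, ∫⁻ x, ENNReal.ofReal (Lr d * (2 ^ e - 1)) ^ p * (Bf (2 ^ e) N w x h ^ p * Vt d s p (2 ^ e) N h) := by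
        refine lintegral_mono fun h => lintegral_mono fun x => ?_
        rw [← mul_assoc, ← ENNReal.mul_rpow_of_nonneg _ _ (by linarith : 0 ≤ p)]
        exact mul_le_mul' (ENNReal.rpow_le_rpow (Tw_diff hθ N hwl x h) (by linarith)) le_rfl
    _ = ENNReal.ofReal (Lr d * (2 ^ e - 1)) ^ p * ∫⁻ h, ∫⁻ x, (Bf (2 ^ e) N w x h ^ p * Vt d s p (2 ^ e) N h) := by
          rw [← lintegral_const_mul' _ _ hc]
          refine lintegral_congr fun h => ?_
          rw [← lintegral_const_mul' _ _ hc]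
    _ ≤ _ := mul_le_mul' le_rfl (B_est hd hs hs1 hp he he1 hep N hw)
    _ = _ := by
        rw [ENNReal.ofReal_mul hL, ENNReal.mul_rpow_of_nonneg _ _ (by linarith : 0 ≤ p)]
        ring

end SectM4

noncomputable section SectM5
variable {d : ℕ}

lemma om_Vt_Wt (s : ℝ) {p : ℝ} (hp : 2 ≤ p) {θ : ℝ} (hθ : 1 ≤ θ) (N : ℕ) (h : Ed d) :
    ENNReal.ofReal (om θ N h - 1) ^ p * Vt d s p θ N h ≤ Wt d s p θ N h := by
  unfold Vt Wt
  have ho := om_pos hθ N h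
  have ho1 := om_one_le hθ N h
  have hK := Ks_nonneg s p h
  rw [ENNReal.ofReal_rpow_of_nonneg (by linarith) (by linarith), ← ENNReal.ofReal_mul (Real.rpow_nonneg (by linarith) _)]
  apply ENNReal.ofReal_le_ofReal
  have h1 : (om θ N h - 1) ^ p ≤ om θ N h ^ p := Real.rpow_le_rpow (by linarith) (by linarith) (by linarith)
  have h2 : om θ N h ^ p * om θ N h ^ (1 - p) = om θ N h := by
    rw [← Real.rpow_add ho]; simp
  calc _ ≤ om θ N h ^ p * (Ks d s p h * om θ N h ^ (1 - p)) := by gcongr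
    _ = Ks d s p h * (om θ N h ^ p * om θ N h ^ (1 - p)) := by ring
    _ = _ := by rw [h2]

def CR (d : ℕ) (s p : ℝ) : ℝ≥0∞ := ENNReal.ofReal (Lr d) ^ p * CBf d s p

lemma CR_ne_top (hd : 2 ≤ d) {s p : ℝ} (hs : 0 < s) (hs1 : s < 1) (hp : 2 ≤ p) : CR d s p ≠ ∞ :=
  ENNReal.mul_ne_top (ENNReal.rpow_ne_top_of_nonneg (by linarith) (by simp)) (CBf_ne_top hd hs hs1 hp)

def CZ (d : ℕ) (s p L : ℝ) : ℝ≥0∞ := ENNReal.ofReal L ^ p * CM d s p * CT d s p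

lemma CZ_ne_top (hd : 2 ≤ d) {s p : ℝ} (hs : 0 < s) (hs1 : s < 1) (hp : 2 ≤ p) (L : ℝ) : CZ d s p L ≠ ∞ :=
  ENNReal.mul_ne_top (ENNReal.mul_ne_top (ENNReal.rpow_ne_top_of_nonneg (by linarith) (by simp))
    (CM_ne_top hd hs hs1 hp)) (CT_ne_top hd hs hs1 hp)

def Cphi (d : ℕ) (s p H L : ℝ) : ℝ≥0∞ :=
  2 ^ p * (ENNReal.ofReal H ^ p * (2 ^ p * (1 + CR d s p)) + CZ d s p L)

lemma Cphi_ne_top (hd : 2 ≤ d) {s p : ℝ} (hs : 0 < s) (hs1 : s < 1) (hp : 2 ≤ p) (H L : ℝ) : Cphi d s p H L ≠ ∞ := by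
  unfold Cphi
  have h1 := CZ_ne_top hd hs hs1 hp L
  have h2 := CR_ne_top hd hs hs1 hp
  have h3 : ENNReal.ofReal H ^ p ≠ ∞ := ENNReal.rpow_ne_top_of_nonneg (by linarith) (by simp)
  have h4 : (2:ℝ≥0∞) ^ p ≠ ∞ := ENNReal.rpow_ne_top_of_nonneg (by linarith) (by simp)
  finiteness

lemma tau_le {e p : ℝ} (hp : 2 ≤ p) (he1 : e ≤ 1) : ENNReal.ofReal (2 ^ e - 1) ^ p ≤ 1 := by
  have : (2:ℝ) ^ e ≤ 2 ^ (1:ℝ) := Real.rpow_le_rpow_of_exponent_le (by norm_num) he1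
  rw [Real.rpow_one] at this
  apply ENNReal.rpow_le_one _ (by linarith)
  rw [← ENNReal.ofReal_one]
  apply ENNReal.ofReal_le_ofReal
  linarith

lemma Tw_Lp1 (hd : 2 ≤ d) {s p e : ℝ} (hs : 0 < s) (hs1 : s < 1) (hp : 2 ≤ p) (he : 0 ≤ e) (he1 : e ≤ 1)
    (hep : e * (p - 1) ≤ s * p / 4) (N : ℕ) {w : Ed d → Ed d} (hw : Measurable w) (hwl : LocallyIntegrable w) :
    ∫⁻ x, ‖Tw (2 ^ e) N w x‖ₑ ^ p ≤ CT d s p * En p (Wt d s p (2 ^ e) N) w := by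
  refine (Tw_Lp hd hs hs1 hp he he1 hep N hw hwl).trans ?_
  refine mul_le_mul' ?_ le_rfl
  exact (mul_le_mul' le_rfl (tau_le hp he1)).trans (by rw [mul_one])

lemma Z_est (hd : 2 ≤ d) {s p e : ℝ} (hs : 0 < s) (hs1 : s < 1) (hp : 2 ≤ p) (he : 0 ≤ e) (he1 : e ≤ 1)
    (hes : e ≤ (1 - s) / 2 * p)
    (hep : e * (p - 1) ≤ s * p / 4) (N : ℕ) {w : Ed d → Ed d} (hw : Measurable w) (hwl : LocallyIntegrable w)
    {ζ : Ed d → ℝ} {L : ℝ} (hL : 0 ≤ L) (hζ : ∀ x h, |ζ (x + h) - ζ x| ≤ L * min 1 ‖h‖) :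
    ∫⁻ h, ∫⁻ x, ‖(ζ (x + h) - ζ x) • Tw (2 ^ e) N w (x + h)‖ₑ ^ p * Kn d s p h ≤
      CZ d s p L * En p (Wt d s p (2 ^ e) N) w := by
  have hθ : (1:ℝ) ≤ 2 ^ e := Real.one_le_rpow (by norm_num) he
  refine (cut_est hp hL hζ (Tw_meas _ N hw) (Kn_meas s p)).trans ?_
  unfold CZ
  rw [mul_assoc _ (CT d s p)]
  refine mul_le_mul' (mul_le_mul' le_rfl ?_) (Tw_Lp1 hd hs hs1 hp he he1 hep N hw hwl)
  refine le_trans (lintegral_mono fun h => ?_) (CM_est (d := d) hp he hes N)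
  exact mul_le_mul' le_rfl (Kn_le_Wt s p hθ N h)

lemma En_split {p : ℝ} (hp : 2 ≤ p) (ζ : Ed d → ℝ) (v : Ed d → Ed d) (x h : Ed d) :
    ‖ζ (x + h) • v (x + h) - ζ x • v x‖ₑ ^ p ≤
      2 ^ p * (‖ζ x • (v (x + h) - v x)‖ₑ ^ p + ‖(ζ (x + h) - ζ x) • v (x + h)‖ₑ ^ p) := by
  have e : ζ (x + h) • v (x + h) - ζ x • v x = ζ x • (v (x + h) - v x) + (ζ (x + h) - ζ x) • v (x + h) := by module
  rw [e]
  exact (ENNReal.rpow_le_rpow (enorm_add_le _ _) (by linarith)).trans (add_rpow_le2 hp _ _)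

lemma phi_est (hd : 2 ≤ d) {s p e : ℝ} (hs : 0 < s) (hs1 : s < 1) (hp : 2 ≤ p) (he : 0 ≤ e) (he1 : e ≤ 1)
    (hes : e ≤ (1 - s) / 2 * p)
    (hep : e * (p - 1) ≤ s * p / 4) (N : ℕ) {w : Ed d → Ed d} (hw : Measurable w) (hwl : LocallyIntegrable w)
    {ζ : Ed d → ℝ} {H L : ℝ} (hζm : Measurable ζ) (hζH : ∀ x, |ζ x| ≤ H) (hL : 0 ≤ L)
    (hζ : ∀ x h, |ζ (x + h) - ζ x| ≤ L * min 1 ‖h‖) :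
    En p (Vt d s p (2 ^ e) N) (fun x => ζ x • Tw (2 ^ e) N w x) ≤
      Cphi d s p H L * En p (Wt d s p (2 ^ e) N) w := by
  have hp0 : 0 ≤ p := by linarith
  have hθ : (1:ℝ) ≤ 2 ^ e := Real.one_le_rpow (by norm_num) he
  have h3 : ENNReal.ofReal H ^ p ≠ ∞ := ENNReal.rpow_ne_top_of_nonneg (by linarith) (by simp)
  have h4 : (2:ℝ≥0∞) ^ p ≠ ∞ := ENNReal.rpow_ne_top_of_nonneg (by linarith) (by simp)
  have hTm := Tw_meas (2 ^ e) N hw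
  have hVm := Vt_meas (d := d) s p (2 ^ e) N
  have hWm := Wt_meas (d := d) s p (2 ^ e) N
  have hom := om_meas (d := d) (2 ^ e) N
  set v := Tw (2 ^ e) N w with hv
  set V := Vt d s p (2 ^ e) N with hV
  set W := Wt d s p (2 ^ e) N with hW
  have hvE : ∫⁻ h, ∫⁻ x, ‖v (x + h) - v x‖ₑ ^ p * V h ≤ 2 ^ p * (1 + CR d s p) * En p W w := by
    calc _ ≤ ∫⁻ h, ∫⁻ x, 2 ^ p * (‖w (x + h) - w x‖ₑ ^ p * W h + ‖(v (x + h) - v x) - (om (2 ^ e) N h - 1) • (w (x + h) - w x)‖ₑ ^ p * V h) := by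
          refine lintegral_mono fun h => lintegral_mono fun x => ?_
          have e1 : v (x + h) - v x = (om (2 ^ e) N h - 1) • (w (x + h) - w x) + ((v (x + h) - v x) - (om (2 ^ e) N h - 1) • (w (x + h) - w x)) := by module
          calc _ ≤ (2 ^ p * (‖(om (2 ^ e) N h - 1) • (w (x + h) - w x)‖ₑ ^ p + ‖(v (x + h) - v x) - (om (2 ^ e) N h - 1) • (w (x + h) - w x)‖ₑ ^ p)) * V h := by
                refine mul_le_mul' ?_ le_rfl
                nth_rw 1 [e1]
                exact (ENNReal.rpow_le_rpow (enorm_add_le _ _) (by linarith)).trans (add_rpow_le2 hp _ _)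
            _ = 2 ^ p * (‖(om (2 ^ e) N h - 1) • (w (x + h) - w x)‖ₑ ^ p * V h + ‖(v (x + h) - v x) - (om (2 ^ e) N h - 1) • (w (x + h) - w x)‖ₑ ^ p * V h) := by ring
            _ ≤ _ := by
                refine mul_le_mul' le_rfl (add_le_add ?_ le_rfl)
                rw [enorm_ofReal_smul (by have := om_one_le hθ N h; linarith), ENNReal.mul_rpow_of_nonneg _ _ hp0,
                  mul_comm (ENNReal.ofReal _ ^ p), mul_assoc]
                exact mul_le_mul' le_rfl (om_Vt_Wt s hp hθ N h)
      _ = 2 ^ p * (En p W w + ∫⁻ h, ∫⁻ x, ‖(v (x + h) - v x) - (om (2 ^ e) N h - 1) • (w (x + h) - w x)‖ₑ ^ p * V h) := by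
          have e2 : ∀ h, ∫⁻ x, 2 ^ p * (‖w (x + h) - w x‖ₑ ^ p * W h + ‖(v (x + h) - v x) - (om (2 ^ e) N h - 1) • (w (x + h) - w x)‖ₑ ^ p * V h) =
              2 ^ p * ((∫⁻ x, ‖w (x + h) - w x‖ₑ ^ p * W h) + ∫⁻ x, ‖(v (x + h) - v x) - (om (2 ^ e) N h - 1) • (w (x + h) - w x)‖ₑ ^ p * V h) := by
            intro h
            rw [lintegral_const_mul' _ _ h4, lintegral_add_left (by fun_prop)]
          simp_rw [e2]
          rw [lintegral_const_mul' _ _ h4, lintegral_add_left (meas_En hw hWm)]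
          rfl
      _ ≤ 2 ^ p * (En p W w + CR d s p * En p W w) := by
          refine mul_le_mul' le_rfl (add_le_add le_rfl ?_)
          refine (R_est hd hs hs1 hp he he1 hep N hw hwl).trans ?_
          refine mul_le_mul' ?_ le_rfl
          exact (mul_le_mul' le_rfl (tau_le hp he1)).trans (by rw [mul_one, CR])
      _ = _ := by ring
  have hZE : ∫⁻ h, ∫⁻ x, ‖(ζ (x + h) - ζ x) • v (x + h)‖ₑ ^ p * V h ≤ CZ d s p L * En p W w := by
    refine le_trans (lintegral_mono fun h => lintegral_mono fun x => ?_) (Z_est hd hs hs1 hp he he1 hes hep N hw hwl hL hζ)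
    exact mul_le_mul' le_rfl (Vt_le_Kn s hp hθ N h)
  calc _ ≤ ∫⁻ h, ∫⁻ x, 2 ^ p * (ENNReal.ofReal H ^ p * (‖v (x + h) - v x‖ₑ ^ p * V h) + ‖(ζ (x + h) - ζ x) • v (x + h)‖ₑ ^ p * V h) := by
        refine lintegral_mono fun h => lintegral_mono fun x => ?_
        calc _ ≤ (2 ^ p * (‖ζ x • (v (x + h) - v x)‖ₑ ^ p + ‖(ζ (x + h) - ζ x) • v (x + h)‖ₑ ^ p)) * V h :=
              mul_le_mul' (En_split hp ζ v x h) le_rfl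
          _ ≤ (2 ^ p * (ENNReal.ofReal H ^ p * ‖v (x + h) - v x‖ₑ ^ p + ‖(ζ (x + h) - ζ x) • v (x + h)‖ₑ ^ p)) * V h := by
              refine mul_le_mul' (mul_le_mul' le_rfl (add_le_add ?_ le_rfl)) le_rfl
              rw [← ENNReal.mul_rpow_of_nonneg _ _ hp0, enorm_smul]
              refine ENNReal.rpow_le_rpow (mul_le_mul' ?_ le_rfl) hp0
              rw [← ofReal_norm]
              exact ENNReal.ofReal_le_ofReal (hζH x)
          _ = _ := by ring
    _ = 2 ^ p * (ENNReal.ofReal H ^ p * (∫⁻ h, ∫⁻ x, ‖v (x + h) - v x‖ₑ ^ p * V h) + ∫⁻ h, ∫⁻ x, ‖(ζ (x + h) - ζ x) • v (x + h)‖ₑ ^ p * V h) := by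
        have e2 : ∀ h, ∫⁻ x, 2 ^ p * (ENNReal.ofReal H ^ p * (‖v (x + h) - v x‖ₑ ^ p * V h) + ‖(ζ (x + h) - ζ x) • v (x + h)‖ₑ ^ p * V h) =
            2 ^ p * (ENNReal.ofReal H ^ p * (∫⁻ x, ‖v (x + h) - v x‖ₑ ^ p * V h) + ∫⁻ x, ‖(ζ (x + h) - ζ x) • v (x + h)‖ₑ ^ p * V h) := by
          intro h
          rw [lintegral_const_mul' _ _ h4, lintegral_add_left (by fun_prop), lintegral_const_mul' _ _ h3]
        simp_rw [e2]
        rw [lintegral_const_mul' _ _ h4, lintegral_add_left ((meas_En hTm hVm).const_mul _), lintegral_const_mul' _ _ h3]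
    _ ≤ 2 ^ p * (ENNReal.ofReal H ^ p * (2 ^ p * (1 + CR d s p) * En p W w) + CZ d s p L * En p W w) :=
        mul_le_mul' le_rfl (add_le_add (mul_le_mul' le_rfl hvE) hZE)
    _ = _ := by unfold Cphi; ring

lemma phi_Lp (hd : 2 ≤ d) {s p e : ℝ} (hs : 0 < s) (hs1 : s < 1) (hp : 2 ≤ p) (he : 0 ≤ e) (he1 : e ≤ 1)
    (hep : e * (p - 1) ≤ s * p / 4) (N : ℕ) {w : Ed d → Ed d} (hw : Measurable w) (hwl : LocallyIntegrable w)
    {ζ : Ed d → ℝ} {H : ℝ} (hζH : ∀ x, |ζ x| ≤ H) :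
    ∫⁻ x, ‖ζ x • Tw (2 ^ e) N w x‖ₑ ^ p ≤
      ENNReal.ofReal H ^ p * CT d s p * En p (Wt d s p (2 ^ e) N) w := by
  have hp0 : 0 ≤ p := by linarith
  have h3 : ENNReal.ofReal H ^ p ≠ ∞ := ENNReal.rpow_ne_top_of_nonneg (by linarith) (by simp)
  calc _ ≤ ∫⁻ x, ENNReal.ofReal H ^ p * ‖Tw (2 ^ e) N w x‖ₑ ^ p := by
        refine lintegral_mono fun x => ?_
        rw [← ENNReal.mul_rpow_of_nonneg _ _ hp0, enorm_smul]
        refine ENNReal.rpow_le_rpow (mul_le_mul' ?_ le_rfl) hp0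
        rw [← ofReal_norm]
        exact ENNReal.ofReal_le_ofReal (hζH x)
    _ = ENNReal.ofReal H ^ p * ∫⁻ x, ‖Tw (2 ^ e) N w x‖ₑ ^ p := lintegral_const_mul' _ _ h3
    _ ≤ _ := by
        rw [mul_assoc]
        exact mul_le_mul' le_rfl (Tw_Lp1 hd hs hs1 hp he he1 hep N hw hwl)

end SectM5

noncomputable section SectM6
variable {d : ℕ}

lemma rk_lint (k : ℕ) : ∫⁻ t, ENNReal.ofReal (rk (d := d) k t) = 1 := by
  rw [← ofReal_integral_eq_lintegral_ofReal (rk_integrable k) (Eventually.of_forall (rk_nonneg k)), rk_int]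
  simp

lemma Pk_Lp {p : ℝ} (hp : 2 ≤ p) (k : ℕ) {w : Ed d → Ed d} (hw : Measurable w) :
    ∫⁻ x, ‖Pk k w x‖ₑ ^ p ≤ ∫⁻ x, ‖w x‖ₑ ^ p := by
  have hr := (rk_cont (d := d) k).measurable
  calc _ ≤ ∫⁻ x, ∫⁻ t, ENNReal.ofReal (rk k t) * ‖w (x - t)‖ₑ ^ p := by
        refine lintegral_mono fun x => ?_
        have h1 : ‖Pk k w x‖ₑ ≤ ∫⁻ t, ENNReal.ofReal (rk k t) * ‖w (x - t)‖ₑ := by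
          refine (enorm_integral_le_lintegral_enorm _).trans (lintegral_mono fun t => ?_)
          rw [enorm_ofReal_smul (rk_nonneg k t)]
        refine (ENNReal.rpow_le_rpow h1 (by linarith)).trans ?_
        refine (jensen_lint volume hp (by fun_prop) (by fun_prop)).trans ?_
        rw [rk_lint, ENNReal.one_rpow, one_mul]
    _ = ∫⁻ t, ∫⁻ x, ENNReal.ofReal (rk k t) * ‖w (x - t)‖ₑ ^ p := by
        rw [lintegral_lintegral_swap]
        have : Measurable fun q : Ed d × Ed d => ENNReal.ofReal (rk k q.2) * ‖w (q.1 - q.2)‖ₑ ^ p := by fun_prop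
        exact this.aemeasurable
    _ = ∫⁻ t, ENNReal.ofReal (rk k t) * ∫⁻ x, ‖w x‖ₑ ^ p := by
        refine lintegral_congr fun t => ?_
        rw [lintegral_const_mul _ (by fun_prop), lintegral_sub_right_eq_self (fun x => ‖w x‖ₑ ^ p) t]
    _ = _ := by rw [lintegral_mul_const _ (by fun_prop), rk_lint, one_mul]

lemma Pk_shift (k : ℕ) {w : Ed d → Ed d} (hw : LocallyIntegrable w) (x h : Ed d) :
    Pk k w (x + h) - Pk k w x = Pk k (fun y => w (y + h) - w y) x := by
  unfold Pk
  rw [← integral_sub (Pk_integrable k hw (x + h)) (Pk_integrable k hw x)]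
  congr 1; ext1 t
  rw [← smul_sub]
  congr 3; abel

lemma Pk_diff_Lp {p : ℝ} (hp : 2 ≤ p) (k : ℕ) {w : Ed d → Ed d} (hw : Measurable w) (hwl : LocallyIntegrable w) (h : Ed d) :
    ∫⁻ x, ‖Pk k w (x + h) - Pk k w x‖ₑ ^ p ≤ ∫⁻ x, ‖w (x + h) - w x‖ₑ ^ p := by
  simp_rw [Pk_shift k hwl]
  exact Pk_Lp hp k (by fun_prop)

lemma Pk_En {p : ℝ} (hp : 2 ≤ p) (k : ℕ) {w : Ed d → Ed d} (hw : Measurable w) (hwl : LocallyIntegrable w)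
    (W : Ed d → ℝ≥0∞) : En p W (Pk k w) ≤ En p W w := by
  have hPm := Pk_meas k hw
  unfold En
  refine lintegral_mono fun h => ?_
  rw [lintegral_mul_const _ (by fun_prop), lintegral_mul_const _ (by fun_prop)]
  exact mul_le_mul' (Pk_diff_Lp hp k hw hwl h) le_rfl

lemma Pk_Lp_diff {s p : ℝ} (hs : 0 < s) (hp : 2 ≤ p) (k : ℕ) {w : Ed d → Ed d} (hw : Measurable w) (hwl : LocallyIntegrable w) :
    ∫⁻ x, ‖Pk k w x - w x‖ₑ ^ p ≤ (ENNReal.ofReal (Lr d) ^ p * (cB d p * (ENNReal.ofReal (2 ^ ((d:ℝ) + s * p)) * En p (Kn d s p) w))) *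
      ENNReal.ofReal ((2:ℝ) ^ (-(s * p))) ^ k := by
  have hp0 : 0 ≤ p := by linarith
  have h3 : ENNReal.ofReal (Lr d) ^ p ≠ ∞ := ENNReal.rpow_ne_top_of_nonneg (by linarith) (by simp)
  set c : ℝ≥0∞ := ENNReal.ofReal (2 ^ ((d:ℝ) + s * p) * (2 ^ (-(s * p))) ^ k) with hc
  have h5 : ENNReal.ofReal (2 ^ (k * d)) * ∫⁻ t in Metric.closedBall (0 : Ed d) (2 * (2 ^ k)⁻¹), ∫⁻ x, ‖w (x + t) - w x‖ₑ ^ p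
      ≤ c * En p (Kn d s p) w := by
    rw [← lintegral_const_mul' _ _ (by simp)]
    unfold En
    rw [← lintegral_const_mul' _ _ (by simp [hc])]
    refine le_trans (setLIntegral_mono' Metric.isClosed_closedBall.measurableSet fun t ht => ?_) (setLIntegral_le_lintegral (Metric.closedBall (0 : Ed d) (2 * (2 ^ k)⁻¹)) _)
    by_cases h0 : t = 0
    · simp [h0, ENNReal.zero_rpow_of_pos (by linarith : 0 < p)]
    have hpos : 0 < ‖t‖ := by simpa using h0
    have ht : ‖t‖ ≤ 2 * (2 ^ k)⁻¹ := by simpa using ht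
    rw [lintegral_mul_const _ (by fun_prop), mul_comm (∫⁻ x, _), ← mul_assoc]
    refine mul_le_mul' ?_ le_rfl
    unfold Kn
    rw [hc, ← ENNReal.ofReal_mul (by positivity)]
    apply ENNReal.ofReal_le_ofReal
    unfold Ks
    have h6 : (2 * ((2:ℝ) ^ k)⁻¹) ^ (-((d:ℝ) + s * p)) ≤ ‖t‖ ^ (-((d:ℝ) + s * p)) := by
      apply Real.rpow_le_rpow_of_nonpos hpos ht
      have : (0:ℝ) ≤ d := by positivity
      have : 0 < s * p := by positivity
      linarith
    calc (2:ℝ) ^ (k * d) = 2 ^ ((d:ℝ) + s * p) * (2 ^ (-(s * p))) ^ k * (2 * ((2:ℝ) ^ k)⁻¹) ^ (-((d:ℝ) + s * p)) := by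
          have h7 : (2 * ((2:ℝ) ^ k)⁻¹) = (2:ℝ) ^ ((1:ℝ) + -(k:ℝ)) := by
            rw [Real.rpow_add (by norm_num), Real.rpow_one, Real.rpow_neg (by norm_num), Real.rpow_natCast]
          rw [h7, ← Real.rpow_natCast (2 ^ (-(s * p))) k, ← Real.rpow_mul (by norm_num),
            ← Real.rpow_natCast 2 (k * d),
            ← Real.rpow_mul (by norm_num), ← Real.rpow_add (by norm_num), ← Real.rpow_add (by norm_num)]
          congr 1; push_cast; ring
      _ ≤ _ := by gcongr
  calc _ ≤ ∫⁻ x, ENNReal.ofReal (Lr d) ^ p * osc k w x ^ p := by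
        refine lintegral_mono fun x => ?_
        rw [← ENNReal.mul_rpow_of_nonneg _ _ hp0, ← enorm_neg, neg_sub]
        exact ENNReal.rpow_le_rpow (Pk_diff1 k hwl x) hp0
    _ = ENNReal.ofReal (Lr d) ^ p * ∫⁻ x, osc k w x ^ p := lintegral_const_mul' _ _ h3
    _ ≤ ENNReal.ofReal (Lr d) ^ p * (cB d p * (c * En p (Kn d s p) w)) :=
        mul_le_mul' le_rfl ((osc_lint hp k hw).trans (mul_le_mul' le_rfl h5))
    _ = _ := by
        rw [hc, ENNReal.ofReal_mul (by positivity), ENNReal.ofReal_pow (by positivity)]; ring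

lemma Pk_Lp_tendsto {s p : ℝ} (hs : 0 < s) (hp : 2 ≤ p) {w : Ed d → Ed d} (hw : Measurable w) (hwl : LocallyIntegrable w)
    (hE : En p (Kn d s p) w ≠ ∞) :
    Tendsto (fun k => ∫⁻ x, ‖Pk k w x - w x‖ₑ ^ p) atTop (𝓝 0) := by
  set B := (ENNReal.ofReal (Lr d) ^ p * (cB d p * (ENNReal.ofReal (2 ^ ((d:ℝ) + s * p)) * En p (Kn d s p) w))) with hB
  have hBt : B ≠ ∞ := by
    have h3 : ENNReal.ofReal (Lr d) ^ p ≠ ∞ := ENNReal.rpow_ne_top_of_nonneg (by linarith) (by simp)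
    have := cB_ne_top (d := d) hp
    finiteness
  have h1 : Tendsto (fun k => B * ENNReal.ofReal ((2:ℝ) ^ (-(s * p))) ^ k) atTop (𝓝 (B * 0)) := by
    refine ENNReal.Tendsto.const_mul (ENNReal.tendsto_pow_atTop_nhds_zero_of_lt_one ?_) (Or.inr hBt)
    rw [← ENNReal.ofReal_one]
    apply (ENNReal.ofReal_lt_ofReal_iff one_pos).2
    apply Real.rpow_lt_one_of_one_lt_of_neg (by norm_num)
    have : 0 < s * p := by positivity
    linarith
  rw [mul_zero] at h1
  exact tendsto_of_tendsto_of_tendsto_of_le_of_le tendsto_const_nhds h1 (fun _ => zero_le) (fun k => Pk_Lp_diff hs hp k hw hwl)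

lemma Pk_En_tendsto {s p : ℝ} (hs : 0 < s) (hp : 2 ≤ p) {w : Ed d → Ed d} (hw : Measurable w) (hwl : LocallyIntegrable w)
    (hE : En p (Kn d s p) w ≠ ∞) :
    Tendsto (fun k => En p (Kn d s p) (fun x => Pk k w x - w x)) atTop (𝓝 0) := by
  have hKm := Kn_meas (d := d) s p
  have h4 : (2:ℝ≥0∞) ^ p ≠ ∞ := ENNReal.rpow_ne_top_of_nonneg (by linarith) (by simp)
  have key := tendsto_lintegral_of_dominated_convergence (μ := (volume : Measure (Ed d)))
    (F := fun k h => ∫⁻ x, ‖(Pk k w (x + h) - w (x + h)) - (Pk k w x - w x)‖ₑ ^ p * Kn d s p h)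
    (f := fun _ => 0)
    (fun h => 2 ^ p * (2 * ∫⁻ x, ‖w (x + h) - w x‖ₑ ^ p * Kn d s p h))
    ?_ ?_ ?_ ?_
  · simpa [En] using key
  · intro k
    have := Pk_meas k hw
    exact meas_En (v := fun x => Pk k w x - w x) (by fun_prop) hKm
  · intro k
    refine Eventually.of_forall fun h => ?_
    have hPm := Pk_meas k hw
    simp only
    rw [lintegral_mul_const _ (by fun_prop), lintegral_mul_const _ (by fun_prop)]
    rw [← mul_assoc, ← mul_assoc]
    refine mul_le_mul' ?_ le_rfl
    calc _ ≤ ∫⁻ x, 2 ^ p * (‖Pk k w (x + h) - Pk k w x‖ₑ ^ p + ‖w (x + h) - w x‖ₑ ^ p) := by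
          refine lintegral_mono fun x => ?_
          refine le_trans ?_ (add_rpow_le2 hp _ _)
          refine ENNReal.rpow_le_rpow ?_ (by linarith)
          have : (Pk k w (x + h) - w (x + h)) - (Pk k w x - w x) = (Pk k w (x + h) - Pk k w x) - (w (x + h) - w x) := by abel
          rw [this]
          exact enorm_sub_le
      _ = 2 ^ p * ((∫⁻ x, ‖Pk k w (x + h) - Pk k w x‖ₑ ^ p) + ∫⁻ x, ‖w (x + h) - w x‖ₑ ^ p) := by
          rw [lintegral_const_mul _ (by fun_prop), lintegral_add_left (by fun_prop)]
      _ ≤ 2 ^ p * ((∫⁻ x, ‖w (x + h) - w x‖ₑ ^ p) + ∫⁻ x, ‖w (x + h) - w x‖ₑ ^ p) :=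
          mul_le_mul' le_rfl (add_le_add (Pk_diff_Lp hp k hw hwl h) le_rfl)
      _ = _ := by ring
  · rw [lintegral_const_mul' _ _ h4, lintegral_const_mul' _ _ (by simp)]
    exact ENNReal.mul_ne_top h4 (ENNReal.mul_ne_top (by simp) hE)
  · refine Eventually.of_forall fun h => ?_
    have h1 : Tendsto (fun k => (2 ^ p * (2 * ∫⁻ x, ‖Pk k w x - w x‖ₑ ^ p)) * Kn d s p h) atTop (𝓝 ((2 ^ p * (2 * 0)) * Kn d s p h)) := by
      refine ENNReal.Tendsto.mul_const ?_ (Or.inr (by simp [Kn]))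
      refine ENNReal.Tendsto.const_mul ?_ (Or.inr h4)
      exact ENNReal.Tendsto.const_mul (Pk_Lp_tendsto hs hp hw hwl hE) (Or.inr (by simp))
    simp only [mul_zero, zero_mul] at h1
    refine tendsto_of_tendsto_of_tendsto_of_le_of_le tendsto_const_nhds h1 (fun _ => zero_le) (fun k => ?_)
    have hPm := Pk_meas k hw
    simp only
    rw [lintegral_mul_const _ (by fun_prop)]
    exact mul_le_mul' (lint_diff_le (v := fun x => Pk k w x - w x) hp (by fun_prop) h) le_rfl

end SectM6

noncomputable section SectM7
variable {d : ℕ}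

def dd (V h : Ed d) : ℝ := (inner ℝ V h : ℝ) / ‖h‖

lemma dd_add (V W h : Ed d) : dd (V + W) h = dd V h + dd W h := by
  unfold dd; rw [inner_add_left, add_div]

lemma dd_smul (c : ℝ) (V h : Ed d) : dd (c • V) h = c * dd V h := by
  unfold dd; rw [real_inner_smul_left, mul_div_assoc]

lemma abs_dd_le (V h : Ed d) : |dd V h| ≤ ‖V‖ := by
  unfold dd
  by_cases hh : h = 0
  · simp [hh]
  · have : 0 < ‖h‖ := by simpa using hh
    rw [abs_div, abs_norm, div_le_iff₀ this]
    exact abs_real_inner_le_norm _ _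

lemma DD_eq_dd (v : Ed d → Ed d) (x h : Ed d) : DD v x h = dd (v (x + h) - v x) h := rfl

lemma enorm_dd_le (V h : Ed d) : ‖dd V h‖ₑ ≤ ‖V‖ₑ := by
  rw [← ofReal_norm, ← ofReal_norm]
  exact ENNReal.ofReal_le_ofReal (abs_dd_le V h)

lemma meas_dd : Measurable fun q : Ed d × Ed d => dd q.1 q.2 := by
  unfold dd; fun_prop

/-- double integral over `Ω × Ω` -/
def JO (Ω : Set (Ed d)) (f : Ed d → Ed d → ℝ≥0∞) : ℝ≥0∞ := ∫⁻ x in Ω, ∫⁻ y in Ω, f x (y - x)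

lemma JO_mono {Ω : Set (Ed d)} {f g : Ed d → Ed d → ℝ≥0∞} (h : ∀ x h, f x h ≤ g x h) : JO Ω f ≤ JO Ω g :=
  lintegral_mono fun _ => lintegral_mono fun _ => h _ _

lemma JO_mono_on {Ω : Set (Ed d)} (hΩ : MeasurableSet Ω) {f g : Ed d → Ed d → ℝ≥0∞} (h : ∀ x h, x ∈ Ω → x + h ∈ Ω → f x h ≤ g x h) : JO Ω f ≤ JO Ω g :=
  setLIntegral_mono' hΩ fun x hx => setLIntegral_mono' hΩ fun y hy => h _ _ hx (by simpa using hy)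

lemma JO_const {Ω : Set (Ed d)} {f : Ed d → Ed d → ℝ≥0∞} {c : ℝ≥0∞} (hc : c ≠ ∞) :
    JO Ω (fun x h => c * f x h) = c * JO Ω f := by
  unfold JO
  rw [← lintegral_const_mul' _ _ hc]
  refine lintegral_congr fun x => ?_
  rw [← lintegral_const_mul' _ _ hc]

lemma full_eq {f : Ed d → Ed d → ℝ≥0∞} (hf : Measurable (Function.uncurry f)) :
    ∫⁻ h, ∫⁻ x, f x h = ∫⁻ x, ∫⁻ y, f x (y - x) := by
  rw [lintegral_lintegral_swap]
  · refine lintegral_congr fun x => ?_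
    rw [lintegral_sub_right_eq_self (fun h => f x h) x]
  · have : Measurable fun q : Ed d × Ed d => f q.2 q.1 := hf.comp measurable_swap
    exact this.aemeasurable

lemma JO_le {Ω : Set (Ed d)} {f : Ed d → Ed d → ℝ≥0∞} (hf : Measurable (Function.uncurry f)) :
    JO Ω f ≤ ∫⁻ h, ∫⁻ x, f x h := by
  rw [full_eq hf]
  unfold JO
  exact (setLIntegral_le_lintegral _ _).trans (lintegral_mono fun x => setLIntegral_le_lintegral _ _)

lemma JO_prod {Ω : Set (Ed d)} {f : Ed d → Ed d → ℝ≥0∞} (hf : Measurable (Function.uncurry f)) :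
    ∫⁻ q, f q.1 (q.2 - q.1) ∂((volume.restrict Ω).prod (volume.restrict Ω)) = JO Ω f := by
  unfold JO
  rw [lintegral_prod]
  have : Measurable fun q : Ed d × Ed d => f q.1 (q.2 - q.1) := by
    have h1 : Measurable fun q : Ed d × Ed d => (q.1, q.2 - q.1) := by fun_prop
    exact hf.comp h1
  exact this.aemeasurable

lemma JO_ind {Ω : Set (Ed d)} (hΩ : MeasurableSet Ω) {f : Ed d → Ed d → ℝ≥0∞} (hf : Measurable (Function.uncurry f)) :
    ∫⁻ h, ∫⁻ x, (Ω.indicator 1 x * Ω.indicator 1 (x + h)) * f x h = JO Ω f := by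
  rw [full_eq (f := fun x h => (Ω.indicator 1 x * Ω.indicator 1 (x + h)) * f x h)]
  · unfold JO
    rw [← lintegral_indicator hΩ]
    refine lintegral_congr fun x => ?_
    by_cases hx : x ∈ Ω
    · simp only [indicator_of_mem hx, Pi.one_apply, one_mul, add_sub_cancel]
      rw [← lintegral_indicator hΩ]
      refine lintegral_congr fun y => ?_
      by_cases hy : y ∈ Ω <;> simp [hy]
    · simp [hx]
  · have h1 : Measurable (Ω.indicator (1 : Ed d → ℝ≥0∞)) := measurable_one.indicator hΩ
    have h2 : Measurable fun q : Ed d × Ed d => f q.1 q.2 := hf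
    change Measurable fun q : Ed d × Ed d => (Ω.indicator 1 q.1 * Ω.indicator 1 (q.1 + q.2)) * f q.1 q.2
    fun_prop

lemma far_Wt {s p e : ℝ} (hp : 2 ≤ p) (he : 0 ≤ e) (hes : e ≤ (1 - s) / 2 * p) (N : ℕ) {r : ℝ} (hr : 0 < r) (hr1 : r ≤ 1) :
    ∫⁻ h in {h : Ed d | r < ‖h‖}, Wt d s p (2 ^ e) N h ≤ (ENNReal.ofReal r ^ p)⁻¹ * CM d s p := by
  have h0 : ENNReal.ofReal r ^ p ≠ 0 := by
    simp [ENNReal.rpow_eq_zero_iff, hr]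
  have h1 : ENNReal.ofReal r ^ p ≠ ∞ := ENNReal.rpow_ne_top_of_nonneg (by linarith) (by simp)
  calc _ ≤ ∫⁻ h in {h : Ed d | r < ‖h‖}, (ENNReal.ofReal r ^ p)⁻¹ * (ENNReal.ofReal (min 1 ‖h‖) ^ p * Wt d s p (2 ^ e) N h) := by
        refine setLIntegral_mono' (measurableSet_lt measurable_const measurable_norm) fun h hh => ?_
        have hh : r < ‖h‖ := hh
        calc _ = (ENNReal.ofReal r ^ p)⁻¹ * (ENNReal.ofReal r ^ p * Wt d s p (2 ^ e) N h) := by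
              rw [← mul_assoc, ENNReal.inv_mul_cancel h0 h1, one_mul]
          _ ≤ _ := by
              refine mul_le_mul' le_rfl (mul_le_mul' (ENNReal.rpow_le_rpow (ENNReal.ofReal_le_ofReal ?_) (by linarith)) le_rfl)
              exact le_min hr1 hh.le
    _ ≤ ∫⁻ h, (ENNReal.ofReal r ^ p)⁻¹ * (ENNReal.ofReal (min 1 ‖h‖) ^ p * Wt d s p (2 ^ e) N h) := setLIntegral_le_lintegral _ _
    _ = (ENNReal.ofReal r ^ p)⁻¹ * ∫⁻ h, (ENNReal.ofReal (min 1 ‖h‖) ^ p * Wt d s p (2 ^ e) N h) := by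
        rw [lintegral_const_mul' _ _ (by simp [h0])]
    _ ≤ _ := mul_le_mul' le_rfl (CM_est hp he hes N)

/-- local projected energy -/
def Gf (s p θ : ℝ) (N : ℕ) (Ω : Set (Ed d)) (η : Ed d → ℝ) (u : Ed d → Ed d) : ℝ≥0∞ :=
  JO Ω fun x h => ‖η x * DD u x h‖ₑ ^ p * Wt d s p θ N h

def CV (d : ℕ) (s p H L r : ℝ) : ℝ≥0∞ :=
  (ENNReal.ofReal H ^ p * (ENNReal.ofReal r ^ p)⁻¹ + ENNReal.ofReal L ^ p) * CM d s p

lemma CV_ne_top (hd : 2 ≤ d) {s p : ℝ} (hs : 0 < s) (hs1 : s < 1) (hp : 2 ≤ p) (H L : ℝ) {r : ℝ} (hr : 0 < r) : CV d s p H L r ≠ ∞ := by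
  unfold CV
  have h1 := CM_ne_top hd hs hs1 hp
  have h2 : ENNReal.ofReal H ^ p ≠ ∞ := ENNReal.rpow_ne_top_of_nonneg (by linarith) (by simp)
  have h3 : ENNReal.ofReal L ^ p ≠ ∞ := ENNReal.rpow_ne_top_of_nonneg (by linarith) (by simp)
  have h0 : ENNReal.ofReal r ^ p ≠ 0 := by
    simp [ENNReal.rpow_eq_zero_iff, hr]
  have h4 : (ENNReal.ofReal r ^ p)⁻¹ ≠ ∞ := by simp [h0]
  finiteness

lemma DD_split (η : Ed d → ℝ) (u : Ed d → Ed d) (x h : Ed d) :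
    DD (fun x => η x • u x) x h = η x * DD u x h + dd ((η (x + h) - η x) • u (x + h)) h := by
  have e : η (x + h) • u (x + h) - η x • u x = η x • (u (x + h) - u x) + (η (x + h) - η x) • u (x + h) := by module
  rw [DD_eq_dd, DD_eq_dd, e, dd_add, dd_smul]

lemma lint3 {c : ℝ≥0∞} (hc : c ≠ ∞) {f1 f2 f3 : Ed d → Ed d → ℝ≥0∞} (hf1m : Measurable fun q : Ed d × Ed d => f1 q.2 q.1)
    (hf2m : Measurable fun q : Ed d × Ed d => f2 q.2 q.1) :
    ∫⁻ h, ∫⁻ x, c * (f1 x h + f2 x h + f3 x h) = c * ((∫⁻ h, ∫⁻ x, f1 x h) + (∫⁻ h, ∫⁻ x, f2 x h) + ∫⁻ h, ∫⁻ x, f3 x h) := by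
  have e1 : ∀ h, ∫⁻ x, c * (f1 x h + f2 x h + f3 x h) = c * ((∫⁻ x, f1 x h) + (∫⁻ x, f2 x h) + ∫⁻ x, f3 x h) := by
    intro h
    have g1 : Measurable fun x => f1 x h := hf1m.comp (by fun_prop : Measurable fun x : Ed d => (h, x))
    have g2 : Measurable fun x => f2 x h := hf2m.comp (by fun_prop : Measurable fun x : Ed d => (h, x))
    rw [lintegral_const_mul' _ _ hc, lintegral_add_left (by fun_prop), lintegral_add_left g1]
  simp_rw [e1]
  have k1 : Measurable fun h => ∫⁻ x, f1 x h := hf1m.lintegral_prod_right'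
  have k2 : Measurable fun h => ∫⁻ x, f2 x h := hf2m.lintegral_prod_right'
  rw [lintegral_const_mul' _ _ hc, lintegral_add_left (by fun_prop), lintegral_add_left k1]

lemma meas_DD' {u : Ed d → Ed d} (hu : Measurable u) : Measurable fun q : Ed d × Ed d => DD u q.1 q.2 := by
  unfold DD
  fun_prop

lemma Dn_loc0 {p : ℝ} (hp : 2 ≤ p) {W : Ed d → ℝ≥0∞} (hWm : Measurable W) {Ω : Set (Ed d)} (hΩ : MeasurableSet Ω)
    {u : Ed d → Ed d} (hu : Measurable u) (hu0 : ∀ x, x ∉ Ω → u x = 0)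
    {η : Ed d → ℝ} {H r : ℝ} (hη : Measurable η) (hηH : ∀ x, |η x| ≤ H) (hr : 0 < r)
    (hηr : ∀ x h, η x ≠ 0 → ‖h‖ ≤ r → x + h ∈ Ω) :
    Dn p W (fun x => η x • u x) ≤
      2 ^ p * (JO Ω (fun x h => ‖η x * DD u x h‖ₑ ^ p * W h)
        + (∫⁻ h in {h : Ed d | r < ‖h‖}, W h) * (ENNReal.ofReal H ^ p * ∫⁻ x, ‖u x‖ₑ ^ p)
        + ∫⁻ h, ∫⁻ x, ‖(η (x + h) - η x) • u (x + h)‖ₑ ^ p * W h) := by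
  have hp0 : 0 ≤ p := by linarith
  have h4 : (2:ℝ≥0∞) ^ p ≠ ∞ := ENNReal.rpow_ne_top_of_nonneg (by linarith) (by simp)
  have h2 : ENNReal.ofReal H ^ p ≠ ∞ := ENNReal.rpow_ne_top_of_nonneg (by linarith) (by simp)
  have hDm : Measurable fun q : Ed d × Ed d => DD u q.1 q.2 := meas_DD' hu
  have hind : Measurable (Ω.indicator (1 : Ed d → ℝ≥0∞)) := measurable_one.indicator hΩ
  have hSm : MeasurableSet {h : Ed d | r < ‖h‖} := measurableSet_lt measurable_const measurable_norm
  have hfm : Measurable fun q : Ed d × Ed d => ‖η q.1 * DD u q.1 q.2‖ₑ ^ p * W q.2 := by fun_prop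
  obtain ⟨f1, hf1⟩ : ∃ f : Ed d → Ed d → ℝ≥0∞, f = fun x h => (Ω.indicator 1 x * Ω.indicator 1 (x + h)) * (‖η x * DD u x h‖ₑ ^ p * W h) := ⟨_, rfl⟩
  obtain ⟨f2, hf2⟩ : ∃ f : Ed d → Ed d → ℝ≥0∞, f = fun x h => {h : Ed d | r < ‖h‖}.indicator W h * (ENNReal.ofReal H ^ p * ‖u x‖ₑ ^ p) := ⟨_, rfl⟩
  obtain ⟨f3, hf3⟩ : ∃ f : Ed d → Ed d → ℝ≥0∞, f = fun x h => ‖(η (x + h) - η x) • u (x + h)‖ₑ ^ p * W h := ⟨_, rfl⟩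
  have hf1m : Measurable fun q : Ed d × Ed d => f1 q.2 q.1 := by
    have : Measurable fun q : Ed d × Ed d => DD u q.2 q.1 := meas_DD hu
    simp only [hf1]
    fun_prop
  have hf2m : Measurable fun q : Ed d × Ed d => f2 q.2 q.1 := by
    have : Measurable ({h : Ed d | r < ‖h‖}.indicator W) := hWm.indicator hSm
    simp only [hf2]
    fun_prop
  have pt : ∀ x h, ‖DD (fun x => η x • u x) x h‖ₑ ^ p * W h ≤ 2 ^ p * (f1 x h + f2 x h + f3 x h) := by
    intro x h
    rw [DD_split]
    have h5 : ‖η x * DD u x h‖ₑ ^ p * W h ≤ f1 x h + f2 x h := by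
      by_cases hx0 : η x = 0
      · simp [hx0, ENNReal.zero_rpow_of_pos (by linarith : 0 < p)]
      have hx : x ∈ Ω := by simpa using hηr x 0 hx0 (by simp [hr.le])
      by_cases hxh : x + h ∈ Ω
      · refine le_trans (le_of_eq ?_) le_self_add
        simp [hf1, hx, hxh]
      · have hrh : r < ‖h‖ := by
          by_contra hc
          exact hxh (hηr x h hx0 (not_lt.1 hc))
        refine le_trans ?_ le_add_self
        simp only [hf2]
        rw [indicator_of_mem (by exact hrh), mul_comm]
        refine mul_le_mul' le_rfl ?_
        rw [← ENNReal.mul_rpow_of_nonneg _ _ hp0, enorm_mul]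
        refine ENNReal.rpow_le_rpow (mul_le_mul' ?_ ?_) hp0
        · rw [← ofReal_norm]
          exact ENNReal.ofReal_le_ofReal (hηH x)
        · rw [DD_eq_dd, hu0 _ hxh]
          refine (enorm_dd_le _ _).trans ?_
          simp
    calc _ ≤ (2 ^ p * (‖η x * DD u x h‖ₑ ^ p + ‖(η (x + h) - η x) • u (x + h)‖ₑ ^ p)) * W h := by
          refine mul_le_mul' ?_ le_rfl
          refine (ENNReal.rpow_le_rpow (enorm_add_le _ _) hp0).trans ((add_rpow_le2 hp _ _).trans ?_)
          exact mul_le_mul' le_rfl (add_le_add le_rfl (ENNReal.rpow_le_rpow (enorm_dd_le _ _) hp0))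
      _ = 2 ^ p * (‖η x * DD u x h‖ₑ ^ p * W h + f3 x h) := by simp only [hf3]; ring
      _ ≤ _ := mul_le_mul' le_rfl (add_le_add h5 le_rfl)
  have i1 : ∫⁻ h, ∫⁻ x, f1 x h = JO Ω (fun x h => ‖η x * DD u x h‖ₑ ^ p * W h) := by
    simp only [hf1]
    exact JO_ind hΩ hfm
  have i2 : ∫⁻ h, ∫⁻ x, f2 x h = (∫⁻ h in {h : Ed d | r < ‖h‖}, W h) * (ENNReal.ofReal H ^ p * ∫⁻ x, ‖u x‖ₑ ^ p) := by
    simp only [hf2]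
    rw [← lintegral_indicator hSm, ← lintegral_mul_const _ (hWm.indicator hSm)]
    refine lintegral_congr fun h => ?_
    rw [lintegral_const_mul _ (by fun_prop), lintegral_const_mul _ (by fun_prop)]
  have i4 := lint3 (f3 := f3) h4 hf1m hf2m
  have i5 : Dn p W (fun x => η x • u x) ≤ ∫⁻ h, ∫⁻ x, 2 ^ p * (f1 x h + f2 x h + f3 x h) :=
    lintegral_mono fun h => lintegral_mono fun x => pt x h
  refine i5.trans ?_
  rw [i4, i1, i2, hf3]

lemma Dn_loc {s p e : ℝ} (hp : 2 ≤ p) (he : 0 ≤ e)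
    (hes : e ≤ (1 - s) / 2 * p) (N : ℕ) {Ω : Set (Ed d)} (hΩ : MeasurableSet Ω)
    {u : Ed d → Ed d} (hu : Measurable u) (hu0 : ∀ x, x ∉ Ω → u x = 0)
    {η : Ed d → ℝ} {H L r : ℝ} (hη : Measurable η) (hηH : ∀ x, |η x| ≤ H) (hL : 0 ≤ L)
    (hηL : ∀ x h, |η (x + h) - η x| ≤ L * min 1 ‖h‖) (hr : 0 < r) (hr1 : r ≤ 1)
    (hηr : ∀ x h, η x ≠ 0 → ‖h‖ ≤ r → x + h ∈ Ω) :
    Dn p (Wt d s p (2 ^ e) N) (fun x => η x • u x) ≤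
      2 ^ p * (Gf s p (2 ^ e) N Ω η u + CV d s p H L r * ∫⁻ x, ‖u x‖ₑ ^ p) := by
  refine (Dn_loc0 hp (Wt_meas (d := d) s p (2 ^ e) N) hΩ hu hu0 hη hηH hr hηr).trans ?_
  refine mul_le_mul' le_rfl ?_
  have i2 := far_Wt (d := d) hp he hes N hr hr1
  have i3 := (cut_est hp hL hηL hu (Wt_meas (d := d) s p (2 ^ e) N)).trans (mul_le_mul' (mul_le_mul' le_rfl (CM_est hp he hes N)) le_rfl)
  refine (add_le_add (add_le_add le_rfl (mul_le_mul' i2 le_rfl)) i3).trans (le_of_eq ?_)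
  unfold CV Gf; ring

end SectM7

noncomputable section SectM8
variable {d : ℕ}

/-- the odd power -/
def zt (p y : ℝ) : ℝ := |y| ^ (p - 2) * y

lemma abs_zt {p : ℝ} (hp : 2 ≤ p) (y : ℝ) : |zt p y| = |y| ^ (p - 1) := by
  unfold zt
  rw [abs_mul, abs_of_nonneg (by positivity : 0 ≤ |y| ^ (p - 2))]
  by_cases hy : y = 0
  · simp [hy, Real.zero_rpow (by linarith : p - 1 ≠ 0)]
  · have : 0 < |y| := abs_pos.2 hy
    nth_rewrite 2 [← Real.rpow_one |y|]
    rw [← Real.rpow_add this]; ring_nf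

lemma zt_mul_self {p : ℝ} (hp : 2 ≤ p) (y : ℝ) : zt p y * y = |y| ^ p := by
  unfold zt
  rw [mul_assoc, ← abs_mul_abs_self y]
  by_cases hy : y = 0
  · simp [hy, Real.zero_rpow (by linarith : p ≠ 0)]
  · have : 0 < |y| := abs_pos.2 hy
    have e : |y| * |y| = |y| ^ (2:ℝ) := by rw [Real.rpow_two]; ring
    rw [e, ← Real.rpow_add this]; ring_nf

lemma zt_mul {p : ℝ} (x y : ℝ) : zt p (x * y) = zt p x * zt p y := by
  unfold zt
  rw [abs_mul, Real.mul_rpow (abs_nonneg _) (abs_nonneg _)]; ring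

lemma zt_young {p : ℝ} (hp : 2 ≤ p) {κ : ℝ} (hκ : 0 < κ) (a y : ℝ) :
    -(zt p a * y) ≤ κ * |a| ^ p + κ ^ (1 - p) * |y| ^ p := by
  have := young_pow hp hκ (abs_nonneg a) (abs_nonneg y)
  rw [← abs_zt hp, ← abs_mul] at this
  exact (neg_le_abs _).trans this

lemma pt_real {p : ℝ} (hp : 2 ≤ p) {α₁ α₂ A η t b R Z Y m κ₁ κ₂ τ : ℝ} (h1 : 0 < α₁) (hA1 : α₁ ≤ A) (hA2 : A ≤ α₂)
    (hm : 1 ≤ m) (hκ₁ : 0 < κ₁) (hκ₂ : 0 < κ₂) (hτ : 0 < τ) :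
    α₁ * (m * |η * t| ^ p) ≤ zt p t * (zt p η * ((m - 1) * (η * t + b) + R) + Z + Y) * A +
      (α₂ * (κ₁ + τ) * (m * |η * t| ^ p) + α₂ * κ₁ ^ (1 - p) * (m * |b| ^ p) + α₂ * τ ^ (1 - p) * (m ^ (1 - p) * |R| ^ p)
       + (α₁ * |η| ^ p + α₂ * (κ₂ + 1)) * |t| ^ p + α₂ * κ₂ ^ (1 - p) * |Z| ^ p + α₂ * |Y| ^ p) := by
  have hm0 : 0 < m := by linarith
  set a := η * t with ha
  have e1 : zt p t * (zt p η * ((m - 1) * (a + b) + R) + Z + Y) =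
      (m - 1) * |a| ^ p + (m - 1) * (zt p a * b) + m * (zt p a * (R / m)) + zt p t * Z + zt p t * Y := by
    rw [← zt_mul_self hp a, ha, zt_mul]
    field_simp
  have y1 := zt_young hp hκ₁ a b
  have y2 := zt_young hp hτ a (R / m)
  have y3 := zt_young hp hκ₂ t Z
  have y4 := zt_young hp one_pos t Y
  rw [Real.one_rpow] at y4
  have e2 : m * |R / m| ^ p = m ^ (1 - p) * |R| ^ p := by
    rw [abs_div, abs_of_pos hm0, Real.div_rpow (abs_nonneg _) hm0.le, Real.rpow_sub hm0, Real.rpow_one]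
    ring
  have b1 : 0 ≤ κ₁ * |a| ^ p + κ₁ ^ (1 - p) * |b| ^ p := by positivity
  have y1' : -((m - 1) * (zt p a * b)) ≤ m * (κ₁ * |a| ^ p + κ₁ ^ (1 - p) * |b| ^ p) := by
    nlinarith
  have y2' : -(m * (zt p a * (R / m))) ≤ m * τ * |a| ^ p + τ ^ (1 - p) * (m ^ (1 - p) * |R| ^ p) := by
    rw [← e2]; nlinarith
  set S := m * (κ₁ * |a| ^ p + κ₁ ^ (1 - p) * |b| ^ p) + (m * τ * |a| ^ p + τ ^ (1 - p) * (m ^ (1 - p) * |R| ^ p))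
    + (κ₂ * |t| ^ p + κ₂ ^ (1 - p) * |Z| ^ p) + (1 * |t| ^ p + 1 * |Y| ^ p) with hS
  have hS0 : 0 ≤ S := by positivity
  rw [e1]
  set X := (m - 1) * |a| ^ p + (m - 1) * (zt p a * b) + m * (zt p a * (R / m)) + zt p t * Z + zt p t * Y with hX
  have hX1 : (m - 1) * |a| ^ p ≤ X + S := by rw [hX, hS]; linarith
  have hP : 0 ≤ (m - 1) * |a| ^ p := mul_nonneg (by linarith) (by positivity)
  have hfin : α₁ * ((m - 1) * |a| ^ p) ≤ X * A + α₂ * S := by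
    have : α₁ * ((m - 1) * |a| ^ p) ≤ A * ((m - 1) * |a| ^ p) := mul_le_mul_of_nonneg_right hA1 hP
    have h3 : A * ((m - 1) * |a| ^ p) ≤ A * (X + S) := mul_le_mul_of_nonneg_left hX1 (by linarith)
    have h4 : A * S ≤ α₂ * S := mul_le_mul_of_nonneg_right hA2 hS0
    linarith
  have e3 : |a| ^ p = |η| ^ p * |t| ^ p := by
    rw [ha, abs_mul, Real.mul_rpow (abs_nonneg _) (abs_nonneg _)]
  have e4 : α₁ * (m * |a| ^ p) = α₁ * ((m - 1) * |a| ^ p) + α₁ * (|η| ^ p * |t| ^ p) := by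
    rw [← e3]; ring
  rw [e4]
  calc _ ≤ X * A + α₂ * S + α₁ * (|η| ^ p * |t| ^ p) := by linarith
    _ = _ := by rw [hS]; ring

lemma enn_split {P g E : ℝ} (hP : 0 ≤ P) (h : P ≤ g + E) (hE : 0 ≤ E) :
    ENNReal.ofReal P + ENNReal.ofReal (-g) ≤ ENNReal.ofReal g + ENNReal.ofReal E := by
  rcases le_total 0 g with hg | hg
  · rw [ENNReal.ofReal_of_nonpos (by linarith : -g ≤ 0), add_zero, ← ENNReal.ofReal_add hg hE]
    exact ENNReal.ofReal_le_ofReal h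
  · rw [ENNReal.ofReal_of_nonpos hg, zero_add, ← ENNReal.ofReal_add hP (by linarith)]
    exact ENNReal.ofReal_le_ofReal (by linarith)

lemma conv1 {p : ℝ} (hp : 2 ≤ p) {c x K : ℝ} (hc : 0 ≤ c) :
    ENNReal.ofReal c * (‖x‖ₑ ^ p * ENNReal.ofReal K) = ENNReal.ofReal (c * (|x| ^ p * K)) := by
  rw [enorm_rpow _ (by linarith : 0 ≤ p), ← ENNReal.ofReal_mul (by positivity), ← ENNReal.ofReal_mul hc]
  rfl

lemma add6 {a b c e f g : ℝ} (ha : 0 ≤ a) (hb : 0 ≤ b) (hc : 0 ≤ c) (he : 0 ≤ e) (hf : 0 ≤ f) (hg : 0 ≤ g) :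
    ENNReal.ofReal a + ENNReal.ofReal b + ENNReal.ofReal c + ENNReal.ofReal e + ENNReal.ofReal f + ENNReal.ofReal g =
      ENNReal.ofReal (a + b + c + e + f + g) := by
  rw [ENNReal.ofReal_add (by positivity) hg, ENNReal.ofReal_add (by positivity) hf, ENNReal.ofReal_add (by positivity) he,
    ENNReal.ofReal_add (by positivity) hc, ENNReal.ofReal_add ha hb]

lemma pt_enn {p : ℝ} (hp : 2 ≤ p) {α₁ α₂ A η t b R Z Y m κ₁ κ₂ τ K H : ℝ} (h1 : 0 < α₁) (hA1 : α₁ ≤ A) (hA2 : A ≤ α₂)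
    (hm : 1 ≤ m) (hκ₁ : 0 < κ₁) (hκ₂ : 0 < κ₂) (hτ : 0 < τ) (hK : 0 ≤ K) (hH : |η| ≤ H) :
    ENNReal.ofReal α₁ * (‖η * t‖ₑ ^ p * ENNReal.ofReal (K * m)) +
        ENNReal.ofReal (-(zt p t * (zt p η * ((m - 1) * (η * t + b) + R) + Z + Y) * A * K)) ≤
      ENNReal.ofReal (zt p t * (zt p η * ((m - 1) * (η * t + b) + R) + Z + Y) * A * K) +
      (ENNReal.ofReal (α₂ * (κ₁ + τ)) * (‖η * t‖ₑ ^ p * ENNReal.ofReal (K * m))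
      + ENNReal.ofReal (α₂ * κ₁ ^ (1 - p)) * (‖b‖ₑ ^ p * ENNReal.ofReal (K * m))
      + ENNReal.ofReal (α₂ * τ ^ (1 - p)) * (‖R‖ₑ ^ p * ENNReal.ofReal (K * m ^ (1 - p)))
      + ENNReal.ofReal (α₁ * H ^ p + α₂ * (κ₂ + 1)) * (‖t‖ₑ ^ p * ENNReal.ofReal K)
      + ENNReal.ofReal (α₂ * κ₂ ^ (1 - p)) * (‖Z‖ₑ ^ p * ENNReal.ofReal K)
      + ENNReal.ofReal α₂ * (‖Y‖ₑ ^ p * ENNReal.ofReal K)) := by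
  have hm0 : 0 < m := by linarith
  have h2 : 0 < α₂ := by linarith
  have hH0 : 0 ≤ H := (abs_nonneg _).trans hH
  rw [conv1 hp h1.le, conv1 hp (by positivity), conv1 hp (by positivity), conv1 hp (by positivity), conv1 hp (by positivity),
    conv1 hp (by positivity), conv1 hp h2.le]
  rw [add6 (by positivity) (by positivity) (by positivity) (by positivity) (by positivity) (by positivity)]
  refine enn_split (by positivity) ?_ (by positivity)
  have key := mul_le_mul_of_nonneg_right (pt_real hp (η := η) (t := t) (b := b) (R := R) (Z := Z) (Y := Y) h1 hA1 hA2 hm hκ₁ hκ₂ hτ) hK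
  have hH' : |η| ^ p ≤ H ^ p := Real.rpow_le_rpow (abs_nonneg _) hH (by linarith)
  have h3 : α₁ * |η| ^ p * (|t| ^ p * K) ≤ α₁ * H ^ p * (|t| ^ p * K) := by
    have : 0 ≤ |t| ^ p * K := by positivity
    exact mul_le_mul_of_nonneg_right (mul_le_mul_of_nonneg_left hH' h1.le) this
  linarith

/-- integrating the pointwise inequality -/
lemma int_split {α : Type*} [MeasurableSpace α] {μ : Measure α} {P Er : α → ℝ≥0∞} {g : α → ℝ}
    (hg : Integrable g μ) (hP : AEMeasurable P μ) (h : ∀ᵐ x ∂μ, P x + ENNReal.ofReal (-g x) ≤ ENNReal.ofReal (g x) + Er x) :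
    ∫⁻ x, P x ∂μ ≤ ENNReal.ofReal (∫ x, g x ∂μ) + ∫⁻ x, Er x ∂μ := by
  have h1 : ∫⁻ x, ENNReal.ofReal (g x) ∂μ ≠ ∞ := by
    have := hg.lintegral_lt_top
    exact this.ne
  have h2 : ∫⁻ x, ENNReal.ofReal (-g x) ∂μ ≠ ∞ := hg.neg.lintegral_lt_top.ne
  have h3 := lintegral_mono_ae h
  rw [lintegral_add_left' hP, lintegral_add_left' hg.aemeasurable.ennreal_ofReal] at h3
  have e := integral_eq_lintegral_pos_part_sub_lintegral_neg_part hg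
  set a := ∫⁻ x, ENNReal.ofReal (g x) ∂μ
  set b := ∫⁻ x, ENNReal.ofReal (-g x) ∂μ
  have h4 : a ≤ ENNReal.ofReal (∫ x, g x ∂μ) + b := by
    rw [e]
    calc a = ENNReal.ofReal a.toReal := (ENNReal.ofReal_toReal h1).symm
      _ ≤ ENNReal.ofReal ((a.toReal - b.toReal) + b.toReal) := by simp
      _ ≤ ENNReal.ofReal (a.toReal - b.toReal) + ENNReal.ofReal b.toReal := ENNReal.ofReal_add_le
      _ = _ := by rw [ENNReal.ofReal_toReal h2]
  have h5 : (∫⁻ x, P x ∂μ) + b ≤ (ENNReal.ofReal (∫ x, g x ∂μ) + ∫⁻ x, Er x ∂μ) + b := by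
    refine h3.trans ((add_le_add h4 le_rfl).trans (le_of_eq ?_))
    ring
  exact (ENNReal.add_le_add_iff_right h2).1 h5

end SectM8

noncomputable section SectM9
variable {d : ℕ}

def PI (s p : ℝ) (Ω : Set (Ed d)) (u : Ed d → Ed d) : ℝ≥0∞ := JO Ω fun x h => ‖DD u x h‖ₑ ^ p * Kn d s p h

lemma projGagP_eq {s p : ℝ} (hp : 2 ≤ p) (Ω : Set (Ed d)) (u : Ed d → Ed d) : projGagP d s p Ω u = PI s p Ω u := by
  unfold projGagP PI JO
  refine lintegral_congr fun x => lintegral_congr fun y => ?_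
  unfold DD Kn Ks
  dsimp only
  rw [add_sub_cancel, enorm_rpow _ (by linarith : 0 ≤ p), ← ENNReal.ofReal_mul (by positivity), Real.norm_eq_abs, abs_div,
    abs_norm, Real.rpow_neg (norm_nonneg _), div_eq_mul_inv _ (‖y - x‖ ^ _)]

/-- the integrand of the pairing -/
def gI (s p : ℝ) (A : Ed d → Ed d → ℝ) (u φ : Ed d → Ed d) (x h : Ed d) : ℝ :=
  zt p (DD u x h) * DD φ x h * A x (x + h) * Ks d s p h

lemma Dquot_eq (v : Ed d → Ed d) (x y : Ed d) : Dquot d v x y = DD v x (y - x) := by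
  unfold Dquot DD
  rw [add_sub_cancel, norm_sub_rev x y, ← neg_sub (v y), ← neg_sub y x, inner_neg_neg]

lemma zt_meas (p : ℝ) : Measurable (zt p) := by
  unfold zt; fun_prop

lemma gI_meas (s p : ℝ) {A : Ed d → Ed d → ℝ} (hA : Measurable (Function.uncurry A)) {u φ : Ed d → Ed d} (hu : Measurable u)
    (hφ : Measurable φ) : Measurable fun q : Ed d × Ed d => gI s p A u φ q.1 q.2 := by
  have h1 := meas_DD' hu
  have h2 := meas_DD' hφ
  have h3 := Ks_meas (d := d) s p
  have h4 := zt_meas p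
  have h5 : Measurable fun q : Ed d × Ed d => A q.1 (q.1 + q.2) :=
    hA.comp (by fun_prop : Measurable fun q : Ed d × Ed d => (q.1, q.1 + q.2))
  unfold gI
  fun_prop

lemma sub_meas {β : Type*} [MeasurableSpace β] {f : Ed d → Ed d → β} (hf : Measurable fun q : Ed d × Ed d => f q.1 q.2) :
    Measurable fun q : Ed d × Ed d => f q.1 (q.2 - q.1) :=
  hf.comp (by fun_prop : Measurable fun q : Ed d × Ed d => (q.1, q.2 - q.1))

lemma gI_bound {s p : ℝ} (hp : 2 ≤ p) {α₂ : ℝ} {A : Ed d → Ed d → ℝ} (hA0 : ∀ x y, 0 ≤ A x y) (hA2 : ∀ x y, A x y ≤ α₂)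
    (u φ : Ed d → Ed d) (x h : Ed d) :
    ‖gI s p A u φ x h‖ₑ ≤ ENNReal.ofReal α₂ * (‖DD u x h‖ₑ ^ p * Kn d s p h + ‖DD φ x h‖ₑ ^ p * Kn d s p h) := by
  have hα : 0 ≤ α₂ := (hA0 x x).trans (hA2 x x)
  have hK := Ks_nonneg s p h
  unfold Kn
  rw [mul_add, conv1 hp hα, conv1 hp hα, ← ENNReal.ofReal_add (by positivity) (by positivity), ← ofReal_norm]
  apply ENNReal.ofReal_le_ofReal
  unfold gI
  rw [Real.norm_eq_abs, abs_mul, abs_mul, abs_of_nonneg hK, abs_mul, abs_of_nonneg (hA0 _ _), abs_zt hp]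
  have y := young_pow hp one_pos (abs_nonneg (DD u x h)) (abs_nonneg (DD φ x h))
  rw [Real.one_rpow, one_mul, one_mul] at y
  have y0 : 0 ≤ |DD u x h| ^ (p - 1) * |DD φ x h| := by positivity
  calc _ ≤ (|DD u x h| ^ p + |DD φ x h| ^ p) * α₂ * Ks d s p h :=
        mul_le_mul_of_nonneg_right (mul_le_mul y (hA2 _ _) (hA0 _ _) (by positivity)) hK
    _ = _ := by ring

lemma PI_meas {s p : ℝ} {u : Ed d → Ed d} (hu : Measurable u) :
    Measurable fun q : Ed d × Ed d => ‖DD u q.1 q.2‖ₑ ^ p * Kn d s p q.2 := by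
  have h1 := meas_DD' hu
  have h3 := Kn_meas (d := d) s p
  fun_prop

lemma gI_int {s p : ℝ} (hp : 2 ≤ p) {α₂ : ℝ} {A : Ed d → Ed d → ℝ} (hA : Measurable (Function.uncurry A))
    (hA0 : ∀ x y, 0 ≤ A x y) (hA2 : ∀ x y, A x y ≤ α₂) {Ω : Set (Ed d)}
    {u φ : Ed d → Ed d} (hu : Measurable u) (hφ : Measurable φ) (h1 : PI s p Ω u ≠ ∞) (h2 : PI s p Ω φ ≠ ∞) :
    Integrable (fun q : Ed d × Ed d => gI s p A u φ q.1 (q.2 - q.1)) ((volume.restrict Ω).prod (volume.restrict Ω)) := by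
  refine ⟨(sub_meas (gI_meas s p hA hu hφ)).aestronglyMeasurable, ?_⟩
  rw [hasFiniteIntegral_iff_enorm]
  refine lt_of_le_of_lt (lintegral_mono fun q => gI_bound hp hA0 hA2 u φ q.1 (q.2 - q.1)) ?_
  rw [lintegral_const_mul' _ _ (by simp), lintegral_add_left (sub_meas (f := fun x h => ‖DD u x h‖ₑ ^ p * Kn d s p h) (PI_meas hu)),
    JO_prod (f := fun x h => ‖DD u x h‖ₑ ^ p * Kn d s p h) (PI_meas hu),
    JO_prod (f := fun x h => ‖DD φ x h‖ₑ ^ p * Kn d s p h) (PI_meas hφ)]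
  change ENNReal.ofReal α₂ * (PI s p Ω u + PI s p Ω φ) < ∞
  finiteness

lemma nlPairing_eq {s p : ℝ} (hp : 2 ≤ p) {α₂ : ℝ} {A : Ed d → Ed d → ℝ} (hA : Measurable (Function.uncurry A))
    (hA0 : ∀ x y, 0 ≤ A x y) (hA2 : ∀ x y, A x y ≤ α₂) {Ω : Set (Ed d)}
    {u φ : Ed d → Ed d} (hu : Measurable u) (hφ : Measurable φ) (h1 : PI s p Ω u ≠ ∞) (h2 : PI s p Ω φ ≠ ∞) :
    nlPairing d s p A Ω u φ = ∫ q, gI s p A u φ q.1 (q.2 - q.1) ∂((volume.restrict Ω).prod (volume.restrict Ω)) := by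
  rw [integral_prod _ (gI_int hp hA hA0 hA2 hu hφ h1 h2)]
  unfold nlPairing
  congr 1; ext1 x
  congr 1; ext1 y
  unfold gI zt Ks
  rw [Dquot_eq, Dquot_eq, add_sub_cancel, norm_sub_rev x y, Real.rpow_neg (norm_nonneg _), div_eq_mul_inv]

lemma PI_le {s p : ℝ} (hp : 2 ≤ p) {Ω : Set (Ed d)} {φ : Ed d → Ed d} (hφ : Measurable φ) : PI s p Ω φ ≤ En p (Kn d s p) φ := by
  refine (JO_le (PI_meas hφ)).trans ?_
  refine lintegral_mono fun h => lintegral_mono fun x => mul_le_mul' (ENNReal.rpow_le_rpow ?_ (by linarith)) le_rfl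
  rw [DD_eq_dd]
  exact enorm_dd_le _ _

lemma JO_add {Ω : Set (Ed d)} {f g : Ed d → Ed d → ℝ≥0∞} (hf : Measurable (Function.uncurry f)) :
    JO Ω (fun x h => f x h + g x h) = JO Ω f + JO Ω g := by
  have h1 : Measurable fun q : Ed d × Ed d => f q.1 (q.2 - q.1) := sub_meas hf
  unfold JO
  rw [← lintegral_add_left h1.lintegral_prod_right']
  refine lintegral_congr fun x => ?_
  rw [lintegral_add_left]
  exact h1.comp (by fun_prop : Measurable fun y : Ed d => (x, y))

lemma DD_phi {p θ : ℝ} (N : ℕ) (η : Ed d → ℝ) (u w φ φn : Ed d → Ed d) (hw : w = fun x => η x • u x)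
    (hφ : φ = fun x => zt p (η x) • Tw θ N w x) (x h : Ed d) :
    DD φn x h = zt p (η x) * ((om θ N h - 1) * (η x * DD u x h + dd ((η (x + h) - η x) • u (x + h)) h)
        + dd ((Tw θ N w (x + h) - Tw θ N w x) - (om θ N h - 1) • (w (x + h) - w x)) h)
      + dd ((zt p (η (x + h)) - zt p (η x)) • Tw θ N w (x + h)) h
      + dd ((φn (x + h) - φ (x + h)) - (φn x - φ x)) h := by
  rw [← DD_split η u, ← hw, DD_eq_dd w, DD_eq_dd, ← dd_smul, ← dd_add, ← dd_smul, ← dd_add, ← dd_add]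
  congr 1
  rw [hφ]
  module

lemma pair_ineq {s p : ℝ} (hp : 2 ≤ p) {α₁ α₂ : ℝ} (h1 : 0 < α₁) {A : Ed d → Ed d → ℝ} (hA : Measurable (Function.uncurry A))
    (hA1 : ∀ x y, α₁ ≤ A x y) (hA2 : ∀ x y, A x y ≤ α₂) {Ω : Set (Ed d)} {θ : ℝ} (hθ : 1 ≤ θ) (N : ℕ)
    {η : Ed d → ℝ} (hη : Measurable η) {H : ℝ} (hηH : ∀ x, |η x| ≤ H)
    {u w φ φn : Ed d → Ed d} (hu : Measurable u) (hw : w = fun x => η x • u x)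
    (hφ : φ = fun x => zt p (η x) • Tw θ N w x) (hφn : Measurable φn)
    (hPu : PI s p Ω u ≠ ∞) (hPφ : PI s p Ω φn ≠ ∞) {κ₁ κ₂ τ : ℝ} (hκ₁ : 0 < κ₁) (hκ₂ : 0 < κ₂) (hτ : 0 < τ) :
    ENNReal.ofReal α₁ * Gf s p θ N Ω η u ≤ ENNReal.ofReal (nlPairing d s p A Ω u φn) +
     (ENNReal.ofReal (α₂ * (κ₁ + τ)) * Gf s p θ N Ω η u
      + ENNReal.ofReal (α₂ * κ₁ ^ (1 - p)) * (∫⁻ h, ∫⁻ x, ‖(η (x + h) - η x) • u (x + h)‖ₑ ^ p * Wt d s p θ N h)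
      + ENNReal.ofReal (α₂ * τ ^ (1 - p)) * (∫⁻ h, ∫⁻ x, ‖(Tw θ N w (x + h) - Tw θ N w x) - (om θ N h - 1) • (w (x + h) - w x)‖ₑ ^ p
          * Vt d s p θ N h)
      + ENNReal.ofReal (α₁ * H ^ p + α₂ * (κ₂ + 1)) * PI s p Ω u
      + ENNReal.ofReal (α₂ * κ₂ ^ (1 - p)) * (∫⁻ h, ∫⁻ x, ‖(zt p (η (x + h)) - zt p (η x)) • Tw θ N w (x + h)‖ₑ ^ p * Kn d s p h)
      + ENNReal.ofReal α₂ * En p (Kn d s p) (fun x => φn x - φ x)) := by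
  have hp0 : 0 ≤ p := by linarith
  have hA0 : ∀ x y, 0 ≤ A x y := fun x y => h1.le.trans (hA1 x y)
  have hwm : Measurable w := by rw [hw]; fun_prop
  have hTm := Tw_meas θ N hwm
  have hzt := zt_meas p
  have hφm : Measurable φ := by rw [hφ]; fun_prop
  have hDu := meas_DD' hu
  have hom := om_meas (d := d) θ N
  have hWm := Wt_meas (d := d) s p θ N
  have hVm := Vt_meas (d := d) s p θ N
  have hKm := Kn_meas (d := d) s p
  have hdd := meas_dd (d := d)
  -- pieces
  have m1 : Measurable fun q : Ed d × Ed d => ‖η q.1 * DD u q.1 q.2‖ₑ ^ p * Wt d s p θ N q.2 := by fun_prop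
  have n2 : Measurable fun q : Ed d × Ed d => ‖(η (q.1 + q.2) - η q.1) • u (q.1 + q.2)‖ₑ ^ p * Wt d s p θ N q.2 := by fun_prop
  have n3 : Measurable fun q : Ed d × Ed d => ‖(Tw θ N w (q.1 + q.2) - Tw θ N w q.1) - (om θ N q.2 - 1) • (w (q.1 + q.2) - w q.1)‖ₑ ^ p
          * Vt d s p θ N q.2 := by fun_prop
  have n4 : Measurable fun q : Ed d × Ed d => ‖DD u q.1 q.2‖ₑ ^ p * Kn d s p q.2 := by fun_prop
  have n5 : Measurable fun q : Ed d × Ed d => ‖(zt p (η (q.1 + q.2)) - zt p (η q.1)) • Tw θ N w (q.1 + q.2)‖ₑ ^ p * Kn d s p q.2 := by fun_prop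
  have n6 : Measurable fun q : Ed d × Ed d => ‖(φn (q.1 + q.2) - φ (q.1 + q.2)) - (φn q.1 - φ q.1)‖ₑ ^ p * Kn d s p q.2 := by fun_prop
  let f1 : Ed d → Ed d → ℝ≥0∞ := fun x h => ‖η x * DD u x h‖ₑ ^ p * Wt d s p θ N h
  let f2 : Ed d → Ed d → ℝ≥0∞ := fun x h => ‖(η (x + h) - η x) • u (x + h)‖ₑ ^ p * Wt d s p θ N h
  let f3 : Ed d → Ed d → ℝ≥0∞ := fun x h => ‖(Tw θ N w (x + h) - Tw θ N w x) - (om θ N h - 1) • (w (x + h) - w x)‖ₑ ^ p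
          * Vt d s p θ N h
  let f4 : Ed d → Ed d → ℝ≥0∞ := fun x h => ‖DD u x h‖ₑ ^ p * Kn d s p h
  let f5 : Ed d → Ed d → ℝ≥0∞ := fun x h => ‖(zt p (η (x + h)) - zt p (η x)) • Tw θ N w (x + h)‖ₑ ^ p * Kn d s p h
  let f6 : Ed d → Ed d → ℝ≥0∞ := fun x h => ‖(φn (x + h) - φ (x + h)) - (φn x - φ x)‖ₑ ^ p * Kn d s p h
  have pt : ∀ x h, ENNReal.ofReal α₁ * f1 x h + ENNReal.ofReal (-gI s p A u φn x h) ≤ ENNReal.ofReal (gI s p A u φn x h) +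
      (ENNReal.ofReal (α₂ * (κ₁ + τ)) * f1 x h + ENNReal.ofReal (α₂ * κ₁ ^ (1 - p)) * f2 x h
      + ENNReal.ofReal (α₂ * τ ^ (1 - p)) * f3 x h + ENNReal.ofReal (α₁ * H ^ p + α₂ * (κ₂ + 1)) * f4 x h
      + ENNReal.ofReal (α₂ * κ₂ ^ (1 - p)) * f5 x h + ENNReal.ofReal α₂ * f6 x h) := by
    intro x h
    have key := pt_enn hp (A := A x (x + h)) (η := η x) (t := DD u x h) (b := dd ((η (x + h) - η x) • u (x + h)) h)
      (R := dd ((Tw θ N w (x + h) - Tw θ N w x) - (om θ N h - 1) • (w (x + h) - w x)) h)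
      (Z := dd ((zt p (η (x + h)) - zt p (η x)) • Tw θ N w (x + h)) h)
      (Y := dd ((φn (x + h) - φ (x + h)) - (φn x - φ x)) h) (m := om θ N h) (K := Ks d s p h) h1 (hA1 _ _) (hA2 _ _)
      (om_one_le hθ N h) hκ₁ hκ₂ hτ (Ks_nonneg s p h) (hηH x)
    rw [← DD_phi N η u w φ φn hw hφ x h] at key
    refine key.trans (add_le_add le_rfl ?_)
    refine add_le_add (add_le_add (add_le_add (add_le_add (add_le_add le_rfl ?_) ?_) le_rfl) ?_) ?_ <;>
    exact mul_le_mul' le_rfl (mul_le_mul' (ENNReal.rpow_le_rpow (enorm_dd_le _ _) hp0) le_rfl)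
  have key := int_split (μ := (volume.restrict Ω).prod (volume.restrict Ω)) (gI_int hp hA hA0 hA2 hu hφn hPu hPφ)
    (P := fun q => ENNReal.ofReal α₁ * f1 q.1 (q.2 - q.1)) ((sub_meas (f := f1) m1).const_mul _).aemeasurable
    (ae_of_all _ fun q => pt q.1 (q.2 - q.1))
  rw [← nlPairing_eq hp hA hA0 hA2 hu hφn hPu hPφ] at key
  have e0 : ∫⁻ q, ENNReal.ofReal α₁ * f1 q.1 (q.2 - q.1) ∂((volume.restrict Ω).prod (volume.restrict Ω)) = ENNReal.ofReal α₁ * JO Ω f1 := by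
    rw [lintegral_const_mul' _ _ (by simp), JO_prod (f := f1) m1]
  rw [e0] at key
  refine key.trans (add_le_add le_rfl ?_)
  have q1 : Measurable fun q : Ed d × Ed d => f1 q.1 (q.2 - q.1) := sub_meas (f := f1) m1
  have q2 : Measurable fun q : Ed d × Ed d => f2 q.1 (q.2 - q.1) := sub_meas (f := f2) n2
  have q3 : Measurable fun q : Ed d × Ed d => f3 q.1 (q.2 - q.1) := sub_meas (f := f3) n3
  have q4 : Measurable fun q : Ed d × Ed d => f4 q.1 (q.2 - q.1) := sub_meas (f := f4) n4
  have q5 : Measurable fun q : Ed d × Ed d => f5 q.1 (q.2 - q.1) := sub_meas (f := f5) n5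
  rw [lintegral_add_left (by fun_prop), lintegral_add_left (by fun_prop), lintegral_add_left (by fun_prop),
    lintegral_add_left (by fun_prop), lintegral_add_left (by fun_prop)]
  iterate 6 rw [lintegral_const_mul' _ _ (by simp)]
  rw [JO_prod (f := f1) m1, JO_prod (f := f2) n2, JO_prod (f := f3) n3, JO_prod (f := f4) n4, JO_prod (f := f5) n5, JO_prod (f := f6) n6]
  refine add_le_add (add_le_add (add_le_add (add_le_add (add_le_add le_rfl ?_) ?_) le_rfl) ?_) ?_ <;> refine mul_le_mul' le_rfl ?_
  · exact JO_le (f := f2) n2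
  · exact JO_le (f := f3) n3
  · exact JO_le (f := f5) n5
  · exact JO_le (f := f6) n6

end SectM9

noncomputable section SectM10
variable {d : ℕ}

lemma Kn_prime {s p ε : ℝ} (hs : 0 < s) (hp : 2 ≤ p) (hd : 2 ≤ d) (hε : 0 ≤ ε)
    (hep : ε * p * (p - 1) ≤ s * p / 4) (N : ℕ) {Dm : ℝ} (hD : 1 ≤ Dm) {h : Ed d} (hh : ‖h‖ ≤ Dm) :
    Kn d (s - ε * (p - 1)) p h ≤ ENNReal.ofReal (Dm ^ (ε * p * (p - 1))) * Vt d s p (2 ^ (ε * p)) N h := by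
  have he : 0 ≤ ε * p := by positivity
  have hp1 : 0 < p - 1 := by linarith
  have hθ : (1:ℝ) ≤ 2 ^ (ε * p) := Real.one_le_rpow (by norm_num) he
  have hd' : (2:ℝ) ≤ d := by exact_mod_cast hd
  unfold Kn Vt
  rw [← ENNReal.ofReal_mul (by positivity)]
  apply ENNReal.ofReal_le_ofReal
  by_cases h0 : h = 0
  · have hsp : 0 < s * p := by positivity
    have : Ks d (s - ε * (p - 1)) p h = 0 := by
      unfold Ks
      rw [h0, norm_zero, Real.zero_rpow]
      nlinarith
    rw [this]
    have := om_pos hθ N h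
    have := Ks_nonneg s p h
    positivity
  have hpos : 0 < ‖h‖ := by simpa using h0
  have e1 : Ks d (s - ε * (p - 1)) p h = Ks d s p h * ‖h‖ ^ (ε * p * (p - 1)) := by
    unfold Ks
    rw [← Real.rpow_add hpos]; congr 1; ring
  have hom := om_pos hθ N h
  have key : ‖h‖ ^ (ε * p * (p - 1)) ≤ Dm ^ (ε * p * (p - 1)) * om (2 ^ (ε * p)) N h ^ (1 - p) := by
    rcases le_total ‖h‖ 1 with h1 | h1
    · have a1 := om_le_rpow he N h0 h1
      have a2 : om (2 ^ (ε * p)) N h ^ (p - 1) ≤ (‖h‖ ^ (-(ε * p))) ^ (p - 1) := Real.rpow_le_rpow hom.le a1 hp1.le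
      rw [← Real.rpow_mul hpos.le] at a2
      have e2 : (1 - p) = -(p - 1) := by ring
      rw [e2, Real.rpow_neg hom.le]
      have a3 : (1:ℝ) ≤ Dm ^ (ε * p * (p - 1)) := Real.one_le_rpow hD (by positivity)
      have a4 : 0 < om (2 ^ (ε * p)) N h ^ (p - 1) := by positivity
      rw [← div_eq_mul_inv, le_div_iff₀ a4]
      calc _ ≤ ‖h‖ ^ (ε * p * (p - 1)) * ‖h‖ ^ (-(ε * p) * (p - 1)) := mul_le_mul_of_nonneg_left a2 (by positivity)
        _ = 1 := by rw [← Real.rpow_add hpos]; ring_nf; simp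
        _ ≤ _ := a3
    · have : om (2 ^ (ε * p)) N h ≤ 1 := by
        rcases eq_or_lt_of_le h1 with h1 | h1
        · have := om_le_rpow he N h0 h1.symm.le
          rw [← h1] at this; simpa using this
        · exact (om_eq_one N h1).le
      have : om (2 ^ (ε * p)) N h = 1 := le_antisymm this (om_one_le hθ N h)
      rw [this, Real.one_rpow, mul_one]
      exact Real.rpow_le_rpow hpos.le hh (by positivity)
  rw [e1]
  calc _ ≤ Ks d s p h * (Dm ^ (ε * p * (p - 1)) * om (2 ^ (ε * p)) N h ^ (1 - p)) :=
        mul_le_mul_of_nonneg_left key (Ks_nonneg s p h)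
    _ = _ := by ring

lemma S_est {s p ε : ℝ} (hs : 0 < s) (hp : 2 ≤ p) (hd : 2 ≤ d) (hε : 0 ≤ ε)
    (hep : ε * p * (p - 1) ≤ s * p / 4) (N : ℕ) {Dm : ℝ} (hD : 1 ≤ Dm) {Ω : Set (Ed d)} (hΩ : MeasurableSet Ω)
    (hΩD : ∀ x ∈ Ω, ∀ y ∈ Ω, ‖y - x‖ ≤ Dm) {φ : Ed d → Ed d} (hφ : Measurable φ) (hφl : LocallyIntegrable φ) (n : ℕ) :
    (∫⁻ x in Ω, ENNReal.ofReal (‖Pk n φ x‖ ^ p)) + projGagP d (s - ε * (p - 1)) p Ω (Pk n φ) ≤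
      (∫⁻ x, ‖φ x‖ₑ ^ p) + ENNReal.ofReal (Dm ^ (ε * p * (p - 1))) * En p (Vt d s p (2 ^ (ε * p)) N) φ := by
  have hp0 : 0 ≤ p := by linarith
  have hPm := Pk_meas n hφ
  have hDD := meas_DD' hPm
  have hVm := Vt_meas (d := d) s p (2 ^ (ε * p)) N
  refine add_le_add ?_ ?_
  · refine (setLIntegral_le_lintegral _ _).trans (le_trans (le_of_eq ?_) (Pk_Lp hp n hφ))
    refine lintegral_congr fun x => ?_
    rw [← ofReal_norm, ENNReal.ofReal_rpow_of_nonneg (norm_nonneg _) hp0]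
  · rw [projGagP_eq hp]
    unfold PI
    calc _ ≤ JO Ω (fun x h => ENNReal.ofReal (Dm ^ (ε * p * (p - 1))) * (‖DD (Pk n φ) x h‖ₑ ^ p * Vt d s p (2 ^ (ε * p)) N h)) := by
          refine JO_mono_on hΩ fun x h hx hh => ?_
          have : ‖h‖ ≤ Dm := by simpa using hΩD x hx _ hh
          refine (mul_le_mul' le_rfl (Kn_prime hs hp hd hε hep N hD this)).trans (le_of_eq ?_)
          ring
      _ = ENNReal.ofReal (Dm ^ (ε * p * (p - 1))) * JO Ω (fun x h => (‖DD (Pk n φ) x h‖ₑ ^ p * Vt d s p (2 ^ (ε * p)) N h)) :=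
          JO_const (by simp)
      _ ≤ ENNReal.ofReal (Dm ^ (ε * p * (p - 1))) * En p (Vt d s p (2 ^ (ε * p)) N) (Pk n φ) := by
          refine mul_le_mul' le_rfl ?_
          have hm : Measurable (Function.uncurry fun x h => ‖DD (Pk n φ) x h‖ₑ ^ p * Vt d s p (2 ^ (ε * p)) N h) := by
            change Measurable fun q : Ed d × Ed d => ‖DD (Pk n φ) q.1 q.2‖ₑ ^ p * Vt d s p (2 ^ (ε * p)) N q.2
            fun_prop
          refine (JO_le hm).trans ?_
          refine lintegral_mono fun h => lintegral_mono fun x => mul_le_mul' (ENNReal.rpow_le_rpow ?_ (by linarith)) le_rfl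
          rw [DD_eq_dd]
          exact enorm_dd_le _ _
      _ ≤ _ := mul_le_mul' le_rfl (Pk_En hp n hφ hφl _)

lemma F_young {p : ℝ} (hp : 2 ≤ p) {M f : ℝ} (hM : 0 ≤ M) {S : ℝ≥0∞} (hS : S ≠ ∞) (hf : |f| ≤ M * S.toReal ^ (1 / p))
    {κ : ℝ} (hκ : 0 < κ) :
    ENNReal.ofReal f ≤ ENNReal.ofReal κ * ENNReal.ofReal ((M ^ (1 / (p - 1))) ^ p) + ENNReal.ofReal (κ ^ (1 - p)) * S := by
  have y := young_pow hp hκ (a := M ^ (1 / (p - 1))) (y := S.toReal ^ (1 / p)) (by positivity) (by positivity)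
  have hp1 : p - 1 ≠ 0 := by linarith
  have hp0 : p ≠ 0 := by linarith
  have e1 : (M ^ (1 / (p - 1))) ^ (p - 1) = M := by
    rw [← Real.rpow_mul hM, one_div_mul_cancel hp1, Real.rpow_one]
  have e2 : (S.toReal ^ (1 / p)) ^ p = S.toReal := by
    rw [← Real.rpow_mul ENNReal.toReal_nonneg, one_div_mul_cancel hp0, Real.rpow_one]
  rw [e1, e2] at y
  have := ENNReal.ofReal_le_ofReal (((le_abs_self f).trans hf).trans y)
  refine this.trans (le_of_eq ?_)
  rw [ENNReal.ofReal_add (by positivity) (by positivity), ENNReal.ofReal_mul hκ.le, ENNReal.ofReal_mul (by positivity),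
    ENNReal.ofReal_toReal hS]

lemma exists_kappa {p : ℝ} (hp : 2 ≤ p) {C : ℝ≥0∞} (hC : C ≠ ∞) {δ : ℝ} (hδ : 0 < δ) :
    ∃ κ : ℝ, 0 < κ ∧ ENNReal.ofReal (κ ^ (1 - p)) * C ≤ ENNReal.ofReal δ := by
  refine ⟨1 + C.toReal / δ, by positivity, ?_⟩
  have h0 : (0:ℝ) ≤ C.toReal / δ := by positivity
  have h1 : (1 + C.toReal / δ) ^ (1 - p) ≤ (1 + C.toReal / δ) ^ (-1 : ℝ) :=
    Real.rpow_le_rpow_of_exponent_le (by linarith) (by linarith)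
  rw [Real.rpow_neg_one] at h1
  calc _ ≤ ENNReal.ofReal ((1 + C.toReal / δ)⁻¹) * ENNReal.ofReal C.toReal := by
        rw [ENNReal.ofReal_toReal hC]
        exact mul_le_mul' (ENNReal.ofReal_le_ofReal h1) le_rfl
    _ = ENNReal.ofReal ((1 + C.toReal / δ)⁻¹ * C.toReal) := by rw [ENNReal.ofReal_mul (by positivity)]
    _ ≤ _ := by
        apply ENNReal.ofReal_le_ofReal
        rw [inv_mul_le_iff₀ (by positivity)]
        have : (1 + C.toReal / δ) * δ = δ + C.toReal := by field_simp
        linarith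

lemma absorb {α : ℝ} (hα : 0 < α) {G X c : ℝ≥0∞} (hG : G ≠ ∞) (hc : c ≤ ENNReal.ofReal (α / 2))
    (h : ENNReal.ofReal α * G ≤ X + c * G) : G ≤ (ENNReal.ofReal (α / 2))⁻¹ * X := by
  have e : ENNReal.ofReal α = ENNReal.ofReal (α / 2) + ENNReal.ofReal (α / 2) := by
    rw [← ENNReal.ofReal_add (by positivity) (by positivity)]; ring_nf
  set b := ENNReal.ofReal (α / 2) with hb
  have hb0 : b ≠ 0 := by rw [hb]; simp [hα]
  have hbt : b ≠ ∞ := by simp [hb]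
  rw [e, add_mul] at h
  have h2 : b * G ≤ X := (ENNReal.add_le_add_iff_right (ENNReal.mul_ne_top hbt hG)).1
    (h.trans (add_le_add le_rfl (mul_le_mul' hc le_rfl)))
  calc G = b⁻¹ * (b * G) := by rw [← mul_assoc, ENNReal.inv_mul_cancel hb0 hbt, one_mul]
    _ ≤ _ := mul_le_mul' le_rfl h2

lemma lim_absorb {a X c : ℝ≥0∞} {t : ℕ → ℝ≥0∞} (hc : c ≠ ∞) (ht : Tendsto t atTop (𝓝 0)) (h : ∀ n, a ≤ X + c * t n) : a ≤ X := by
  have h1 : Tendsto (fun n => X + c * t n) atTop (𝓝 (X + c * 0)) :=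
    tendsto_const_nhds.add (ENNReal.Tendsto.const_mul ht (Or.inr hc))
  have := ge_of_tendsto' h1 h
  simpa using this

lemma En_const_mul {p : ℝ} {W W' : Ed d → ℝ≥0∞} {c : ℝ≥0∞} (hc : c ≠ ∞) (h : ∀ z, W z ≤ c * W' z) (v : Ed d → Ed d) :
    En p W v ≤ c * En p W' v := by
  unfold En
  rw [← lintegral_const_mul' _ _ hc]
  refine lintegral_mono fun z => ?_
  rw [← lintegral_const_mul' _ _ hc]
  refine lintegral_mono fun x => ?_
  refine (mul_le_mul' le_rfl (h z)).trans (le_of_eq ?_)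
  ring

lemma locInt_of {p : ℝ} (hp : 2 ≤ p) {w : Ed d → Ed d} (hw : Measurable w) (h : ∫⁻ x, ‖w x‖ₑ ^ p ≠ ∞) : LocallyIntegrable w := by
  have : MemLp w (ENNReal.ofReal p) volume := by
    refine ⟨hw.aestronglyMeasurable, ?_⟩
    rw [eLpNorm_lt_top_iff_lintegral_rpow_enorm_lt_top (by simp; linarith) (by simp), ENNReal.toReal_ofReal (by linarith)]
    exact lt_top_iff_ne_top.2 h
  refine this.locallyIntegrable ?_
  rw [← ENNReal.ofReal_one]
  exact ENNReal.ofReal_le_ofReal (by linarith)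

end SectM10

noncomputable section SectM11
variable {d : ℕ}

lemma Gf_fin {s p θ : ℝ} (hp : 2 ≤ p) (hθ : 1 ≤ θ) (N : ℕ) {Ω : Set (Ed d)} {η : Ed d → ℝ} {H : ℝ} (hηH : ∀ x, |η x| ≤ H)
    {u : Ed d → Ed d} (hI : PI s p Ω u ≠ ∞) : Gf s p θ N Ω η u ≠ ∞ := by
  have h2 : ENNReal.ofReal H ^ p ≠ ∞ := ENNReal.rpow_ne_top_of_nonneg (by linarith) (by simp)
  have hp0 : 0 ≤ p := by linarith
  have : Gf s p θ N Ω η u ≤ (ENNReal.ofReal H ^ p * ENNReal.ofReal (θ ^ N)) * PI s p Ω u := by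
    unfold Gf PI
    rw [← JO_const (by finiteness)]
    refine JO_mono fun x h => ?_
    calc _ ≤ (ENNReal.ofReal H ^ p * ‖DD u x h‖ₑ ^ p) * (ENNReal.ofReal (θ ^ N) * Kn d s p h) := by
          refine mul_le_mul' ?_ (Wt_le_Kn s p hθ N h)
          rw [← ENNReal.mul_rpow_of_nonneg _ _ hp0, enorm_mul]
          refine ENNReal.rpow_le_rpow (mul_le_mul' ?_ le_rfl) hp0
          rw [← ofReal_norm]
          exact ENNReal.ofReal_le_ofReal (hηH x)
      _ = _ := by ring
  exact ne_top_of_le_ne_top (by finiteness) this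

lemma smul_Lp {p : ℝ} (hp : 2 ≤ p) {η : Ed d → ℝ} {H : ℝ} (hηH : ∀ x, |η x| ≤ H) {u : Ed d → Ed d} (hV : ∫⁻ x, ‖u x‖ₑ ^ p ≠ ∞) :
    ∫⁻ x, ‖η x • u x‖ₑ ^ p ≠ ∞ := by
  have hp0 : 0 ≤ p := by linarith
  have h2 : ENNReal.ofReal H ^ p ≠ ∞ := ENNReal.rpow_ne_top_of_nonneg (by linarith) (by simp)
  have : ∫⁻ x, ‖η x • u x‖ₑ ^ p ≤ ENNReal.ofReal H ^ p * ∫⁻ x, ‖u x‖ₑ ^ p := by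
    rw [← lintegral_const_mul' _ _ h2]
    refine lintegral_mono fun x => ?_
    rw [← ENNReal.mul_rpow_of_nonneg _ _ hp0, enorm_smul]
    refine ENNReal.rpow_le_rpow (mul_le_mul' ?_ le_rfl) hp0
    rw [← ofReal_norm]
    exact ENNReal.ofReal_le_ofReal (hηH x)
  exact ne_top_of_le_ne_top (by finiteness) this

/-- the inequality before absorption -/
lemma pre_absorb (hd : 2 ≤ d) {s p : ℝ} (hs : 0 < s) (hs1 : s < 1) (hp : 2 ≤ p) {α₁ α₂ : ℝ} (h1 : 0 < α₁)
    {A : Ed d → Ed d → ℝ} (hA : Measurable (Function.uncurry A))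
    (hA1 : ∀ x y, α₁ ≤ A x y) (hA2 : ∀ x y, A x y ≤ α₂) {Ω : Set (Ed d)} (hΩ : MeasurableSet Ω)
    {Dm : ℝ} (hD : 1 ≤ Dm) (hΩD : ∀ x ∈ Ω, ∀ y ∈ Ω, ‖y - x‖ ≤ Dm)
    {ε : ℝ} (hε : 0 < ε) (he1 : ε * p ≤ 1) (hes : ε * p ≤ (1 - s) / 2 * p) (hep : ε * p * (p - 1) ≤ s * p / 4)
    {η : Ed d → ℝ} (hη : Measurable η) (hηc : HasCompactSupport η) {H L H' L' : ℝ} (hηH : ∀ x, |η x| ≤ H) (hL : 0 ≤ L)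
    (hηL : ∀ x h, |η (x + h) - η x| ≤ L * min 1 ‖h‖)
    (hζH : ∀ x, |zt p (η x)| ≤ H') (hL' : 0 ≤ L') (hζL : ∀ x h, |zt p (η (x + h)) - zt p (η x)| ≤ L' * min 1 ‖h‖)
    {u : Ed d → Ed d} (hu : Measurable u) (hV : ∫⁻ x, ‖u x‖ₑ ^ p ≠ ∞) (hI : PI s p Ω u ≠ ∞)
    {M : ℝ} (hM : 0 ≤ M)
    (hF : ∀ φ : Ed d → Ed d, ContDiff ℝ (⊤ : ℕ∞) φ → HasCompactSupport φ →
      |nlPairing d s p A Ω u φ| ≤ M * (((∫⁻ x in Ω, ENNReal.ofReal (‖φ x‖ ^ p)) +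
                    projGagP d (s - ε * (p - 1)) p Ω φ).toReal) ^ (1 / p))
    (N : ℕ) {G E : ℝ≥0∞} (hG : G = Gf s p (2 ^ (ε * p)) N Ω η u) (hE : E = En p (Wt d s p (2 ^ (ε * p)) N) (fun x => η x • u x))
    (hEt : E ≠ ∞) {κ₁ κ₂ κ₃ : ℝ} (hκ₁ : 0 < κ₁) (hκ₂ : 0 < κ₂) (hκ₃ : 0 < κ₃) :
    ENNReal.ofReal α₁ * G ≤ 
      (ENNReal.ofReal κ₃ * ENNReal.ofReal ((M ^ (1 / (p - 1))) ^ p) + ENNReal.ofReal (κ₃ ^ (1 - p)) *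
        ((ENNReal.ofReal H' ^ p * CT d s p + ENNReal.ofReal (Dm ^ (ε * p * (p - 1))) * Cphi d s p H' L') * E)) +
      (ENNReal.ofReal (α₂ * (κ₁ + (2 ^ (ε * p) - 1))) * G
      + ENNReal.ofReal (α₂ * κ₁ ^ (1 - p)) * (ENNReal.ofReal L ^ p * CM d s p * ∫⁻ x, ‖u x‖ₑ ^ p)
      + ENNReal.ofReal (α₂ * (2 ^ (ε * p) - 1)) * (CR d s p * E)
      + ENNReal.ofReal (α₁ * H ^ p + α₂ * (κ₂ + 1)) * PI s p Ω u
      + ENNReal.ofReal (α₂ * κ₂ ^ (1 - p)) * (CZ d s p L' * E)) := by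
  have hp0 : 0 ≤ p := by linarith
  have hα2 : 0 < α₂ := by linarith [hA1 0 0, hA2 0 0]
  have he : 0 < ε * p := by positivity
  set e := ε * p with hedef
  have hθ : (1:ℝ) < 2 ^ e := Real.one_lt_rpow (by norm_num) he
  set θ : ℝ := 2 ^ e with hθdef
  have hτ : 0 < θ - 1 := by linarith
  obtain ⟨w, hw⟩ : ∃ w : Ed d → Ed d, w = fun x => η x • u x := ⟨_, rfl⟩
  have hwm : Measurable w := by rw [hw]; fun_prop
  have hwp : ∫⁻ x, ‖w x‖ₑ ^ p ≠ ∞ := by rw [hw]; exact smul_Lp hp hηH hV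
  have hwl := locInt_of hp hwm hwp
  rw [← hw] at hE
  obtain ⟨φ, hφ⟩ : ∃ φ : Ed d → Ed d, φ = fun x => zt p (η x) • Tw θ N w x := ⟨_, rfl⟩
  have hztm := zt_meas p
  have hTm := Tw_meas θ N hwm
  have hζm : Measurable fun x => zt p (η x) := hztm.comp hη
  have hφm : Measurable φ := by rw [hφ]; fun_prop
  have q1 : ∫⁻ x, ‖φ x‖ₑ ^ p ≤ ENNReal.ofReal H' ^ p * CT d s p * E := by
    rw [hφ, hE]; exact phi_Lp hd hs hs1 hp he.le he1 hep N hwm hwl hζH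
  have q2 : En p (Vt d s p θ N) φ ≤ Cphi d s p H' L' * E := by
    rw [hφ, hE]; exact phi_est hd hs hs1 hp he.le he1 hes hep N hwm hwl hζm hζH hL' hζL
  have hCT := CT_ne_top hd hs hs1 hp
  have hCphi := Cphi_ne_top hd hs hs1 hp H' L'
  have hH' : ENNReal.ofReal H' ^ p ≠ ∞ := ENNReal.rpow_ne_top_of_nonneg (by linarith) (by simp)
  have hφp : ∫⁻ x, ‖φ x‖ₑ ^ p ≠ ∞ := ne_top_of_le_ne_top (by finiteness) q1
  have hφV : En p (Vt d s p θ N) φ ≠ ∞ := ne_top_of_le_ne_top (by finiteness) q2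
  have hφK : En p (Kn d s p) φ ≠ ∞ :=
    ne_top_of_le_ne_top (by finiteness) (En_const_mul (c := ENNReal.ofReal ((θ ^ N) ^ (p - 1))) (by simp) (Kn_le_Vt s hp hθ.le N) φ)
  have hφl := locInt_of hp hφm hφp
  have hφc : HasCompactSupport φ := by
    rw [hφ]
    refine hηc.mono fun x hx => ?_
    simp only [Function.mem_support] at hx ⊢
    intro h0
    apply hx
    simp [h0, zt]
  have lim := Pk_En_tendsto hs hp hφm hφl hφK
  refine lim_absorb (c := ENNReal.ofReal α₂) (by simp) lim fun n => ?_
  have hnm := Pk_meas n hφm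
  have hPφ : PI s p Ω (Pk n φ) ≠ ∞ := ne_top_of_le_ne_top hφK ((PI_le hp hnm).trans (Pk_En hp n hφm hφl _))
  have key := pair_ineq hp h1 hA hA1 hA2 hθ.le N hη hηH hu hw hφ hnm hI hPφ hκ₁ hκ₂ hτ
  have hS := S_est hs hp hd hε.le hep N hD hΩ hΩD hφm hφl n
  have hSt : (∫⁻ x, ‖φ x‖ₑ ^ p) + ENNReal.ofReal (Dm ^ (ε * p * (p - 1))) * En p (Vt d s p (2 ^ (ε * p)) N) φ ≠ ∞ := by
    finiteness
  have fy := F_young hp hM (ne_top_of_le_ne_top hSt hS) (hF _ (Pk_contDiff n hφl) (Pk_supp n hφc)) hκ₃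
  have r1 := cut_est hp hL hηL hu (Wt_meas (d := d) s p θ N)
  have r2 := R_est hd hs hs1 hp he.le he1 hep N hwm hwl
  have r3 := Z_est hd hs hs1 hp he.le he1 hes hep N hwm hwl (ζ := fun x => zt p (η x)) hL' hζL
  rw [← hE] at r2 r3
  have r4 : ENNReal.ofReal (α₂ * (θ - 1) ^ (1 - p)) * (ENNReal.ofReal (Lr d) ^ p * CBf d s p * ENNReal.ofReal (θ - 1) ^ p * E) =
      ENNReal.ofReal (α₂ * (θ - 1)) * (CR d s p * E) := by
    unfold CR
    have : ENNReal.ofReal (α₂ * (θ - 1)) = ENNReal.ofReal (α₂ * (θ - 1) ^ (1 - p)) * ENNReal.ofReal (θ - 1) ^ p := by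
      rw [ENNReal.ofReal_rpow_of_nonneg hτ.le hp0, ← ENNReal.ofReal_mul (by positivity), mul_assoc, ← Real.rpow_add hτ]
      simp
    rw [this]; ring
  rw [← hG] at key
  refine key.trans ?_
  rw [← add_assoc, add_assoc (ENNReal.ofReal κ₃ * _ + _), ← add_assoc (ENNReal.ofReal κ₃ * _ + _)]
  refine add_le_add (add_le_add ?_ ?_) le_rfl
  · refine fy.trans (add_le_add le_rfl (mul_le_mul' le_rfl (hS.trans ?_)))
    rw [add_mul]
    refine add_le_add q1 ?_
    rw [mul_assoc (ENNReal.ofReal _)]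
    exact mul_le_mul' le_rfl q2
  · refine add_le_add (add_le_add (add_le_add (add_le_add le_rfl ?_) ?_) le_rfl) ?_
    · exact mul_le_mul' le_rfl (r1.trans (mul_le_mul' (mul_le_mul' le_rfl (CM_est hp he.le hes N)) le_rfl))
    · rw [← r4]
      exact mul_le_mul' le_rfl r2
    · exact mul_le_mul' le_rfl r3

end SectM11

noncomputable section SectM12
variable {d : ℕ}

lemma unif_E (hd : 2 ≤ d) {s p : ℝ} (hs : 0 < s) (hs1 : s < 1) (hp : 2 ≤ p) {α₁ α₂ : ℝ} (h1 : 0 < α₁)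
    {A : Ed d → Ed d → ℝ} (hA : Measurable (Function.uncurry A))
    (hA1 : ∀ x y, α₁ ≤ A x y) (hA2 : ∀ x y, A x y ≤ α₂) {Ω : Set (Ed d)} (hΩ : MeasurableSet Ω)
    {Dm : ℝ} (hD : 1 ≤ Dm) (hΩD : ∀ x ∈ Ω, ∀ y ∈ Ω, ‖y - x‖ ≤ Dm)
    {ε : ℝ} (hε : 0 < ε) (he1 : ε * p ≤ 1) (hes : ε * p ≤ (1 - s) / 2 * p) (hep : ε * p * (p - 1) ≤ s * p / 4)
    (hτ1 : α₂ * (2 ^ (ε * p) - 1) ≤ α₁ / 16)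
    (hτ2 : ENNReal.ofReal (α₂ * (2 ^ (ε * p) - 1)) * (CR d s p * (CKorn d s p * 2 ^ p)) ≤ ENNReal.ofReal (α₁ / 8))
    {η : Ed d → ℝ} (hη : Measurable η) (hηc : HasCompactSupport η) {H L H' L' r : ℝ} (hηH : ∀ x, |η x| ≤ H) (hL : 0 ≤ L)
    (hηL : ∀ x h, |η (x + h) - η x| ≤ L * min 1 ‖h‖)
    (hζH : ∀ x, |zt p (η x)| ≤ H') (hL' : 0 ≤ L') (hζL : ∀ x h, |zt p (η (x + h)) - zt p (η x)| ≤ L' * min 1 ‖h‖)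
    (hr : 0 < r) (hr1 : r ≤ 1) (hηr : ∀ x h, η x ≠ 0 → ‖h‖ ≤ r → x + h ∈ Ω) :
    ∃ C : ℝ≥0∞, C ≠ ∞ ∧ ∀ u : Ed d → Ed d, Measurable u → (∀ x, x ∉ Ω → u x = 0) → ∫⁻ x, ‖u x‖ₑ ^ p ≠ ∞ → PI s p Ω u ≠ ∞ →
      ∀ M : ℝ, 0 ≤ M → (∀ φ : Ed d → Ed d, ContDiff ℝ (⊤ : ℕ∞) φ → HasCompactSupport φ →
        |nlPairing d s p A Ω u φ| ≤ M * (((∫⁻ x in Ω, ENNReal.ofReal (‖φ x‖ ^ p)) +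
                    projGagP d (s - ε * (p - 1)) p Ω φ).toReal) ^ (1 / p)) → ∀ N : ℕ,
        En p (Wt d s p (2 ^ (ε * p)) N) (fun x => η x • u x) ≤
          C * (ENNReal.ofReal ((M ^ (1 / (p - 1))) ^ p) + ((∫⁻ x, ‖u x‖ₑ ^ p) + PI s p Ω u)) := by
  have hp0 : 0 ≤ p := by linarith
  have hα2 : 0 < α₂ := by linarith [hA1 0 0, hA2 0 0]
  have he : 0 < ε * p := by positivity
  have hθ : (1:ℝ) < 2 ^ (ε * p) := Real.one_lt_rpow (by norm_num) he
  have hθ2 : (2:ℝ) ^ (ε * p) ≤ 2 := by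
    calc _ ≤ (2:ℝ) ^ (1:ℝ) := Real.rpow_le_rpow_of_exponent_le (by norm_num) he1
      _ = 2 := by norm_num
  have hθs : (2:ℝ) ^ (ε * p) ≤ 2 ^ ((1 - s) / 2 * p) := Real.rpow_le_rpow_of_exponent_le (by norm_num) hes
  have h4 : (2:ℝ≥0∞) ^ p ≠ ∞ := ENNReal.rpow_ne_top_of_nonneg (by linarith) (by simp)
  have hCK : CKorn d s p ≠ ∞ := CKorn_ne_top hp
  have hCT := CT_ne_top hd hs hs1 hp
  have hCphi := Cphi_ne_top hd hs hs1 hp H' L'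
  have hCM := CM_ne_top hd hs hs1 hp
  have hCR := CR_ne_top hd hs hs1 hp
  have hCZ := CZ_ne_top hd hs hs1 hp L'
  have hCV := CV_ne_top hd hs hs1 hp H L hr
  have hH' : ENNReal.ofReal H' ^ p ≠ ∞ := ENNReal.rpow_ne_top_of_nonneg (by linarith) (by simp)
  have hLL : ENNReal.ofReal L ^ p ≠ ∞ := ENNReal.rpow_ne_top_of_nonneg (by linarith) (by simp)
  obtain ⟨B, hB⟩ : ∃ B, B = CKorn d s p * 2 ^ p := ⟨_, rfl⟩
  have hBt : B ≠ ∞ := by rw [hB]; finiteness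
  obtain ⟨Cψ, hCψ⟩ : ∃ B, B = ENNReal.ofReal H' ^ p * CT d s p + ENNReal.ofReal (Dm ^ (ε * p * (p - 1))) * Cphi d s p H' L' := ⟨_, rfl⟩
  have hCψt : Cψ ≠ ∞ := by rw [hCψ]; finiteness
  obtain ⟨κ₂, hκ₂, k2⟩ := exists_kappa hp (C := ENNReal.ofReal α₂ * CZ d s p L' * B) (by finiteness) (by positivity : 0 < α₁ / 8)
  obtain ⟨κ₃, hκ₃, k3⟩ := exists_kappa hp (C := Cψ * B) (by finiteness) (by positivity : 0 < α₁ / 8)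
  obtain ⟨κ₁, hκ₁d⟩ : ∃ κ, κ = α₁ / (16 * α₂) := ⟨_, rfl⟩
  have hκ₁ : 0 < κ₁ := by rw [hκ₁d]; positivity
  obtain ⟨c1, hc1⟩ : ∃ c, c = ENNReal.ofReal (α₂ * (κ₁ + (2 ^ (ε * p) - 1))) := ⟨_, rfl⟩
  obtain ⟨c2, hc2⟩ : ∃ c, c = ENNReal.ofReal (α₂ * κ₁ ^ (1 - p)) := ⟨_, rfl⟩
  obtain ⟨c3, hc3⟩ : ∃ c, c = ENNReal.ofReal (α₂ * (2 ^ (ε * p) - 1)) := ⟨_, rfl⟩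
  obtain ⟨c4, hc4⟩ : ∃ c, c = ENNReal.ofReal (α₁ * H ^ p + α₂ * (κ₂ + 1)) := ⟨_, rfl⟩
  obtain ⟨c5, hc5⟩ : ∃ c, c = ENNReal.ofReal (α₂ * κ₂ ^ (1 - p)) := ⟨_, rfl⟩
  obtain ⟨c6, hc6⟩ : ∃ c, c = ENNReal.ofReal κ₃ := ⟨_, rfl⟩
  obtain ⟨c7, hc7⟩ : ∃ c, c = ENNReal.ofReal (κ₃ ^ (1 - p)) := ⟨_, rfl⟩
  have t1 : c1 ≠ ∞ := by simp [hc1]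
  have t2 : c2 ≠ ∞ := by simp [hc2]
  have t3 : c3 ≠ ∞ := by simp [hc3]
  have t4 : c4 ≠ ∞ := by simp [hc4]
  have t5 : c5 ≠ ∞ := by simp [hc5]
  have t6 : c6 ≠ ∞ := by simp [hc6]
  have t7 : c7 ≠ ∞ := by simp [hc7]
  obtain ⟨CE, hCE⟩ : ∃ c, c = c7 * Cψ + c3 * CR d s p + c5 * CZ d s p L' := ⟨_, rfl⟩
  have tE : CE ≠ ∞ := by rw [hCE]; finiteness
  have hc1' : c1 ≤ ENNReal.ofReal (α₁ / 8) := by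
    rw [hc1]
    apply ENNReal.ofReal_le_ofReal
    have : α₂ * κ₁ = α₁ / 16 := by rw [hκ₁d]; field_simp
    linarith
  have hc : c1 + CE * B ≤ ENNReal.ofReal (α₁ / 2) := by
    have e : ENNReal.ofReal (α₁ / 2) = ENNReal.ofReal (α₁ / 8) + (ENNReal.ofReal (α₁ / 8) + ENNReal.ofReal (α₁ / 8) + ENNReal.ofReal (α₁ / 8)) := by
      rw [← ENNReal.ofReal_add (by positivity) (by positivity), ← ENNReal.ofReal_add (by positivity) (by positivity),
        ← ENNReal.ofReal_add (by positivity) (by positivity)]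
      ring_nf
    rw [e, hCE, add_mul, add_mul]
    refine add_le_add hc1' (add_le_add (add_le_add ?_ ?_) ?_)
    · rw [hc7, mul_assoc]; exact k3
    · rw [hc3, mul_assoc, hB]; exact hτ2
    · refine le_trans (le_of_eq ?_) k2
      rw [hc5, ENNReal.ofReal_mul hα2.le]; ring
  obtain ⟨b, hb⟩ : ∃ c, c = (ENNReal.ofReal (α₁ / 2))⁻¹ := ⟨_, rfl⟩
  have hbt : b ≠ ∞ := by rw [hb]; simp [h1]
  obtain ⟨CX, hCX⟩ : ∃ c, c = c6 + c2 * (ENNReal.ofReal L ^ p * CM d s p) + c4 + CE * (B * CV d s p H L r) := ⟨_, rfl⟩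
  have tX : CX ≠ ∞ := by rw [hCX]; finiteness
  refine ⟨B * (b * CX + CV d s p H L r), by finiteness, ?_⟩
  intro u hu hu0 hV hI M hM hF N
  obtain ⟨V, hVd⟩ : ∃ V, V = ∫⁻ x, ‖u x‖ₑ ^ p := ⟨_, rfl⟩
  obtain ⟨I, hId⟩ : ∃ V, V = PI s p Ω u := ⟨_, rfl⟩
  obtain ⟨MM, hMd⟩ : ∃ V, V = ENNReal.ofReal ((M ^ (1 / (p - 1))) ^ p) := ⟨_, rfl⟩
  obtain ⟨G, hG⟩ : ∃ G, G = Gf s p (2 ^ (ε * p)) N Ω η u := ⟨_, rfl⟩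
  obtain ⟨E, hE⟩ : ∃ E, E = En p (Wt d s p (2 ^ (ε * p)) N) (fun x => η x • u x) := ⟨_, rfl⟩
  have hGt : G ≠ ∞ := by rw [hG]; exact Gf_fin hp hθ.le N hηH hI
  have hEB : E ≤ B * (G + CV d s p H L r * V) := by
    have a1 := korn_om (d := d) hs hs1 hp hθ.le hθ2 hθs N (v := fun x => η x • u x) (by fun_prop) (smul_Lp hp hηH hV)
    have a2 := Dn_loc hp he.le hes N hΩ hu hu0 hη hηH hL hηL hr hr1 hηr
    rw [hE, hB, hVd, hG]
    refine a1.trans ((mul_le_mul' le_rfl a2).trans (le_of_eq ?_))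
    ring
  have hEt : E ≠ ∞ := by
    rw [← hVd] at hV
    exact ne_top_of_le_ne_top (by finiteness) hEB
  have key := pre_absorb hd hs hs1 hp h1 hA hA1 hA2 hΩ hD hΩD hε he1 hes hep hη hηc hηH hL hηL hζH hL' hζL hu hV hI hM hF N hG hE hEt
    hκ₁ hκ₂ hκ₃
  rw [← hc1, ← hc2, ← hc3, ← hc4, ← hc5, ← hc6, ← hc7, ← hCψ, ← hVd, ← hId, ← hMd] at key
  have key2 : ENNReal.ofReal α₁ * G ≤ CX * (MM + (V + I)) + (c1 + CE * B) * G := by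
    refine key.trans ?_
    calc _ = c6 * MM + c2 * (ENNReal.ofReal L ^ p * CM d s p) * V + c4 * I + CE * E + c1 * G := by rw [hCE]; ring
      _ ≤ c6 * MM + c2 * (ENNReal.ofReal L ^ p * CM d s p) * V + c4 * I + CE * (B * (G + CV d s p H L r * V)) + c1 * G := by
          exact add_le_add (add_le_add le_rfl (mul_le_mul' le_rfl hEB)) le_rfl
      _ = c6 * MM + c2 * (ENNReal.ofReal L ^ p * CM d s p) * V + c4 * I + CE * (B * CV d s p H L r) * V + (c1 + CE * B) * G := by ring
      _ ≤ _ := by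
          refine add_le_add ?_ le_rfl
          rw [hCX, add_mul, add_mul, add_mul]
          have s1 : MM ≤ MM + (V + I) := le_self_add
          have s2 : V ≤ MM + (V + I) := le_trans le_self_add le_add_self
          have s3 : I ≤ MM + (V + I) := le_trans le_add_self le_add_self
          exact add_le_add (add_le_add (add_le_add (mul_le_mul' le_rfl s1) (mul_le_mul' le_rfl s2)) (mul_le_mul' le_rfl s3)) (mul_le_mul' le_rfl s2)
  have hGf := absorb h1 hGt hc key2
  rw [← hb] at hGf
  rw [← hE, ← hVd, ← hId, ← hMd]
  refine hEB.trans ?_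
  rw [mul_assoc B]
  refine mul_le_mul' le_rfl ?_
  rw [add_mul, mul_assoc b]
  have s2 : V ≤ MM + (V + I) := le_trans le_self_add le_add_self
  exact add_le_add hGf (mul_le_mul' le_rfl s2)

end SectM12

noncomputable section SectM13
variable {d : ℕ}

lemma rpow_bern {q a b : ℝ} (hq : 0 ≤ q) (hb : 0 ≤ b) (hab : b ≤ a) :
    (a ^ q - b ^ q) * b ≤ q * a ^ q * (a - b) := by
  rcases hb.eq_or_lt with h | hb0
  · rw [← h]; have : 0 ≤ a := hb.trans hab
    simp only [mul_zero, sub_zero]; positivity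
  have ha : 0 < a := hb0.trans_le hab
  have h1 := one_add_mul_self_le_rpow_one_add (s := b / a - 1) (by have : 0 ≤ b / a := by positivity
                                                                   linarith) (p := q + 1) (by linarith)
  have e : 1 + (b / a - 1) = b / a := by ring
  rw [e, Real.div_rpow hb ha.le, Real.rpow_add hb0, Real.rpow_add ha, Real.rpow_one, Real.rpow_one] at h1
  have h2 : 0 < a ^ q := Real.rpow_pos_of_pos ha _
  have h3 := mul_le_mul_of_nonneg_right h1 (by positivity : 0 ≤ a ^ q * a)
  rw [div_mul_cancel₀ _ (by positivity)] at h3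
  have h4 : (1 + (q + 1) * (b / a - 1)) * (a ^ q * a) = a ^ q * (a + (q + 1) * (b - a)) := by
    field_simp
  rw [h4] at h3
  nlinarith

lemma zt_lip {p H : ℝ} (hp : 2 ≤ p) {a b : ℝ} (ha : |a| ≤ H) (hb : |b| ≤ H) :
    |zt p a - zt p b| ≤ (p - 1) * H ^ (p - 2) * |a - b| := by
  wlog hab : |b| ≤ |a| generalizing a b
  · rw [abs_sub_comm, abs_sub_comm a]; exact this hb ha (le_of_not_ge hab)
  have h1 := rpow_bern (q := p - 2) (by linarith) (abs_nonneg b) hab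
  have h2 : |b| ^ (p - 2) ≤ |a| ^ (p - 2) := Real.rpow_le_rpow (abs_nonneg _) hab (by linarith)
  have h3 : |a| ^ (p - 2) ≤ H ^ (p - 2) := Real.rpow_le_rpow (abs_nonneg _) ha (by linarith)
  have h0 : 0 ≤ |a| ^ (p - 2) := by positivity
  have h4 : |a| - |b| ≤ |a - b| := abs_sub_abs_le_abs_sub a b
  unfold zt
  have e : |a| ^ (p - 2) * a - |b| ^ (p - 2) * b = |a| ^ (p - 2) * (a - b) + (|a| ^ (p - 2) - |b| ^ (p - 2)) * b := by ring
  rw [e]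
  calc _ ≤ |a| ^ (p - 2) * |a - b| + (|a| ^ (p - 2) - |b| ^ (p - 2)) * |b| := by
        refine (abs_add_le _ _).trans (le_of_eq ?_)
        rw [abs_mul, abs_mul, abs_of_nonneg h0, abs_of_nonneg (sub_nonneg.2 h2)]
    _ ≤ |a| ^ (p - 2) * |a - b| + (p - 2) * |a| ^ (p - 2) * |a - b| := by
        refine add_le_add le_rfl (h1.trans ?_)
        exact mul_le_mul_of_nonneg_left h4 (mul_nonneg (by linarith) h0)
    _ = (p - 1) * |a| ^ (p - 2) * |a - b| := by ring
    _ ≤ _ := by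
        refine mul_le_mul_of_nonneg_right (mul_le_mul_of_nonneg_left h3 (by linarith)) (abs_nonneg _)

lemma cutoff {η : Ed d → ℝ} (hη : ContDiff ℝ (⊤ : ℕ∞) η) (hηc : HasCompactSupport η) :
    ∃ H L : ℝ, 0 ≤ H ∧ 0 ≤ L ∧ (∀ x, |η x| ≤ H) ∧ ∀ x h, |η (x + h) - η x| ≤ L * min 1 ‖h‖ := by
  obtain ⟨H, hH⟩ := hηc.exists_bound_of_continuous hη.continuous
  have hH0 : 0 ≤ H := (norm_nonneg _).trans (hH 0)
  obtain ⟨K, hK⟩ := (hη.of_le (by norm_cast) : ContDiff ℝ 1 η).lipschitzWith_of_hasCompactSupport hηc one_ne_zero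
  refine ⟨H, max (2 * H) K, hH0, by positivity, hH, fun x h => ?_⟩
  rcases le_total 1 ‖h‖ with h1 | h1
  · rw [min_eq_left h1, mul_one]
    refine le_trans ?_ (le_max_left _ _)
    have := abs_sub (η (x + h)) (η x)
    have a := hH x
    have b := hH (x + h)
    rw [Real.norm_eq_abs] at a b
    linarith
  · rw [min_eq_right h1]
    have := hK.dist_le_mul (x + h) x
    rw [Real.dist_eq, dist_eq_norm, add_sub_cancel_left] at this
    exact this.trans (mul_le_mul_of_nonneg_right (le_max_right _ _) (norm_nonneg _))

lemma radius {η : Ed d → ℝ} {Ω : Set (Ed d)} (hΩ : IsOpen Ω) (hηc : HasCompactSupport η) (hs : tsupport η ⊆ Ω) :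
    ∃ r : ℝ, 0 < r ∧ r ≤ 1 ∧ ∀ x h, η x ≠ 0 → ‖h‖ ≤ r → x + h ∈ Ω := by
  obtain ⟨δ, hδ, h⟩ := hηc.isCompact.exists_cthickening_subset_open hΩ hs
  refine ⟨min δ 1, by positivity, min_le_right _ _, fun x z hx hz => h ?_⟩
  refine Metric.mem_cthickening_of_dist_le (x + z) x δ _ (subset_tsupport _ hx) ?_
  rw [dist_eq_norm, add_sub_cancel_left]
  exact hz.trans (min_le_left _ _)

lemma KnS_le_Wt {s p ε : ℝ} (he : 0 ≤ ε * p) {N : ℕ} {h : Ed d} (hh : (1/2:ℝ) ^ N < ‖h‖) :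
    Kn d (s + ε) p h ≤ ENNReal.ofReal (2 ^ (ε * p)) * Wt d s p (2 ^ (ε * p)) N h := by
  have h0 : 0 < ‖h‖ := lt_trans (by positivity) hh
  unfold Kn Wt
  rw [← ENNReal.ofReal_mul (by positivity)]
  refine ENNReal.ofReal_le_ofReal ?_
  have e : Ks d (s + ε) p h = Ks d s p h * ‖h‖ ^ (-(ε * p)) := by
    unfold Ks
    rw [← Real.rpow_add h0]
    congr 1; ring
  have hlt : lam N ‖h‖ < N ∨ N = 0 := by
    by_contra hc
    push Not at hc
    have h1 : lam N ‖h‖ = N := le_antisymm (lam_le _ _) hc.1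
    have h2 := lam_spec (N := N) (r := ‖h‖) (by omega)
    rw [h1] at h2
    have : (1/2:ℝ) ^ N * 2 ^ N < ‖h‖ * 2 ^ N := mul_lt_mul_of_pos_right hh (by positivity)
    rw [← mul_pow] at this
    norm_num at this
    linarith
  have hk : 1 ≤ ‖h‖ * 2 ^ (lam N ‖h‖ + 1) := by
    rcases hlt with h1 | h1
    · exact (lam_succ h1).le
    · rw [h1] at hh
      simp only [pow_zero] at hh
      have : (1:ℝ) ≤ 2 ^ (lam N ‖h‖ + 1) := one_le_pow₀ (by norm_num)
      nlinarith
  have key : ‖h‖ ^ (-(ε * p)) ≤ 2 ^ (ε * p) * om (2 ^ (ε * p)) N h := by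
    unfold om
    generalize ε * p = e at he
    rw [← pow_succ', Real.rpow_neg h0.le, ← Real.rpow_natCast, ← Real.rpow_mul (by norm_num), mul_comm e, Real.rpow_mul (by norm_num), Real.rpow_natCast]
    rw [inv_le_iff_one_le_mul₀ (by positivity), ← Real.mul_rpow (by positivity) (by positivity), mul_comm]
    exact Real.one_le_rpow hk he
  rw [e]
  calc _ ≤ Ks d s p h * (2 ^ (ε * p) * om (2 ^ (ε * p)) N h) := mul_le_mul_of_nonneg_left key (Ks_nonneg _ _ _)
    _ = _ := by ring

lemma gagP_le {s p ε : ℝ} (hp : 2 ≤ p) (he : 0 ≤ ε * p) {v : Ed d → Ed d} (hv : Measurable v) {B : ℝ≥0∞}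
    (hB : ∀ N, En p (Wt d s p (2 ^ (ε * p)) N) v ≤ B) :
    gagP d (s + ε) p univ v ≤ ENNReal.ofReal (2 ^ (ε * p)) * B := by
  have hKm := Kn_meas (d := d) (s + ε) p
  have hp0 : 0 ≤ p := by linarith
  have e : gagP d (s + ε) p univ v = ∫⁻ h, ∫⁻ x, ‖v (x + h) - v x‖ₑ ^ p * Kn d (s + ε) p h := by
    rw [full_eq (f := fun x h => ‖v (x + h) - v x‖ₑ ^ p * Kn d (s + ε) p h)]
    · unfold gagP
      simp only [Measure.restrict_univ]
      refine lintegral_congr fun x => lintegral_congr fun y => ?_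
      unfold Kn Ks
      rw [add_sub_cancel, enorm_rpow _ hp0, ← ENNReal.ofReal_mul (by positivity), Real.rpow_neg (norm_nonneg _), div_eq_mul_inv]
    · change Measurable fun q : Ed d × Ed d => ‖v (q.1 + q.2) - v q.1‖ₑ ^ p * Kn d (s + ε) p q.2
      fun_prop
  rw [e]
  refine lint_le_of_trunc _ _ ?_ (fun n => (1/2:ℝ) ^ n) ?_ ?_ fun n => ?_
  · simp [ENNReal.zero_rpow_of_pos (by linarith : 0 < p)]
  · exact pow_right_anti₀ (by norm_num) (by norm_num)
  · exact tendsto_pow_atTop_nhds_zero_of_lt_one (by norm_num) (by norm_num)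
  · refine le_trans ?_ (mul_le_mul' le_rfl (hB n))
    unfold En
    rw [← lintegral_const_mul' _ _ (by simp)]
    refine le_trans ?_ (setLIntegral_le_lintegral {h : Ed d | (1/2:ℝ) ^ n < ‖h‖} _)
    refine setLIntegral_mono' (measurableSet_lt measurable_const measurable_norm) fun h hh => ?_
    rw [← lintegral_const_mul' _ _ (by simp)]
    refine lintegral_mono fun x => ?_
    calc _ ≤ _ := mul_le_mul' le_rfl (KnS_le_Wt (s := s) he hh)
      _ = _ := by ring

lemma eps0 (hd : 2 ≤ d) {s p : ℝ} (hs : 0 < s) (hs1 : s < 1) (hp : 2 ≤ p) {α₁ α₂ : ℝ} (h1 : 0 < α₁) (h2 : 0 < α₂) :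
    ∃ ε₀ : ℝ, 0 < ε₀ ∧ ∀ ε, 0 < ε → ε < ε₀ → ε * p ≤ 1 ∧ ε * p ≤ (1 - s) / 2 * p ∧ ε * p * (p - 1) ≤ s * p / 4 ∧
      α₂ * (2 ^ (ε * p) - 1) ≤ α₁ / 16 ∧
      ENNReal.ofReal (α₂ * (2 ^ (ε * p) - 1)) * (CR d s p * (CKorn d s p * 2 ^ p)) ≤ ENNReal.ofReal (α₁ / 8) := by
  have h4 : (2:ℝ≥0∞) ^ p ≠ ∞ := ENNReal.rpow_ne_top_of_nonneg (by linarith) (by simp)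
  have hCK : CKorn d s p ≠ ∞ := CKorn_ne_top hp
  have hCR := CR_ne_top hd hs hs1 hp
  obtain ⟨K, hK⟩ : ∃ K, K = CR d s p * (CKorn d s p * 2 ^ p) := ⟨_, rfl⟩
  have hKt : K ≠ ∞ := by rw [hK]; finiteness
  have hc : Tendsto (fun ε : ℝ => α₂ * ((2:ℝ) ^ (ε * p) - 1) * (K.toReal + 1)) (𝓝 0) (𝓝 0) := by
    have : Continuous fun ε : ℝ => α₂ * ((2:ℝ) ^ (ε * p) - 1) * (K.toReal + 1) := by
      have : Continuous fun ε : ℝ => (2:ℝ) ^ (ε * p) :=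
        Continuous.rpow continuous_const (by fun_prop) (fun _ => Or.inl (by norm_num))
      fun_prop
    have h := this.tendsto 0
    simpa using h
  obtain ⟨δ, hδ, hball⟩ := Metric.eventually_nhds_iff.1 (hc.eventually (gt_mem_nhds (by positivity : 0 < α₁ / 16)))
  have hp1 : 0 < p - 1 := by linarith
  have hs' : 0 < 1 - s := by linarith
  refine ⟨min δ (min (1 / p) (min ((1 - s) / 2) (s / 4 / (p - 1)))), by positivity, fun ε he hε => ?_⟩
  obtain ⟨a1, a2⟩ := lt_min_iff.1 hε
  obtain ⟨a2, a3⟩ := lt_min_iff.1 a2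
  obtain ⟨a3, a4⟩ := lt_min_iff.1 a3
  have hp0 : 0 < p := by linarith
  have hb := hball (y := ε) (by rw [Real.dist_eq, sub_zero, abs_of_pos he]; exact a1)
  have hθ : 0 ≤ α₂ * ((2:ℝ) ^ (ε * p) - 1) := by
    have : (1:ℝ) ≤ 2 ^ (ε * p) := Real.one_le_rpow (by norm_num) (by positivity)
    exact mul_nonneg h2.le (by linarith)
  have hK0 : 0 ≤ K.toReal := ENNReal.toReal_nonneg
  refine ⟨?_, ?_, ?_, ?_, ?_⟩
  · rw [lt_div_iff₀ hp0] at a2; exact a2.le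
  · exact mul_le_mul_of_nonneg_right a3.le hp0.le
  · rw [lt_div_iff₀ hp1] at a4; nlinarith
  · nlinarith
  · rw [← hK, ← ENNReal.ofReal_toReal hKt, ← ENNReal.ofReal_mul hθ]
    refine ENNReal.ofReal_le_ofReal ?_
    nlinarith

end SectM13

noncomputable section SectM14
variable {d : ℕ}

lemma projGagP_congr {s p : ℝ} {Ω : Set (Ed d)} {u v : Ed d → Ed d} (h : u =ᵐ[volume.restrict Ω] v) :
    projGagP d s p Ω u = projGagP d s p Ω v := by
  unfold projGagP
  refine lintegral_congr_ae ?_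
  filter_upwards [h] with x hx
  refine lintegral_congr_ae ?_
  filter_upwards [h] with y hy
  rw [hx, hy]

lemma gagP_congr {s p : ℝ} {u v : Ed d → Ed d} (h : u =ᵐ[volume] v) :
    gagP d s p univ u = gagP d s p univ v := by
  unfold gagP
  simp only [Measure.restrict_univ]
  refine lintegral_congr_ae ?_
  filter_upwards [h] with x hx
  refine lintegral_congr_ae ?_
  filter_upwards [h] with y hy
  rw [hx, hy]

lemma nlPairing_congr {s p : ℝ} {A : Ed d → Ed d → ℝ} {Ω : Set (Ed d)} {u v φ : Ed d → Ed d} (h : u =ᵐ[volume.restrict Ω] v) :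
    nlPairing d s p A Ω u φ = nlPairing d s p A Ω v φ := by
  unfold nlPairing
  refine integral_congr_ae ?_
  filter_upwards [h] with x hx
  refine integral_congr_ae ?_
  filter_upwards [h] with y hy
  unfold Dquot
  rw [hx, hy]

lemma final_pow {p : ℝ} (hp : 2 ≤ p) {G C T : ℝ≥0∞} {M : ℝ} (hM : 0 ≤ M) (hC : C ≠ ∞)
    (h : G ≤ C * (ENNReal.ofReal ((M ^ (1 / (p - 1))) ^ p) + T)) :
    G ^ (1 / p) ≤ ENNReal.ofReal (((C ^ (1 / p)).toReal + 1) * M ^ (1 / (p - 1))) +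
      ENNReal.ofReal ((C ^ (1 / p)).toReal + 1) * T ^ (1 / p) := by
  have hp0 : 0 < p := by linarith
  have hi : 0 ≤ 1 / p := by positivity
  have hi1 : 1 / p ≤ 1 := by rw [div_le_one hp0]; linarith
  have hm : 0 ≤ M ^ (1 / (p - 1)) := by positivity
  have hCt : C ^ (1 / p) ≠ ∞ := ENNReal.rpow_ne_top_of_nonneg hi hC
  have hCle : C ^ (1 / p) ≤ ENNReal.ofReal ((C ^ (1 / p)).toReal + 1) := by
    conv_lhs => rw [← ENNReal.ofReal_toReal hCt]
    exact ENNReal.ofReal_le_ofReal (by linarith)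
  calc G ^ (1 / p) ≤ _ := ENNReal.rpow_le_rpow h hi
    _ = C ^ (1 / p) * (ENNReal.ofReal ((M ^ (1 / (p - 1))) ^ p) + T) ^ (1 / p) := ENNReal.mul_rpow_of_nonneg _ _ hi
    _ ≤ C ^ (1 / p) * (ENNReal.ofReal ((M ^ (1 / (p - 1))) ^ p) ^ (1 / p) + T ^ (1 / p)) :=
        mul_le_mul' le_rfl (ENNReal.rpow_add_le_add_rpow _ _ hi hi1)
    _ = C ^ (1 / p) * (ENNReal.ofReal (M ^ (1 / (p - 1))) + T ^ (1 / p)) := by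
        rw [ENNReal.ofReal_rpow_of_nonneg (by positivity) hi, ← Real.rpow_mul hm, mul_one_div_cancel hp0.ne', Real.rpow_one]
    _ ≤ ENNReal.ofReal ((C ^ (1 / p)).toReal + 1) * (ENNReal.ofReal (M ^ (1 / (p - 1))) + T ^ (1 / p)) :=
        mul_le_mul' hCle le_rfl
    _ = _ := by
        rw [mul_add, ← ENNReal.ofReal_mul (by positivity)]

end SectM14

/-- **Self-improving regularity for the strongly coupled nonlocal system.** Let
`s ∈ (0,1)`, `p ≥ 2`, `d ≥ 2`, `Ω ⊂ ℝ^d` a bounded domain, and `A` measurable, symmetric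
and elliptic (`α₁ ≤ A ≤ α₂`). There is `ε₀ > 0` such that for every `ε ∈ (0,ε₀)` and every
cutoff `η ∈ C_c^∞(Ω)` there is `C > 0` (independent of `u` and `F`) such that: whenever
`u ∈ L^p(Ω;ℝ^d)` with `[u]_{𝒳^s_p(Ω)} < ∞` is a weak solution `⟨𝕃^s_{p,Ω} u, φ⟩ = F(φ)`
for all `φ ∈ C_c^∞(ℝ^d;ℝ^d)`, where `F` is a linear functional with
`|F(φ)| ≤ M (‖φ‖_{L^p(Ω)}^p + [φ]_{𝒳^{s−ε(p−1)}_p(Ω)}^p)^{1/p}`, then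
`[ηu]_{W^{s+ε,p}(ℝ^d)} < ∞` and
`[ηu]_{W^{s+ε,p}(ℝ^d)} ≤ C M^{1/(p−1)} + C (‖u‖_{L^p(Ω)}^p + [u]_{𝒳^s_p(Ω)}^p)^{1/p}`. -/
theorem nonlocal_self_improving_regularity (d : ℕ) (hd : 2 ≤ d) (s p : ℝ)
    (hs : s ∈ Set.Ioo (0 : ℝ) 1) (hp : 2 ≤ p)
    (Ω : Set (Ed d)) (hΩo : IsOpen Ω) (hΩc : IsConnected Ω)
    (hΩb : Bornology.IsBounded Ω)
    (α₁ α₂ : ℝ) (hα₁ : 0 < α₁) (hα : α₁ ≤ α₂)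
    (A : Ed d → Ed d → ℝ) (hAm : Measurable (Function.uncurry A))
    (hAl : ∀ x y, α₁ ≤ A x y) (hAu : ∀ x y, A x y ≤ α₂) (hAsym : ∀ x y, A x y = A y x) :
    ∃ ε₀ : ℝ, 0 < ε₀ ∧
      ∀ ε : ℝ, ε ∈ Set.Ioo 0 ε₀ →
        ∀ η : Ed d → ℝ, ContDiff ℝ (⊤ : ℕ∞) η → HasCompactSupport η → tsupport η ⊆ Ω →
          ∃ C : ℝ, 0 < C ∧
            ∀ (u : Ed d → Ed d) (M : ℝ) (F : (Ed d → Ed d) → ℝ),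
              MemLp u (ENNReal.ofReal p) (volume.restrict Ω) →
              projGagP d s p Ω u < ∞ →
              0 ≤ M →
              (∀ φ ψ : Ed d → Ed d, F (φ + ψ) = F φ + F ψ) →
              (∀ (c : ℝ) (φ : Ed d → Ed d), F (c • φ) = c * F φ) →
              (∀ φ : Ed d → Ed d, ContDiff ℝ (⊤ : ℕ∞) φ → HasCompactSupport φ →
                |F φ| ≤ M * (((∫⁻ x in Ω, ENNReal.ofReal (‖φ x‖ ^ p)) +
                    projGagP d (s - ε * (p - 1)) p Ω φ).toReal) ^ (1 / p)) →
              (∀ φ : Ed d → Ed d, ContDiff ℝ (⊤ : ℕ∞) φ → HasCompactSupport φ →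
                nlPairing d s p A Ω u φ = F φ) →
              gagP d (s + ε) p Set.univ (fun x => η x • u x) < ∞ ∧
              gagSem d (s + ε) p Set.univ (fun x => η x • u x) ≤
                ENNReal.ofReal (C * M ^ (1 / (p - 1))) +
                ENNReal.ofReal C *
                  ((∫⁻ x in Ω, ENNReal.ofReal (‖u x‖ ^ p)) + projGagP d s p Ω u) ^ (1 / p) := by
  have hs0 := hs.1
  have hs1 := hs.2
  have hp0 : 0 ≤ p := by linarith
  obtain ⟨ε₀, hε₀, hE⟩ := eps0 hd hs0 hs1 hp hα₁ (hα₁.trans_le hα)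
  refine ⟨ε₀, hε₀, fun ε hε η hη hηc hηΩ => ?_⟩
  obtain ⟨e1, e2, e3, e4, e5⟩ := hE ε hε.1 hε.2
  have hep : 0 ≤ ε * p := mul_nonneg hε.1.le hp0
  obtain ⟨H, L, hH, hL, hηH, hηL⟩ := cutoff hη hηc
  obtain ⟨r, hr, hr1, hηr⟩ := radius hΩo hηc hηΩ
  have hL' : 0 ≤ (p - 1) * H ^ (p - 2) * L :=
    mul_nonneg (mul_nonneg (by linarith) (by positivity)) hL
  obtain ⟨C, hC, hmain⟩ := unif_E hd hs0 hs1 hp hα₁ hAm hAl hAu hΩo.measurableSet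
    (le_max_left 1 (Metric.diam Ω))
    (fun x hx y hy => by
      rw [← dist_eq_norm]
      exact (Metric.dist_le_diam_of_mem hΩb hy hx).trans (le_max_right _ _))
    hε.1 e1 e2 e3 e4 e5 hη.continuous.measurable hηc hηH hL hηL
    (H' := H ^ (p - 1)) (L' := (p - 1) * H ^ (p - 2) * L)
    (fun x => by
      rw [abs_zt hp]
      exact Real.rpow_le_rpow (abs_nonneg _) (hηH x) (by linarith))
    hL'
    (fun x h => by
      refine (zt_lip hp (hηH _) (hηH _)).trans ?_
      rw [mul_assoc _ L]
      exact mul_le_mul_of_nonneg_left (hηL x h) (mul_nonneg (by linarith) (by positivity)))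
    hr hr1 hηr
  have hC2 : ENNReal.ofReal (2 ^ (ε * p)) * C ≠ ∞ := by finiteness
  refine ⟨((ENNReal.ofReal (2 ^ (ε * p)) * C) ^ (1 / p)).toReal + 1, by positivity, ?_⟩
  intro u M F hu hproj hM _ _ hF hweak
  obtain ⟨u', hu'⟩ : ∃ u', u' = Ω.indicator (hu.1.mk u) := ⟨_, rfl⟩
  have hu'm : Measurable u' := by
    rw [hu']
    exact hu.1.stronglyMeasurable_mk.measurable.indicator hΩo.measurableSet
  have hu'0 : ∀ x, x ∉ Ω → u' x = 0 := fun x hx => by rw [hu']; exact indicator_of_notMem hx _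
  have hae : u =ᵐ[volume.restrict Ω] u' := by
    filter_upwards [hu.1.ae_eq_mk, ae_restrict_mem hΩo.measurableSet] with x hx hxΩ
    rw [hu', indicator_of_mem hxΩ]
    exact hx
  have hV : ∫⁻ x in Ω, ENNReal.ofReal (‖u x‖ ^ p) = ∫⁻ x, ‖u' x‖ₑ ^ p := by
    have h1 : ∫⁻ x in Ω, ENNReal.ofReal (‖u x‖ ^ p) = ∫⁻ x in Ω, ‖u' x‖ₑ ^ p := by
      refine lintegral_congr_ae ?_
      filter_upwards [hae] with x hx
      rw [enorm_rpow _ hp0, hx]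
    rw [h1, ← lintegral_indicator hΩo.measurableSet]
    refine lintegral_congr fun x => ?_
    by_cases hx : x ∈ Ω
    · rw [indicator_of_mem hx]
    · rw [indicator_of_notMem hx, hu'0 x hx, enorm_zero, ENNReal.zero_rpow_of_pos (by linarith)]
  have hVt : ∫⁻ x in Ω, ENNReal.ofReal (‖u x‖ ^ p) ≠ ∞ := by
    have h1 := lintegral_rpow_enorm_lt_top_of_eLpNorm_lt_top
      (p := ENNReal.ofReal p) (by simp; linarith) (by simp) hu.2
    rw [ENNReal.toReal_ofReal hp0] at h1
    simp_rw [enorm_rpow _ hp0] at h1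
    exact h1.ne
  have hPI : projGagP d s p Ω u = PI s p Ω u' := by
    rw [projGagP_congr hae, projGagP_eq hp]
  have hη' : (fun x => η x • u x) =ᵐ[volume] fun x => η x • u' x := by
    filter_upwards [(ae_restrict_iff' hΩo.measurableSet).1 hae] with x hx
    by_cases hxΩ : x ∈ Ω
    · rw [hx hxΩ]
    · have : η x = 0 := by
        by_contra h0
        exact hxΩ (hηΩ (subset_tsupport _ h0))
      rw [this, zero_smul, zero_smul]
  have hb := hmain u' hu'm hu'0 (by rw [← hV]; exact hVt) (by rw [← hPI]; exact hproj.ne) M hM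
    (fun φ hφ hφc => by
      rw [← nlPairing_congr hae, hweak φ hφ hφc]
      exact hF φ hφ hφc)
  rw [← hV, ← hPI] at hb
  have hg := gagP_le (s := s) hp hep (hη.continuous.measurable.smul hu'm) hb
  change gagP d (s + ε) p univ (fun x => η x • u' x) ≤ _ at hg
  rw [← gagP_congr hη', ← mul_assoc] at hg
  refine ⟨lt_of_le_of_lt hg ?_, final_pow hp hM hC2 hg⟩
  have hVlt := hVt.lt_top
  exact ENNReal.mul_lt_top hC2.lt_top (ENNReal.add_lt_top.2 ⟨by simp, ENNReal.add_lt_top.2 ⟨hVlt, hproj⟩⟩)
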